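/- Let (u_p)_{p>1} be a family of nodal solutions of (𝒫_p) satisfying conditions (A) and (B), and define z_p⁻(x) := (p/u_p(x_p⁺))·(−u_p(ε_p x + x_p⁻) − u_p(x_p⁺)) on Ω⁻(ε_p) := (Ω − x_p⁻)/ε_p. Then for every sequence p_n → +∞ there exist a subsequence and μ ∈ (0,1] such that along it z_{p_n}⁻ converges in C²_loc(ℝ²) to U_μ(x) := log(μ/(1 + μ|x|²/8)²); U_μ solves −ΔU_μ = e^{U_μ} on ℝ², U_μ ≤ 0 and ∫_{ℝ²} e^{U_μ} = 8π. If the constant K in condition (B) equals 0, then μ = 1. -/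

import Mathlib

open MeasureTheory Real Set Filter Topology Metric

noncomputable section

/-- The Euclidean plane. -/
abbrev R2 : Type := EuclideanSpace ℝ (Fin 2)

/-- The Laplacian: sum of the two pure second directional derivatives. -/
def lap (u : R2 → ℝ) (x : R2) : ℝ :=
  ∑ i : Fin 2,
    fderiv ℝ (fun y => fderiv ℝ u y (EuclideanSpace.single i 1)) x (EuclideanSpace.single i 1)

/-- Each point of ∂Ω has a neighborhood in which ∂Ω is the graph of a C^∞ function
(in suitable Euclidean coordinates). -/
def SmoothBoundary (Ω : Set R2) : Prop :=
  ∀ x ∈ frontier Ω, ∃ V : Set R2, IsOpen V ∧ x ∈ V ∧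
    ∃ (e : R2 ≃ᵢ R2) (g : ℝ → ℝ), ContDiff ℝ (⊤ : ℕ∞) g ∧
      frontier Ω ∩ V = {y | y ∈ V ∧ e y 1 = g (e y 0)}

/-- A (classical) solution of the Lane–Emden problem `(𝒫_p)` on Ω. -/
def IsSolution (Ω : Set R2) (p : ℝ) (u : R2 → ℝ) : Prop :=
  ContDiffOn ℝ 2 u Ω ∧ ContDiffOn ℝ 1 u (closure Ω) ∧
  (∀ x ∈ Ω, -lap u x = |u x| ^ (p - 1) * u x) ∧
  (∀ x ∈ frontier Ω, u x = 0)

/-- A nodal (sign-changing) function on Ω. -/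
def IsNodal (Ω : Set R2) (u : R2 → ℝ) : Prop :=
  (∃ x ∈ Ω, 0 < u x) ∧ ∃ x ∈ Ω, u x < 0

/-- The energy functional E_p. -/
def energy (Ω : Set R2) (p : ℝ) (u : R2 → ℝ) : ℝ :=
  (1 / 2) * ∫ x in Ω, ‖gradient u x‖ ^ 2 - (1 / (p + 1)) * ∫ x in Ω, |u x| ^ (p + 1)

/-- Condition (A): p·∫_Ω |∇u_p|² → 16πe. -/
def CondA (Ω : Set R2) (u : ℝ → R2 → ℝ) : Prop :=
  Tendsto (fun p : ℝ => p * ∫ x in Ω, ‖gradient (u p) x‖ ^ 2) atTop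
    (𝓝 (16 * π * Real.exp 1))

/-- Condition (B): p·(u_p(x_p⁺) + u_p(x_p⁻)) → K for some K ≥ 0. -/
def CondB (u : ℝ → R2 → ℝ) (xp xm : ℝ → R2) : Prop :=
  ∃ K : ℝ, 0 ≤ K ∧ Tendsto (fun p : ℝ => p * (u p (xp p) + u p (xm p))) atTop (𝓝 K)

/-- ε_p := (p·u_p(x_p⁺)^{p−1})^{−1/2}. -/
def eps (u : ℝ → R2 → ℝ) (xp : ℝ → R2) (p : ℝ) : ℝ :=
  1 / Real.sqrt (p * u p (xp p) ^ (p - 1))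

/-- The rescaling z_p of u_p around x_p⁺. -/
def zp (u : ℝ → R2 → ℝ) (xp : ℝ → R2) (p : ℝ) (x : R2) : ℝ :=
  (p / u p (xp p)) * (u p (eps u xp p • x + xp p) - u p (xp p))

/-- The rescaling z_p⁻ of u_p around x_p⁻ (with the scale ε_p of the maximum). -/
def zm (u : ℝ → R2 → ℝ) (xp xm : ℝ → R2) (p : ℝ) (x : R2) : ℝ :=
  (p / u p (xp p)) * (-u p (eps u xp p • x + xm p) - u p (xp p))

/-- Convergence in C²_loc(ℝ²) of a family of functions f_i defined on sets D_i:
every compact set K is eventually contained in D_i, and on K all derivatives up to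
order 2 converge uniformly. -/
def TendstoC2loc {ι : Type} (l : Filter ι) (D : ι → Set R2) (f : ι → R2 → ℝ)
    (g : R2 → ℝ) : Prop :=
  ∀ K : Set R2, IsCompact K →
    (∀ᶠ i in l, K ⊆ D i) ∧
    ∀ n : ℕ, n ≤ 2 →
      TendstoUniformlyOn (fun i x => iteratedFDeriv ℝ n (f i) x)
        (fun x => iteratedFDeriv ℝ n g x) l K

/-- The standard bubble U(x) = −2 log(1 + |x|²/8). -/
def stdBubble (x : R2) : ℝ := -2 * Real.log (1 + ‖x‖ ^ 2 / 8)

/-- The bubble U_μ(x) = log(μ/(1 + μ|x|²/8)²). -/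
def bubble (μ : ℝ) (x : R2) : ℝ := Real.log (μ / (1 + μ * ‖x‖ ^ 2 / 8) ^ 2)

/-- A C^∞ function compactly supported in S. -/
def CcSmoothIn (S : Set R2) (v : R2 → ℝ) : Prop :=
  ContDiff ℝ (⊤ : ℕ∞) v ∧ HasCompactSupport v ∧ tsupport v ⊆ S

/-- The quadratic form of the linearized operator at u. -/
def Qform (p : ℝ) (u v : R2 → ℝ) : ℝ :=
  ∫ x, (‖gradient v x‖ ^ 2 - p * |u x| ^ (p - 1) * v x ^ 2)

/-- Morse index one hypothesis (M): for p large, the quadratic form of the linearized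
operator is negative somewhere on C_c^∞ of the positive nodal domain, but is not
negative definite on any 2-dimensional subspace. -/
def MorseOne (Ω : Set R2) (u : ℝ → R2 → ℝ) : Prop :=
  ∀ᶠ p : ℝ in atTop,
    (∃ v : R2 → ℝ, CcSmoothIn {x ∈ Ω | 0 < u p x} v ∧ Qform p (u p) v < 0) ∧
    ¬ ∃ v w : R2 → ℝ, CcSmoothIn {x ∈ Ω | 0 < u p x} v ∧
        CcSmoothIn {x ∈ Ω | 0 < u p x} w ∧
        LinearIndependent ℝ ![v, w] ∧
        ∀ a b : ℝ, ¬(a = 0 ∧ b = 0) →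
          Qform p (u p) (fun x => a * v x + b * w x) < 0

/-- The `i`-th standard unit vector of the plane. -/
abbrev ei (i : Fin 2) : R2 := EuclideanSpace.single i 1

/-- The `i`-th partial derivative. -/
def pd (i : Fin 2) (u : R2 → ℝ) (x : R2) : ℝ := fderiv ℝ u x (ei i)

/-- The discrete (five-point) Laplacian with step `h`, not normalized. -/
def secDiff (u : R2 → ℝ) (x : R2) (h : ℝ) : ℝ :=
  ∑ i : Fin 2, (u (x + h • ei i) + u (x - h • ei i) - 2 * u x)

lemma lap_eq_pd (u : R2 → ℝ) (x : R2) : lap u x = pd 0 (pd 0 u) x + pd 1 (pd 1 u) x := by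
  rw [lap, Fin.sum_univ_two]
  rfl

lemma norm_ei (i : Fin 2) : ‖ei i‖ = 1 := by simp [ei]

lemma tendsto_second_difference {g : ℝ → ℝ} (hg : ContDiffAt ℝ 2 g 0) :
    Tendsto (fun h => (g h + g (-h) - 2 * g 0) / h ^ 2) (𝓝[≠] 0) (𝓝 (deriv (deriv g) 0)) := by
  have hd : ∀ᶠ h in 𝓝 (0:ℝ), DifferentiableAt ℝ g h := by
    filter_upwards [hg.eventually (by simp)] with h hh
    exact hh.differentiableAt (by norm_num)
  have hneg : Tendsto (fun h : ℝ => -h) (𝓝 0) (𝓝 0) := by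
    simpa using (continuous_neg.tendsto (0:ℝ))
  have hd' : ∀ᶠ h in 𝓝 (0:ℝ), DifferentiableAt ℝ g (-h) := hneg.eventually hd
  have h2 : HasDerivAt (deriv g) (deriv (deriv g) 0) 0 := by
    have h1 : ContDiffAt ℝ 1 (deriv g) 0 := by
      have := hg.fderiv_right (m := 1) (by norm_num)
      have h3 : deriv g = fun x => fderiv ℝ g x 1 := by ext x; simp
      rw [h3]
      exact this.clm_apply contDiffAt_const
    exact (h1.differentiableAt (by norm_num)).hasDerivAt
  have key : Tendsto (fun h => (deriv g h - deriv g (-h)) / (2 * h)) (𝓝[≠] 0)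
      (𝓝 (deriv (deriv g) 0)) := by
    have t1 := h2.tendsto_slope
    have hneg' : Tendsto (fun h : ℝ => -h) (𝓝[≠] 0) (𝓝[≠] 0) := by
      refine tendsto_nhdsWithin_iff.2 ⟨hneg.mono_left nhdsWithin_le_nhds, ?_⟩
      filter_upwards [self_mem_nhdsWithin] with h hh
      simpa using hh
    have t2 := t1.comp hneg'
    have t3 := (t1.add t2).div_const 2
    have : (deriv (deriv g) 0 + deriv (deriv g) 0) / 2 = deriv (deriv g) 0 := by ring
    rw [this] at t3
    refine t3.congr' ?_
    filter_upwards [self_mem_nhdsWithin] with h hh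
    have : h ≠ 0 := hh
    simp only [slope_def_field, Function.comp, sub_zero]
    field_simp
    ring
  refine HasDerivAt.lhopital_zero_nhdsNE (f' := fun h => deriv g h - deriv g (-h))
    (g' := fun h => 2 * h) ?_ ?_ ?_ ?_ ?_ key
  · filter_upwards [hd.filter_mono nhdsWithin_le_nhds, hd'.filter_mono nhdsWithin_le_nhds]
      with h h1 h2
    have a := h1.hasDerivAt
    have b : HasDerivAt (fun h => g (-h)) (-(deriv g (-h))) h := by
      have := h2.hasDerivAt.comp h (hasDerivAt_neg h)
      rw [mul_neg_one] at this
      exact this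
    simpa [sub_eq_add_neg] using (a.add b).sub_const (2 * g 0)
  · filter_upwards with h
    simpa using hasDerivAt_pow 2 h
  · filter_upwards [self_mem_nhdsWithin] with h hh
    simpa using hh
  · have c : ContinuousAt (fun h => g h + g (-h) - 2 * g 0) 0 := by
      have c1 : ContinuousAt g 0 := hg.continuousAt
      have c2 : ContinuousAt (fun h => g (-h)) 0 :=
        ContinuousAt.comp (by simpa using c1) continuous_neg.continuousAt
      exact (c1.add c2).sub continuousAt_const
    have := c.tendsto
    simp only [neg_zero] at this
    have h0 : g 0 + g 0 - 2 * g 0 = 0 := by ring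
    rw [h0] at this
    exact this.mono_left nhdsWithin_le_nhds
  · have : Tendsto (fun h : ℝ => h ^ 2) (𝓝 0) (𝓝 (0 ^ 2)) := (continuous_pow 2).tendsto 0
    simpa using this.mono_left nhdsWithin_le_nhds

lemma contDiffAt_pd {u : R2 → ℝ} {x : R2} {m n : WithTop ℕ∞} (hu : ContDiffAt ℝ n u x)
    (hmn : m + 1 ≤ n) (i : Fin 2) : ContDiffAt ℝ m (pd i u) x :=
  (hu.fderiv_right hmn).clm_apply contDiffAt_const

lemma contDiff_pd {u : R2 → ℝ} {m n : WithTop ℕ∞} (hu : ContDiff ℝ n u)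
    (hmn : m + 1 ≤ n) (i : Fin 2) : ContDiff ℝ m (pd i u) :=
  (hu.fderiv_right hmn).clm_apply contDiff_const

lemma hasDerivAt_line {u : R2 → ℝ} {x : R2} (v : R2) {t : ℝ}
    (hu : DifferentiableAt ℝ u (x + t • v)) :
    HasDerivAt (fun s : ℝ => u (x + s • v)) (fderiv ℝ u (x + t • v) v) t := by
  have h1 : HasDerivAt (fun s : ℝ => x + s • v) v t := by
    simpa using ((hasDerivAt_id t).smul_const v).const_add x
  exact hu.hasFDerivAt.comp_hasDerivAt t h1

lemma tendsto_secDiff {u : R2 → ℝ} {x : R2} (hu : ContDiffAt ℝ 2 u x) :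
    Tendsto (fun h => secDiff u x h / h ^ 2) (𝓝[≠] 0) (𝓝 (lap u x)) := by
  have key : ∀ i : Fin 2, Tendsto (fun h : ℝ =>
      (u (x + h • ei i) + u (x - h • ei i) - 2 * u x) / h ^ 2) (𝓝[≠] 0)
      (𝓝 (pd i (pd i u) x)) := by
    intro i
    have hline : ContDiff ℝ 2 (fun s : ℝ => x + s • ei i) := by fun_prop
    have hg : ContDiffAt ℝ 2 (fun s : ℝ => u (x + s • ei i)) 0 :=
      ContDiffAt.comp (0:ℝ) (by simpa using hu) hline.contDiffAt
    have ht : Tendsto (fun s : ℝ => x + s • ei i) (𝓝 0) (𝓝 x) := by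
      simpa using hline.continuous.tendsto 0
    have h1 : deriv (fun s : ℝ => u (x + s • ei i)) =ᶠ[𝓝 0] fun s => pd i u (x + s • ei i) := by
      filter_upwards [ht.eventually (hu.eventually (by simp))] with s hs
      exact (hasDerivAt_line (ei i) (hs.differentiableAt (by norm_num))).deriv
    have h2 : deriv (deriv (fun s : ℝ => u (x + s • ei i))) 0 = pd i (pd i u) x := by
      rw [h1.deriv_eq]
      have hp : DifferentiableAt ℝ (pd i u) (x + (0:ℝ) • ei i) := by
        simpa using (contDiffAt_pd (m := 1) hu (by norm_num) i).differentiableAt (by norm_num)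
      rw [(hasDerivAt_line (ei i) hp).deriv]
      simp [pd]
    have := tendsto_second_difference hg
    rw [h2] at this
    refine this.congr fun h => ?_
    simp [sub_eq_add_neg]
  have := (key 0).add (key 1)
  rw [lap_eq_pd]
  refine this.congr fun h => ?_
  simp only [secDiff, Fin.sum_univ_two]
  ring

lemma lap_eq_of_tendsto {u : R2 → ℝ} {x : R2} {a : ℝ} (hu : ContDiffAt ℝ 2 u x)
    (h : Tendsto (fun h => secDiff u x h / h ^ 2) (𝓝[≠] 0) (𝓝 a)) : lap u x = a :=
  tendsto_nhds_unique (tendsto_secDiff hu) h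

lemma tendsto_smul_ei (x : R2) (i : Fin 2) :
    Tendsto (fun h : ℝ => x + h • ei i) (𝓝[≠] 0) (𝓝 x) := by
  have hline : Continuous (fun s : ℝ => x + s • ei i) := by fun_prop
  simpa using (hline.tendsto 0).mono_left nhdsWithin_le_nhds

lemma tendsto_smul_ei' (x : R2) (i : Fin 2) :
    Tendsto (fun h : ℝ => x - h • ei i) (𝓝[≠] 0) (𝓝 x) := by
  have hline : Continuous (fun s : ℝ => x - s • ei i) := by fun_prop
  simpa using (hline.tendsto 0).mono_left nhdsWithin_le_nhds

lemma IsLocalMax.eventually_secDiff_nonpos {F : R2 → ℝ} {x : R2} (hF : IsLocalMax F x) :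
    ∀ᶠ h in 𝓝[≠] 0, secDiff F x h ≤ 0 := by
  filter_upwards [(tendsto_smul_ei x 0).eventually hF, (tendsto_smul_ei x 1).eventually hF,
    (tendsto_smul_ei' x 0).eventually hF, (tendsto_smul_ei' x 1).eventually hF]
    with h h1 h2 h3 h4
  simp only [secDiff, Fin.sum_univ_two]
  linarith

/-- A function whose normalized discrete Laplacian has a positive limit has no local maximum. -/
lemma not_isLocalMax_of_tendsto {F : R2 → ℝ} {x : R2} {a : ℝ}
    (h : Tendsto (fun h => secDiff F x h / h ^ 2) (𝓝[≠] 0) (𝓝 a)) (ha : 0 < a) :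
    ¬ IsLocalMax F x := by
  intro hF
  have h1 := hF.eventually_secDiff_nonpos
  have h2 := h.eventually (lt_mem_nhds ha)
  obtain ⟨t, ht1, ht2⟩ := (h1.and h2).exists
  have : secDiff F x t / t ^ 2 ≤ 0 := div_nonpos_of_nonpos_of_nonneg ht1 (by positivity)
  linarith

lemma norm_add_smul_ei_sq (x : R2) (h : ℝ) (i : Fin 2) :
    ‖x + h • ei i‖ ^ 2 = ‖x‖ ^ 2 + 2 * h * x i + h ^ 2 := by
  fin_cases i <;> simp [EuclideanSpace.norm_sq_eq, Fin.sum_univ_two, ei] <;> ring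

lemma norm_sub_smul_ei_sq (x : R2) (h : ℝ) (i : Fin 2) :
    ‖x - h • ei i‖ ^ 2 = ‖x‖ ^ 2 - 2 * h * x i + h ^ 2 := by
  have := norm_add_smul_ei_sq x (-h) i
  rw [neg_smul, ← sub_eq_add_neg] at this
  rw [this]; ring

lemma secDiff_norm_sq (c x : R2) (h : ℝ) :
    secDiff (fun y => ‖y - c‖ ^ 2) x h = 4 * h ^ 2 := by
  simp only [secDiff, Fin.sum_univ_two]
  have e1 : ∀ v : R2, x + v - c = (x - c) + v := fun v => by abel
  have e2 : ∀ v : R2, x - v - c = (x - c) - v := fun v => by abel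
  simp only [e1, e2, norm_add_smul_ei_sq, norm_sub_smul_ei_sq]
  ring

/-- Reflection across the line orthogonal to the `i`-th axis. -/
def axisReflection (i : Fin 2) (y : R2) : R2 := y - (2 * y i) • ei i

lemma continuous_axisReflection (i : Fin 2) : Continuous (axisReflection i) := by
  unfold axisReflection
  fun_prop

lemma norm_axisReflection (i : Fin 2) (y : R2) : ‖axisReflection i y‖ = ‖y‖ := by
  have : ‖axisReflection i y‖ ^ 2 = ‖y‖ ^ 2 := by
    rw [axisReflection, norm_sub_smul_ei_sq]; ring
  exact (sq_eq_sq₀ (norm_nonneg _) (norm_nonneg _)).1 this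

lemma secDiff_comp_axisReflection (u : R2 → ℝ) (i : Fin 2) (x y : R2) (h : ℝ) :
    secDiff (fun y => u (x + axisReflection i y)) y h = secDiff u (x + axisReflection i y) h := by
  have e1 : ∀ j : Fin 2, ∀ h : ℝ, j ≠ i →
      x + axisReflection i (y + h • ei j) = x + axisReflection i y + h • ei j := by
    intro j h hj
    ext k
    simp [axisReflection, ei, hj.symm]
    ring
  have e2 : ∀ h : ℝ,
      x + axisReflection i (y + h • ei i) = x + axisReflection i y - h • ei i := by
    intro h
    ext k
    by_cases hk : k = i <;> simp [axisReflection, ei, hk]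
    ring
  have e1' : ∀ j : Fin 2, ∀ h : ℝ, j ≠ i →
      x + axisReflection i (y - h • ei j) = x + axisReflection i y - h • ei j := by
    intro j h hj
    have := e1 j (-h) hj
    simpa [sub_eq_add_neg] using this
  have e2' : ∀ h : ℝ,
      x + axisReflection i (y - h • ei i) = x + axisReflection i y + h • ei i := by
    intro h
    have := e2 (-h)
    simpa [sub_eq_add_neg] using this
  simp only [secDiff]
  refine Finset.sum_congr rfl fun j _ => ?_
  by_cases hj : j = i
  · subst hj
    simp only [e2, e2']; ring
  · simp only [e1 j h hj, e1' j h hj]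

lemma secDiff_coord (i : Fin 2) (x : R2) (h : ℝ) : secDiff (fun y => y i) x h = 0 := by
  fin_cases i <;> simp [secDiff, ei] <;> ring

lemma secDiff_coord_sq (i : Fin 2) (x : R2) (h : ℝ) :
    secDiff (fun y => y i ^ 2) x h = 2 * h ^ 2 := by
  fin_cases i <;> simp [secDiff, ei] <;> ring

lemma lap_neg {u : R2 → ℝ} {x : R2} (hu : ContDiffAt ℝ 2 u x) :
    lap (fun y => -u y) x = -lap u x := by
  refine lap_eq_of_tendsto hu.neg ((tendsto_secDiff hu).neg.congr fun h => ?_)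
  simp only [secDiff, Fin.sum_univ_two]
  ring

lemma lap_sub {u v : R2 → ℝ} {x : R2} (hu : ContDiffAt ℝ 2 u x) (hv : ContDiffAt ℝ 2 v x) :
    lap (fun y => u y - v y) x = lap u x - lap v x := by
  refine lap_eq_of_tendsto (hu.sub hv)
    (((tendsto_secDiff hu).sub (tendsto_secDiff hv)).congr fun h => ?_)
  simp only [secDiff, Fin.sum_univ_two]
  ring

lemma lap_comp_smul_add {u : R2 → ℝ} {a b c r : ℝ} {x k : R2}
    (hu : ContDiffAt ℝ 2 u (r • x + k)) :
    lap (fun y => a * (b * u (r • y + k) + c)) x = a * b * r ^ 2 * lap u (r • x + k) := by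
  have hcomp : ContDiffAt ℝ 2 (fun y => u (r • y + k)) x :=
    ContDiffAt.comp x hu (by fun_prop)
  refine lap_eq_of_tendsto (contDiffAt_const.mul ((contDiffAt_const.mul hcomp).add
    contDiffAt_const)) ?_
  have e1 : ∀ (h : ℝ) (i : Fin 2), r • (x + h • ei i) + k = (r • x + k) + (r * h) • ei i := by
    intro h i; rw [smul_add, smul_smul]; abel
  have e2 : ∀ (h : ℝ) (i : Fin 2), r • (x - h • ei i) + k = (r • x + k) - (r * h) • ei i := by
    intro h i; rw [smul_sub, smul_smul]; abel
  have hs : ∀ h, secDiff (fun y => a * (b * u (r • y + k) + c)) x h =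
      a * b * secDiff u (r • x + k) (r * h) := by
    intro h
    simp only [secDiff, Fin.sum_univ_two, e1, e2]
    ring
  simp only [hs]
  by_cases hr : r = 0
  · subst hr
    have : ∀ y : R2, secDiff u y 0 = 0 := by
      intro y
      simp [secDiff]
      ring
    simp [this]
  · have ht : Tendsto (fun h : ℝ => r * h) (𝓝[≠] 0) (𝓝[≠] 0) := by
      refine tendsto_nhdsWithin_iff.2 ⟨?_, ?_⟩
      · have : Continuous fun h : ℝ => r * h := by fun_prop
        simpa using (this.tendsto 0).mono_left nhdsWithin_le_nhds
      · filter_upwards [self_mem_nhdsWithin] with h hh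
        simpa [hr] using hh
    have := (((tendsto_secDiff hu).comp ht).const_mul (a * b * r ^ 2))
    refine this.congr' ?_
    filter_upwards [self_mem_nhdsWithin] with h hh
    have : h ≠ 0 := hh
    simp only [Function.comp]
    field_simp

lemma pd_le_of_bounds {u : R2 → ℝ} {x : R2} {d A N : ℝ} (hd : 0 < d) (hN : 0 < N)
    (hu : ∀ y ∈ closedBall x d, ContDiffAt ℝ 2 u y)
    (hA : ∀ y ∈ closedBall x d, |u y| ≤ A) (hL : ∀ y ∈ closedBall x d, |lap u y| ≤ N)
    (i : Fin 2) : pd i u x ≤ 2 * A / d + N * d := by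
  have hA0 : 0 ≤ A := (abs_nonneg _).trans (hA x (mem_closedBall_self hd.le))
  set α := A / d ^ 2 with hα
  have hα0 : 0 ≤ α := by positivity
  set γ := 2 * α + N with hγ
  have hγ0 : 0 < γ := by positivity
  set β := γ * d with hβ
  have hβ' : β = 2 * A / d + N * d := by rw [hβ, hγ, hα]; field_simp
  have hmem : ∀ y : R2, ‖y‖ ≤ d → x + y ∈ closedBall x d := by
    intro y hy; simpa [mem_closedBall, dist_eq_norm] using hy
  have hmem' : ∀ y : R2, ‖y‖ ≤ d → x + axisReflection i y ∈ closedBall x d := fun y hy =>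
    hmem _ (by rwa [norm_axisReflection])
  set F : R2 → ℝ := fun y => (u (x + y) - u (x + axisReflection i y)) / 2
    - (α * ‖y‖ ^ 2 + β * y i - γ * y i ^ 2) with hF
  set D : Set R2 := closedBall 0 d ∩ {y | 0 ≤ y i} with hD
  have hDc : IsCompact D := by
    refine (isCompact_closedBall 0 d).inter_right (isClosed_le continuous_const (by fun_prop))
  have hFc : ContinuousOn F D := by
    intro y hy
    have hy1 : ‖y‖ ≤ d := by simpa using hy.1
    have c1 : ContinuousAt (fun y => u (x + y)) y :=
      ContinuousAt.comp (f := fun y => x + y) (hu _ (hmem y hy1)).continuousAt (by fun_prop)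
    have c2 : ContinuousAt (fun y => u (x + axisReflection i y)) y :=
      ContinuousAt.comp (f := fun y => x + axisReflection i y) (hu _ (hmem' y hy1)).continuousAt
        (continuous_const.add (continuous_axisReflection i)).continuousAt
    have c3 : ContinuousAt (fun y : R2 => α * ‖y‖ ^ 2 + β * y i - γ * y i ^ 2) y := by fun_prop
    exact (((c1.sub c2).div_const 2).sub c3).continuousWithinAt
  obtain ⟨y₀, hy₀, hmax⟩ := hDc.exists_isMaxOn ⟨0, by simp [hD, hd.le]⟩ hFc
  have hy1 : ‖y₀‖ ≤ d := by simpa using hy₀.1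
  have hy2 : 0 ≤ y₀ i := hy₀.2
  have hcoord : y₀ i ≤ ‖y₀‖ := (le_abs_self _).trans (PiLp.norm_apply_le y₀ i)
  have hF0 : F y₀ ≤ 0 := by
    rcases hy2.eq_or_lt with h0 | h0
    · have : axisReflection i y₀ = y₀ := by simp [axisReflection, ← h0]
      simp only [hF, this, ← h0]
      have : 0 ≤ α * ‖y₀‖ ^ 2 := by positivity
      linarith
    rcases hy1.eq_or_lt with h1 | h1
    · have a1 := abs_le.1 (hA _ (hmem y₀ hy1))
      have a2 := abs_le.1 (hA _ (hmem' y₀ hy1))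
      have a3 : α * ‖y₀‖ ^ 2 = A := by rw [h1, hα]; field_simp
      have a4 : 0 ≤ γ * (y₀ i * (d - y₀ i)) := by
        have : 0 ≤ d - y₀ i := by linarith
        positivity
      simp only [hF]
      nlinarith
    · exfalso
      have hloc : IsLocalMax F y₀ := by
        refine hmax.isLocalMax ?_
        have o1 : IsOpen {y : R2 | 0 < y i} := isOpen_lt continuous_const (by fun_prop)
        filter_upwards [isOpen_ball.mem_nhds (show y₀ ∈ ball (0:R2) d by simpa using h1),
          o1.mem_nhds h0] with y ha hb
        exact ⟨ball_subset_closedBall ha, le_of_lt hb⟩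
      have t1 := tendsto_secDiff (hu _ (hmem y₀ hy1))
      have t2 := tendsto_secDiff (hu _ (hmem' y₀ hy1))
      have t3 := ((t1.sub t2).div_const 2).sub_const (4 * α - 2 * γ)
      refine not_isLocalMax_of_tendsto (F := F) (t3.congr' ?_) ?_ hloc
      · filter_upwards [self_mem_nhdsWithin] with h hh
        have hh' : h ≠ 0 := hh
        have s1 := secDiff_comp_axisReflection u i x y₀ h
        have s2 := secDiff_norm_sq 0 y₀ h
        have s3 := secDiff_coord i y₀ h
        have s4 := secDiff_coord_sq i y₀ h
        have s0 : secDiff (fun y => u (x + y)) y₀ h = secDiff u (x + y₀) h := by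
          simp only [secDiff, add_assoc, add_sub_assoc]
        have : secDiff F y₀ h = (secDiff (fun y => u (x + y)) y₀ h -
            secDiff (fun y => u (x + axisReflection i y)) y₀ h) / 2
            - (α * secDiff (fun y : R2 => ‖y - 0‖ ^ 2) y₀ h + β * secDiff (fun y : R2 => y i) y₀ h
              - γ * secDiff (fun y : R2 => y i ^ 2) y₀ h) := by
          simp only [secDiff, Fin.sum_univ_two, hF, sub_zero]
          ring
        rw [this, s0, s1, s2, s3, s4]
        field_simp
        ring
      · have a1 := abs_le.1 (hL _ (hmem y₀ hy1))
        have a2 := abs_le.1 (hL _ (hmem' y₀ hy1))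
        have : 4 * α - 2 * γ = -(2 * N) := by rw [hγ]; ring
        linarith
  have hle : ∀ s ∈ Icc 0 d, (u (x + s • ei i) - u (x + s • (-ei i))) / 2
      - (α * s ^ 2 + β * s - γ * s ^ 2) ≤ 0 := by
    intro s hs
    have hsD : s • ei i ∈ D := by
      refine ⟨?_, ?_⟩
      · simpa [norm_smul, abs_of_nonneg hs.1] using hs.2
      · simpa [ei] using hs.1
    have := (hmax hsD).trans hF0
    have hr : axisReflection i (s • ei i) = s • (-ei i) := by
      rw [axisReflection]; simp [ei]; module
    have h1 : ‖s • ei i‖ = s := by simp [norm_smul, abs_of_nonneg hs.1]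
    simp only [hF, hr, h1] at this
    simpa [ei] using this
  have hdx : DifferentiableAt ℝ u x :=
    (hu x (mem_closedBall_self hd.le)).differentiableAt (by norm_num)
  have d1 := hasDerivAt_line (u := u) (x := x) (ei i) (t := 0) (by simpa using hdx)
  have d2 := hasDerivAt_line (u := u) (x := x) (-ei i) (t := 0) (by simpa using hdx)
  have d3 : HasDerivAt (fun s : ℝ => α * s ^ 2 + β * s - γ * s ^ 2) β 0 := by
    have := (((hasDerivAt_pow 2 (0:ℝ)).const_mul α).add ((hasDerivAt_id (0:ℝ)).const_mul β)).sub
      ((hasDerivAt_pow 2 (0:ℝ)).const_mul γ)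
    have hb : α * (((2:ℕ):ℝ) * 0 ^ (2 - 1)) + β * 1 - γ * (((2:ℕ):ℝ) * 0 ^ (2 - 1)) = β := by
      simp
    rw [hb] at this
    exact this
  have d4 := ((d1.sub d2).div_const 2).sub d3
  have hval : ((fderiv ℝ u (x + (0:ℝ) • ei i)) (ei i) - (fderiv ℝ u (x + (0:ℝ) • -ei i)) (-ei i)) / 2
      - β = pd i u x - β := by
    simp [pd]
  rw [hval] at d4
  have hsl := d4.tendsto_slope.mono_left
    (nhdsWithin_mono (0:ℝ) (fun s (hs : s ∈ Ioi (0:ℝ)) => (ne_of_gt hs : s ≠ 0)))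
  have : pd i u x - β ≤ 0 := by
    refine le_of_tendsto hsl ?_
    filter_upwards [Ioc_mem_nhdsGT hd] with s hs
    have := hle s ⟨hs.1.le, hs.2⟩
    rw [slope_def_field]
    refine div_nonpos_of_nonpos_of_nonneg ?_ (by linarith [hs.1])
    simpa using this
  linarith

/-- Interior gradient estimate for Poisson's equation. -/
lemma norm_fderiv_le_of_bounds {u : R2 → ℝ} {x : R2} {d A N : ℝ} (hd : 0 < d) (hN : 0 < N)
    (hu : ∀ y ∈ closedBall x d, ContDiffAt ℝ 2 u y)
    (hA : ∀ y ∈ closedBall x d, |u y| ≤ A) (hL : ∀ y ∈ closedBall x d, |lap u y| ≤ N) :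
    ‖fderiv ℝ u x‖ ≤ 2 * (2 * A / d + N * d) := by
  have hA0 : 0 ≤ A := (abs_nonneg _).trans (hA x (mem_closedBall_self hd.le))
  have hpd : ∀ i, |pd i u x| ≤ 2 * A / d + N * d := by
    intro i
    refine abs_le.2 ⟨?_, pd_le_of_bounds hd hN hu hA hL i⟩
    have := pd_le_of_bounds (u := fun y => -u y) hd hN (fun y hy => (hu y hy).neg)
      (fun y hy => by simpa using hA y hy)
      (fun y hy => by rw [lap_neg (hu y hy), abs_neg]; exact hL y hy) i
    have h2 : pd i (fun y => -u y) x = -pd i u x := by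
      simp [pd, fderiv_fun_neg]
    linarith
  refine ContinuousLinearMap.opNorm_le_bound _ (by positivity) fun v => ?_
  have hv : v = v 0 • ei 0 + v 1 • ei 1 := by
    ext k; fin_cases k <;> simp [ei]
  have h1 : fderiv ℝ u x v = v 0 * pd 0 u x + v 1 * pd 1 u x := by
    conv_lhs => rw [hv]
    simp [pd]
  rw [h1, Real.norm_eq_abs]
  have hc : ∀ i, |v i| ≤ ‖v‖ := fun i => PiLp.norm_apply_le v i
  calc |v 0 * pd 0 u x + v 1 * pd 1 u x| ≤ |v 0| * |pd 0 u x| + |v 1| * |pd 1 u x| := by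
        rw [← abs_mul, ← abs_mul]; exact abs_add_le _ _
    _ ≤ ‖v‖ * (2 * A / d + N * d) + ‖v‖ * (2 * A / d + N * d) := by
        gcongr <;> first | exact hc _ | exact hpd _
    _ = _ := by ring

/-- A priori bound for Poisson's equation with zero boundary values. -/
lemma le_of_abs_lap_le {Ω : Set R2} {u : R2 → ℝ} {R N : ℝ} (hop : IsOpen Ω) (hN : 0 < N)
    (hΩ : Ω ⊆ closedBall 0 R) (hc : ContinuousOn u (closure Ω))
    (hu : ∀ x ∈ Ω, ContDiffAt ℝ 2 u x) (h0 : ∀ x ∈ frontier Ω, u x = 0)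
    (hL : ∀ x ∈ Ω, |lap u x| ≤ N) {x : R2} (hx : x ∈ Ω) : u x ≤ N * R ^ 2 := by
  have hcl : closure Ω ⊆ closedBall 0 R := closure_minimal hΩ isClosed_closedBall
  have hK : IsCompact (closure Ω) := (isCompact_closedBall 0 R).of_isClosed_subset isClosed_closure hcl
  have hFc : ContinuousOn (fun y => u y + N * ‖y - 0‖ ^ 2) (closure Ω) :=
    hc.add (by fun_prop)
  obtain ⟨y, hy, hmax⟩ := hK.exists_isMaxOn ⟨x, subset_closure hx⟩ hFc
  have hxy : u x + N * ‖x - 0‖ ^ 2 ≤ u y + N * ‖y - 0‖ ^ 2 := hmax (subset_closure hx)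
  have hyR : ‖y‖ ≤ R := by simpa using hcl hy
  have hyR2 : ‖y‖ ^ 2 ≤ R ^ 2 := by gcongr
  have hpos : 0 ≤ N * ‖x - 0‖ ^ 2 := by positivity
  by_cases hyΩ : y ∈ Ω
  · exfalso
    have hloc : IsLocalMax (fun y => u y + N * ‖y - 0‖ ^ 2) y :=
      hmax.isLocalMax (Filter.mem_of_superset (hop.mem_nhds hyΩ) subset_closure)
    have t := (tendsto_secDiff (hu y hyΩ)).add_const (4 * N)
    refine not_isLocalMax_of_tendsto (t.congr' ?_) ?_ hloc
    · filter_upwards [self_mem_nhdsWithin] with h hh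
      have hh' : h ≠ 0 := hh
      have s2 := secDiff_norm_sq 0 y h
      have : secDiff (fun y => u y + N * ‖y - 0‖ ^ 2) y h =
          secDiff u y h + N * secDiff (fun y : R2 => ‖y - 0‖ ^ 2) y h := by
        simp only [secDiff, Fin.sum_univ_two]; ring
      rw [this, s2]
      field_simp
    · have := (abs_le.1 (hL y hyΩ)).1
      linarith
  · have : y ∈ frontier Ω := by rw [frontier, hop.interior_eq]; exact ⟨hy, hyΩ⟩
    rw [h0 y this] at hxy
    have h2 : N * ‖y - 0‖ ^ 2 ≤ N * R ^ 2 := by rw [sub_zero]; gcongr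
    linarith

/-- The logarithmic potential of an arc. -/
def logPot (γ : ℝ → R2) (x : R2) : ℝ := ∫ t in (0:ℝ)..1, -Real.log ‖x - γ t‖

lemma mul_log_ge {y : ℝ} (hy : 0 ≤ y) : y - 1 ≤ y * Real.log y := by
  rcases hy.eq_or_lt with rfl | hy
  · simp
  have := Real.one_sub_inv_le_log_of_pos hy
  have h2 := mul_le_mul_of_nonneg_left this hy.le
  have h3 : y * (1 - y⁻¹) = y - 1 := by field_simp
  linarith

lemma integral_neg_log_abs_le (ξ : ℝ) : ∫ t in (0:ℝ)..1, -Real.log |ξ - t| ≤ 2 := by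
  have h1 : ∫ t in (0:ℝ)..1, -Real.log |ξ - t| = -∫ s in (0 - ξ)..(1 - ξ), Real.log s := by
    rw [intervalIntegral.integral_neg, ← intervalIntegral.integral_comp_sub_right
      (fun s => Real.log s) ξ]
    congr 1
    refine intervalIntegral.integral_congr fun t _ => ?_
    simp only [Real.log_abs]
    rw [← Real.log_neg_eq_log]; ring_nf
  rw [h1, integral_log]
  have e1 : Real.log (0 - ξ) = Real.log ξ := by rw [zero_sub, Real.log_neg_eq_log]
  rw [e1]
  by_cases hξ0 : ξ < 0
  · have a : Real.log (-ξ) ≤ Real.log (1 - ξ) := Real.log_le_log (by linarith) (by linarith)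
    rw [Real.log_neg_eq_log] at a
    have b : 0 ≤ Real.log (1 - ξ) := Real.log_nonneg (by linarith)
    nlinarith
  by_cases hξ1 : 1 < ξ
  · have e2 : Real.log (1 - ξ) = Real.log (ξ - 1) := by
      rw [← Real.log_neg_eq_log]; ring_nf
    rw [e2]
    have a : Real.log (ξ - 1) ≤ Real.log ξ := Real.log_le_log (by linarith) (by linarith)
    have b : 0 ≤ Real.log ξ := Real.log_nonneg hξ1.le
    nlinarith
  · have a := mul_log_ge (y := ξ) (by linarith)
    have b := mul_log_ge (y := 1 - ξ) (by linarith)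
    linarith

lemma intervalIntegrable_log_dist {γ : ℝ → R2} (hγ : ContinuousOn γ (Icc 0 1)) {x : R2}
    (hx : ∀ t ∈ Icc (0:ℝ) 1, x ≠ γ t) :
    IntervalIntegrable (fun t => -Real.log ‖x - γ t‖) volume 0 1 := by
  refine ContinuousOn.intervalIntegrable ?_
  rw [uIcc_of_le zero_le_one]
  refine (ContinuousOn.log (continuousOn_const.sub hγ).norm fun t ht => ?_).neg
  exact norm_ne_zero_iff.2 (sub_ne_zero.2 (hx t ht))

lemma logPot_le_two {γ : ℝ → R2} (hγ : ContinuousOn γ (Icc 0 1)) {x : R2}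
    (hx : ∀ t ∈ Icc (0:ℝ) 1, x ≠ γ t) {ξ : ℝ} (hξ : ∀ t ∈ Icc (0:ℝ) 1, |ξ - t| ≤ ‖x - γ t‖) :
    logPot γ x ≤ 2 := by
  refine le_trans ?_ (integral_neg_log_abs_le ξ)
  have hi : IntervalIntegrable (fun t => -Real.log |ξ - t|) volume 0 1 := by
    have h1 := (intervalIntegral.intervalIntegrable_log' (a := ξ) (b := ξ - 1)).comp_sub_left ξ
    simp only [sub_self, sub_sub_cancel] at h1
    simp only [Real.log_abs]
    exact h1.neg
  refine intervalIntegral.integral_mono_ae_restrict zero_le_one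
    (intervalIntegrable_log_dist hγ hx) hi ?_
  have h1 : ∀ᵐ t ∂(volume.restrict (Icc (0:ℝ) 1)), t ≠ ξ :=
    ae_restrict_of_ae (by simp [ae_iff])
  filter_upwards [h1, ae_restrict_mem measurableSet_Icc] with t ht ht'
  exact neg_le_neg (Real.log_le_log (abs_pos.2 (sub_ne_zero.2 ht.symm)) (hξ t ht'))

lemma neg_log_le_logPot {γ : ℝ → R2} (hγ : ContinuousOn γ (Icc 0 1)) {x : R2} {L : ℝ}
    (hx : ∀ t ∈ Icc (0:ℝ) 1, x ≠ γ t) (hL : ∀ t ∈ Icc (0:ℝ) 1, ‖x - γ t‖ ≤ L) :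
    -Real.log L ≤ logPot γ x := by
  have h := intervalIntegral.integral_mono_on (μ := volume) (zero_le_one (α := ℝ))
    (intervalIntegrable_const (c := -Real.log L))
    (intervalIntegrable_log_dist hγ hx) fun t ht =>
      neg_le_neg (Real.log_le_log (norm_pos_iff.2 (sub_ne_zero.2 (hx t ht))) (hL t ht))
  simpa [logPot] using h

lemma logPot_le_neg_log {γ : ℝ → R2} (hγ : ContinuousOn γ (Icc 0 1)) {x : R2} {L : ℝ} (h0 : 0 < L)
    (hL : ∀ t ∈ Icc (0:ℝ) 1, L ≤ ‖x - γ t‖) :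
    logPot γ x ≤ -Real.log L := by
  have hx : ∀ t ∈ Icc (0:ℝ) 1, x ≠ γ t := fun t ht h => by
    have := hL t ht
    rw [h, sub_self, norm_zero] at this
    linarith
  have h := intervalIntegral.integral_mono_on (μ := volume) (zero_le_one (α := ℝ))
    (intervalIntegrable_log_dist hγ hx) (intervalIntegrable_const (c := -Real.log L))
     fun t ht => neg_le_neg (Real.log_le_log h0 (hL t ht))
  simpa [logPot] using h

lemma abs_log_sub_le {a b d : ℝ} (hd : 0 < d) (ha : d ≤ a) (hb : d ≤ b) :
    |Real.log a - Real.log b| ≤ |a - b| / d := by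
  wlog h : b ≤ a generalizing a b
  · rw [abs_sub_comm, abs_sub_comm a]; exact this hb ha (le_of_not_ge h)
  have hb0 := hd.trans_le hb
  have h1 := Real.log_le_sub_one_of_pos (div_pos (hd.trans_le ha) hb0)
  rw [Real.log_div (hd.trans_le ha).ne' hb0.ne'] at h1
  rw [abs_of_nonneg (sub_nonneg.2 (Real.log_le_log hb0 h)), abs_of_nonneg (sub_nonneg.2 h)]
  refine h1.trans ?_
  rw [div_sub_one hb0.ne']
  exact div_le_div_of_nonneg_left (sub_nonneg.2 h) hd hb

lemma exists_dist_arc_ge {γ : ℝ → R2} (hγ : ContinuousOn γ (Icc 0 1)) {x : R2}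
    (hx : ∀ t ∈ Icc (0:ℝ) 1, x ≠ γ t) : ∃ δ > 0, ∀ t ∈ Icc (0:ℝ) 1, δ ≤ ‖x - γ t‖ := by
  obtain ⟨t, ht, hmin⟩ := (isCompact_Icc (a := (0:ℝ)) (b := 1)).exists_isMinOn ⟨0, by simp⟩
    ((continuousOn_const (c := x)).sub hγ).norm
  exact ⟨‖x - γ t‖, norm_pos_iff.2 (sub_ne_zero.2 (hx t ht)), fun s hs => hmin hs⟩

lemma continuousAt_logPot {γ : ℝ → R2} (hγ : ContinuousOn γ (Icc 0 1)) {x : R2}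
    (hx : ∀ t ∈ Icc (0:ℝ) 1, x ≠ γ t) : ContinuousAt (logPot γ) x := by
  obtain ⟨δ, hδ, hδx⟩ := exists_dist_arc_ge hγ hx
  have key : ∀ y ∈ ball x (δ / 2), |logPot γ y - logPot γ x| ≤ 2 / δ * ‖y - x‖ := by
    intro y hy
    rw [mem_ball, dist_eq_norm] at hy
    have hy2 : ∀ t ∈ Icc (0:ℝ) 1, δ / 2 ≤ ‖y - γ t‖ := by
      intro t ht
      have h1 := hδx t ht
      have h2 : ‖x - γ t‖ ≤ ‖y - x‖ + ‖y - γ t‖ := by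
        rw [norm_sub_rev y x]
        calc ‖x - γ t‖ = ‖(x - y) + (y - γ t)‖ := by abel_nf
          _ ≤ _ := norm_add_le _ _
      linarith
    have hyne : ∀ t ∈ Icc (0:ℝ) 1, y ≠ γ t := fun t ht h => by
      have := hy2 t ht
      rw [h, sub_self, norm_zero] at this
      linarith
    unfold logPot
    rw [← intervalIntegral.integral_sub (intervalIntegrable_log_dist hγ hyne)
      (intervalIntegrable_log_dist hγ hx)]
    have := intervalIntegral.norm_integral_le_of_norm_le_const (a := (0:ℝ)) (b := 1)
      (f := fun t => -Real.log ‖y - γ t‖ - -Real.log ‖x - γ t‖) (C := 2 / δ * ‖y - x‖) ?_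
    · simpa using this
    · intro t ht
      rw [uIoc_of_le zero_le_one] at ht
      have ht' := Ioc_subset_Icc_self ht
      have h1 := abs_log_sub_le (half_pos hδ) (hy2 t ht') ((half_le_self hδ.le).trans (hδx t ht'))
      rw [Real.norm_eq_abs, neg_sub_neg, abs_sub_comm]
      refine h1.trans ?_
      have h3 := abs_norm_sub_norm_le (y - γ t) (x - γ t)
      rw [sub_sub_sub_cancel_right] at h3
      calc _ ≤ ‖y - x‖ / (δ / 2) := by gcongr
        _ = _ := by field_simp
  rw [ContinuousAt, tendsto_iff_norm_sub_tendsto_zero]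
  have hlim : Tendsto (fun y : R2 => 2 / δ * ‖y - x‖) (𝓝 x) (𝓝 0) := by
    have : Continuous fun y : R2 => 2 / δ * ‖y - x‖ := by fun_prop
    simpa using this.tendsto x
  refine squeeze_zero' (Eventually.of_forall fun _ => norm_nonneg _) ?_ hlim
  filter_upwards [ball_mem_nhds x (half_pos hδ)] with y hy using key y hy

set_option maxHeartbeats 1000000 in
lemma abs_secDiff_log_le {c x : R2} {δ h : ℝ} (hδ : 0 < δ) (hx : δ ≤ ‖x - c‖) (hh : |h| ≤ δ / 2) :
    |secDiff (fun y => -Real.log ‖y - c‖) x h| ≤ 3 * h ^ 4 / δ ^ 4 := by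
  have e1 : ∀ i, x + h • ei i - c = (x - c) + h • ei i := fun v => by abel
  have e2 : ∀ i, x - h • ei i - c = (x - c) - h • ei i := fun v => by abel
  simp only [secDiff, Fin.sum_univ_two, e1, e2]
  set v := x - c
  have hs : ‖v‖ ^ 2 = v 0 ^ 2 + v 1 ^ 2 := by
    rw [EuclideanSpace.norm_sq_eq, Fin.sum_univ_two]; simp
  have hne : ∀ i, 0 < ‖v + h • ei i‖ ∧ 0 < ‖v - h • ei i‖ := by
    intro i
    have hn : ‖h • ei i‖ ≤ δ / 2 := by rw [norm_smul, norm_ei, mul_one]; exact hh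
    have h1 := norm_sub_norm_le v (h • ei i)
    have h2 := norm_sub_norm_le v (-(h • ei i))
    rw [norm_neg, sub_neg_eq_add] at h2
    constructor <;> linarith
  have hL : ∀ w : R2, Real.log ‖w‖ = 1 / 2 * Real.log (‖w‖ ^ 2) := fun w => by
    rw [Real.log_pow]; push_cast; ring
  set a := v 0 with ha
  set b := v 1 with hb
  set s := ‖v‖ ^ 2 with hsdef
  have hδs : δ ^ 2 ≤ s := by rw [hsdef]; gcongr
  have hs0 : 0 < s := lt_of_lt_of_le (by positivity) hδs
  have hh2 : h ^ 2 ≤ s / 4 := by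
    have : h ^ 2 ≤ (δ / 2) ^ 2 := by rw [← sq_abs]; gcongr
    nlinarith
  have q0 := sq_pos_of_pos (hne 0).1
  have q0' := sq_pos_of_pos (hne 0).2
  have q1 := sq_pos_of_pos (hne 1).1
  have q1' := sq_pos_of_pos (hne 1).2
  simp only [hL, ← hsdef]
  rw [norm_add_smul_ei_sq] at q0 q1 ⊢
  rw [norm_sub_smul_ei_sq] at q0' q1' ⊢
  rw [norm_add_smul_ei_sq, norm_sub_smul_ei_sq]
  simp only [← hsdef, ← ha, ← hb] at q0 q1 q0' q1' ⊢
  set Pr := (s + 2 * h * a + h ^ 2) * (s - 2 * h * a + h ^ 2) *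
    ((s + 2 * h * b + h ^ 2) * (s - 2 * h * b + h ^ 2)) with hPr
  have hlogPr : Real.log Pr = Real.log (s + 2 * h * a + h ^ 2) + Real.log (s - 2 * h * a + h ^ 2)
      + (Real.log (s + 2 * h * b + h ^ 2) + Real.log (s - 2 * h * b + h ^ 2)) := by
    rw [hPr, Real.log_mul (by positivity) (by positivity), Real.log_mul q0.ne' q0'.ne',
      Real.log_mul q1.ne' q1'.ne']
  have hlogs : Real.log (s ^ 4) = 4 * Real.log s := by rw [Real.log_pow]; push_cast; ring
  have hPrs : Pr - s ^ 4 = -2 * h ^ 4 * (a ^ 4 - 6 * a ^ 2 * b ^ 2 + b ^ 4) + h ^ 8 := by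
    rw [hPr, hs]; ring
  have hq : |a ^ 4 - 6 * a ^ 2 * b ^ 2 + b ^ 4| ≤ s ^ 2 := by
    rw [hs, abs_le]
    constructor
    · nlinarith [sq_nonneg (a ^ 2 - b ^ 2)]
    · nlinarith [mul_nonneg (sq_nonneg a) (sq_nonneg b)]
  have hh4 : h ^ 4 ≤ s ^ 2 / 16 := by
    have : (h ^ 2) ^ 2 ≤ (s / 4) ^ 2 := by gcongr
    nlinarith
  have h40 : 0 ≤ h ^ 4 := by positivity
  have hdiff : |Pr - s ^ 4| ≤ 3 * h ^ 4 * s ^ 2 := by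
    rw [hPrs]
    have t1 : h ^ 8 ≤ h ^ 4 * s ^ 2 := by
      have : h ^ 8 = h ^ 4 * h ^ 4 := by ring
      rw [this]; exact mul_le_mul_of_nonneg_left (by linarith [sq_nonneg s]) h40
    have t2 := abs_le.1 hq
    have t3 := mul_le_mul_of_nonneg_left t2.1 h40
    have t4 := mul_le_mul_of_nonneg_left t2.2 h40
    have t5 : 0 ≤ h ^ 8 := by positivity
    have t6 : 0 ≤ h ^ 4 * s ^ 2 := by positivity
    generalize a ^ 4 - 6 * a ^ 2 * b ^ 2 + b ^ 4 = Q at t3 t4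
    have t7 : h ^ 4 * -(s ^ 2) = -(h ^ 4 * s ^ 2) := by ring
    rw [t7] at t3
    rw [abs_le]
    constructor <;> linarith
  have hPrge : s ^ 4 / 2 ≤ Pr := by
    have := (abs_le.1 hdiff).1
    have : 3 * h ^ 4 * s ^ 2 ≤ 3 * (s ^ 2 / 16) * s ^ 2 := by gcongr
    have t : 0 ≤ s ^ 4 := by positivity
    have t8 : 3 * (s ^ 2 / 16) * s ^ 2 = 3 / 16 * s ^ 4 := by ring
    linarith
  have hfin := abs_log_sub_le (d := s ^ 4 / 2) (by positivity) hPrge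
    (half_le_self (by positivity))
  rw [hlogPr, hlogs] at hfin
  have hE : |Pr - s ^ 4| / (s ^ 4 / 2) ≤ 6 * h ^ 4 / δ ^ 4 := by
    have hδ4 : δ ^ 4 ≤ s ^ 2 := by
      have : (δ ^ 2) ^ 2 ≤ s ^ 2 := by gcongr
      nlinarith
    calc |Pr - s ^ 4| / (s ^ 4 / 2) ≤ 3 * h ^ 4 * s ^ 2 / (s ^ 4 / 2) := by gcongr
      _ = 6 * h ^ 4 / s ^ 2 := by field_simp; ring
      _ ≤ _ := by gcongr
  have e3 : 6 * h ^ 4 / δ ^ 4 = 2 * (3 * h ^ 4 / δ ^ 4) := by ring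
  rw [e3] at hE
  have hA := abs_le.1 (hfin.trans hE)
  rw [abs_le]
  constructor <;> linarith [hA.1, hA.2]

lemma secDiff_logPot_le {γ : ℝ → R2} (hγ : ContinuousOn γ (Icc 0 1)) {x : R2} {δ h : ℝ}
    (hδ : 0 < δ) (hx : ∀ t ∈ Icc (0:ℝ) 1, δ ≤ ‖x - γ t‖) (hh : |h| ≤ δ / 2) :
    |secDiff (logPot γ) x h| ≤ 3 * h ^ 4 / δ ^ 4 := by
  have hI : ∀ v : R2, ‖v‖ ≤ δ / 2 →
      IntervalIntegrable (fun t => -Real.log ‖x + v - γ t‖) volume 0 1 := by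
    intro v hv
    refine intervalIntegrable_log_dist hγ fun t ht he => ?_
    have h1 := hx t ht
    have : x - γ t = -v := by rw [← he]; abel
    rw [this, norm_neg] at h1
    linarith
  have hn : ∀ i, ‖h • ei i‖ ≤ δ / 2 := fun i => by
    rw [norm_smul, norm_ei, mul_one]; exact hh
  have hp := fun i => hI (h • ei i) (hn i)
  have hm : ∀ i, IntervalIntegrable (fun t => -Real.log ‖x - h • ei i - γ t‖) volume 0 1 :=
    fun i => by
      have := hI (-(h • ei i)) (by rw [norm_neg]; exact hn i)
      simpa only [← sub_eq_add_neg] using this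
  have h0 : IntervalIntegrable (fun t => -Real.log ‖x - γ t‖) volume 0 1 := by
    simpa using hI 0 (by simp; positivity)
  have hsum : secDiff (logPot γ) x h =
      ∫ t in (0:ℝ)..1, secDiff (fun y => -Real.log ‖y - γ t‖) x h := by
    simp only [secDiff, Fin.sum_univ_two, logPot]
    rw [intervalIntegral.integral_add (((hp 0).add (hm 0)).sub (h0.const_mul 2))
      (((hp 1).add (hm 1)).sub (h0.const_mul 2)),
      intervalIntegral.integral_sub ((hp 0).add (hm 0)) (h0.const_mul 2),
      intervalIntegral.integral_sub ((hp 1).add (hm 1)) (h0.const_mul 2),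
      intervalIntegral.integral_add (hp 0) (hm 0), intervalIntegral.integral_add (hp 1) (hm 1),
      intervalIntegral.integral_const_mul]
  rw [hsum]
  have := intervalIntegral.norm_integral_le_of_norm_le_const (a := (0:ℝ)) (b := 1)
      (f := fun t => secDiff (fun y => -Real.log ‖y - γ t‖) x h) (C := 3 * h ^ 4 / δ ^ 4) ?_
  · simpa using this
  · intro t ht
    rw [uIoc_of_le zero_le_one] at ht
    exact abs_secDiff_log_le hδ (hx t (Ioc_subset_Icc_self ht)) hh

lemma tendsto_secDiff_logPot {γ : ℝ → R2} (hγ : ContinuousOn γ (Icc 0 1)) {x : R2}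
    (hx : ∀ t ∈ Icc (0:ℝ) 1, x ≠ γ t) :
    Tendsto (fun h => secDiff (logPot γ) x h / h ^ 2) (𝓝[≠] 0) (𝓝 0) := by
  obtain ⟨δ, hδ, hδx⟩ := exists_dist_arc_ge hγ hx
  have hlim : Tendsto (fun h : ℝ => 3 * h ^ 2 / δ ^ 4) (𝓝[≠] 0) (𝓝 0) := by
    have : Continuous fun h : ℝ => 3 * h ^ 2 / δ ^ 4 := by fun_prop
    simpa using (this.tendsto 0).mono_left nhdsWithin_le_nhds
  refine squeeze_zero_norm' ?_ hlim
  have hev : ∀ᶠ h in 𝓝[≠] (0:ℝ), |h| ≤ δ / 2 := by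
    refine Filter.Eventually.filter_mono nhdsWithin_le_nhds ?_
    filter_upwards [ball_mem_nhds (0:ℝ) (half_pos hδ)] with h hh
    simpa using (mem_ball.1 hh).le
  filter_upwards [hev, self_mem_nhdsWithin] with h hh h0
  have h0' : h ≠ 0 := h0
  have h2 : 0 < h ^ 2 := by positivity
  rw [norm_div, Real.norm_eq_abs, Real.norm_eq_abs, abs_of_pos h2, div_le_iff₀ h2]
  refine (secDiff_logPot_le hγ hδ hδx hh).trans (le_of_eq ?_)
  ring

/-- Quantitative boundary barrier: a nonnegative function with bounded Laplacian and a large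
constant boundary value is large near any arc contained in the boundary. -/
lemma boundary_barrier {D : Set R2} {w : R2 → ℝ} {P L : ℝ} {γ : ℝ → R2} (hop : IsOpen D)
    (hc : ContinuousOn w (closure D)) (hw : ∀ x ∈ D, ContDiffAt ℝ 2 w x)
    (hw0 : ∀ x ∈ closure D, 0 ≤ w x) (hlap : ∀ x ∈ D, |lap w x| ≤ 1)
    (hP : ∀ x ∈ frontier D, w x = P) (hP0 : 0 ≤ P) (h0 : (0:R2) ∈ D) (hL : 1 ≤ L)
    (hγ : ContinuousOn γ (Icc 0 1)) (hγD : ∀ t ∈ Icc (0:ℝ) 1, γ t ∈ frontier D)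
    (hγL : ∀ t ∈ Icc (0:ℝ) 1, ‖γ t‖ ≤ L)
    (hξ : ∀ x, ∃ ξ : ℝ, ∀ t ∈ Icc (0:ℝ) 1, |ξ - t| ≤ ‖x - γ t‖) :
    P / (Real.log (3 * L) + 2) - 8 * L ^ 2 ≤ w 0 := by
  by_contra! hcon
  set C0 := Real.log (3 * L) + 2 with hC0
  have hlog3 : 1 ≤ Real.log 3 := by
    rw [Real.le_log_iff_exp_le (by norm_num)]
    exact (Real.exp_one_lt_d9.trans (by norm_num)).le
  have hlogL : 0 ≤ Real.log L := Real.log_nonneg hL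
  have hlog3L : Real.log (3 * L) = Real.log 3 + Real.log L :=
    Real.log_mul (by norm_num) (by linarith)
  have hC0p : 0 < C0 := by linarith
  set F : R2 → ℝ := fun x => -w x + P / C0 * (Real.log (3 * L) + logPot γ x)
    - ((4 * L) ^ 2 - ‖x - 0‖ ^ 2) / 2 with hF
  have hPC : 0 ≤ P / C0 := by positivity
  have hoff : ∀ x, x ∉ frontier D → ∀ t ∈ Icc (0:ℝ) 1, x ≠ γ t := fun x hx t ht h =>
    hx (h ▸ hγD t ht)
  have hnfr : ∀ x ∈ D, x ∉ frontier D := fun x hx => by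
    rw [frontier, hop.interior_eq]; exact fun h => h.2 hx
  have hup : ∀ x, x ∉ frontier D → P / C0 * (Real.log (3 * L) + logPot γ x) ≤ P := by
    intro x hx
    obtain ⟨ξ, h⟩ := hξ x
    have h1 := logPot_le_two hγ (hoff x hx) h
    calc _ ≤ P / C0 * C0 := mul_le_mul_of_nonneg_left (by linarith) hPC
      _ = P := by field_simp
  have hF0 : 0 < F 0 := by
    have h1 := neg_log_le_logPot (L := L) hγ (hoff 0 (hnfr 0 h0)) (by simpa using hγL)
    have h2 : P / C0 * 1 ≤ P / C0 * (Real.log (3 * L) + logPot γ 0) := by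
      gcongr; linarith
    simp only [hF, sub_zero, norm_zero]
    nlinarith
  set η := F 0 with hη
  have hη1 : w 0 ≤ P - η := by
    have := hup 0 (hnfr 0 h0)
    have : η ≤ -w 0 + P := by
      simp only [hη, hF, sub_zero, norm_zero]
      nlinarith
    linarith
  set K : Set R2 := (closure D ∩ closedBall 0 (4 * L)) ∩ w ⁻¹' Iic (P - η) with hK
  have hKc : IsCompact K := by
    refine (isCompact_closedBall (0:R2) (4 * L)).of_isClosed_subset ?_ fun x hx => hx.1.2
    exact (hc.mono inter_subset_left).preimage_isClosed_of_isClosed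
      (isClosed_closure.inter isClosed_closedBall) isClosed_Iic
  have hKfr : ∀ x ∈ K, x ∉ frontier D := fun x hx h => by
    have h1 : w x ≤ P - η := hx.2
    rw [hP x h] at h1
    linarith
  have hFc : ContinuousOn F K := by
    have h1 : ContinuousOn (logPot γ) K := fun x hx =>
      (continuousAt_logPot hγ (hoff x (hKfr x hx))).continuousWithinAt
    have h2 : ContinuousOn w K := hc.mono fun x hx => hx.1.1
    have h3 : Continuous fun x : R2 => ((4 * L) ^ 2 - ‖x - 0‖ ^ 2) / 2 := by fun_prop
    exact ((h2.neg).add (continuousOn_const.mul (continuousOn_const.add h1))).sub h3.continuousOn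
  obtain ⟨y, hy, hmax⟩ := hKc.exists_isMaxOn
    ⟨0, ⟨⟨subset_closure h0, by simp; linarith⟩, hη1⟩⟩ hFc
  have hFy : η ≤ F y := hmax ⟨⟨subset_closure h0, by simp; linarith⟩, hη1⟩
  have hyD : y ∈ D := by
    by_contra h
    exact hKfr y hy (by rw [frontier, hop.interior_eq]; exact ⟨hy.1.1, h⟩)
  have hyle : ‖y‖ ≤ 4 * L := by simpa using hy.1.2
  have hylt : ‖y‖ < 4 * L := by
    refine lt_of_le_of_ne hyle fun he => ?_
    have h1 : logPot γ y ≤ -Real.log (3 * L) :=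
      logPot_le_neg_log hγ (by linarith) fun t ht => by
        have := norm_sub_norm_le y (γ t)
        linarith [hγL t ht]
    have h2 : P / C0 * (Real.log (3 * L) + logPot γ y) ≤ P / C0 * 0 := by
      gcongr; linarith
    have h3 := hw0 y hy.1.1
    have : F y ≤ 0 := by
      simp only [hF, sub_zero, he]
      linarith
    linarith
  have hwy : w y < P - η := by
    have h1 := hup y (hKfr y hy)
    have h2 : ‖y‖ ^ 2 < (4 * L) ^ 2 := by gcongr
    have : F y < -w y + P := by
      simp only [hF, sub_zero]
      linarith
    linarith
  have hloc : IsLocalMax F y := by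
    refine hmax.isLocalMax ?_
    filter_upwards [hop.mem_nhds hyD, (hw y hyD).continuousAt.eventually (gt_mem_nhds hwy),
      isOpen_ball.mem_nhds (show y ∈ ball (0:R2) (4 * L) by simpa using hylt)] with x h1 h2 h3
    exact ⟨⟨subset_closure h1, ball_subset_closedBall h3⟩, h2.le⟩
  have t := (((tendsto_secDiff (hw y hyD)).neg).add
    ((tendsto_secDiff_logPot hγ (hoff y (hnfr y hyD))).const_mul (P / C0))).add_const 2
  refine not_isLocalMax_of_tendsto (t.congr' ?_) ?_ hloc
  · filter_upwards [self_mem_nhdsWithin] with h hh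
    have hh' : h ≠ 0 := hh
    have s2 := secDiff_norm_sq 0 y h
    have : secDiff F y h =
        -secDiff w y h + P / C0 * secDiff (logPot γ) y h
          + 1 / 2 * secDiff (fun y : R2 => ‖y - 0‖ ^ 2) y h := by
      simp only [hF, secDiff, Fin.sum_univ_two]; ring
    rw [this, s2]
    field_simp
    ring
  · have := (abs_le.1 (hlap y hyD)).2
    linarith

/-- Through every point of `S` passes, at every scale `ε ≤ ε₀`, an arc of size comparable to `ε`
contained in `Γ`, parametrized with speed bounded below by `ε` in a strong sense. -/
def HasArcs (Γ S : Set R2) : Prop :=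
  ∃ Λ > 0, ∃ ε₀ > 0, ∀ y ∈ S, ∀ ε : ℝ, 0 < ε → ε ≤ ε₀ → ∃ γ : ℝ → R2,
    ContinuousOn γ (Icc 0 1) ∧ (∀ t ∈ Icc (0:ℝ) 1, γ t ∈ Γ) ∧
    (∀ t ∈ Icc (0:ℝ) 1, ‖γ t - y‖ ≤ ε * Λ) ∧
    ∀ x, ∃ ξ : ℝ, ∀ t ∈ Icc (0:ℝ) 1, ε * |ξ - t| ≤ ‖x - γ t‖

lemma abs_apply_le_norm (v : R2) (i : Fin 2) : |v i| ≤ ‖v‖ := by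
  simpa using PiLp.norm_apply_le v i

lemma norm_le_abs_add_abs (v : R2) : ‖v‖ ≤ |v 0| + |v 1| := by
  have h : ‖v‖ ^ 2 = v 0 ^ 2 + v 1 ^ 2 := by
    rw [EuclideanSpace.norm_sq_eq, Fin.sum_univ_two]; simp
  refine abs_le_of_sq_le_sq' ?_ (by positivity) |>.2
  rw [h, ← sq_abs (v 0), ← sq_abs (v 1)]
  nlinarith [mul_nonneg (abs_nonneg (v 0)) (abs_nonneg (v 1))]

lemma SmoothBoundary.hasArcs_nhds {Ω : Set R2} (hsm : SmoothBoundary Ω) {y₀ : R2}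
    (hy₀ : y₀ ∈ frontier Ω) : ∃ T ∈ 𝓝[frontier Ω] y₀, HasArcs (frontier Ω) T := by
  obtain ⟨V, hV, hyV, e, g, hg, hgraph⟩ := hsm y₀ hy₀
  obtain ⟨r, hr, hrV⟩ := Metric.isOpen_iff.1 hV y₀ hyV
  set a₀ := e y₀ 0 with ha₀
  obtain ⟨C, T, hT, hlip⟩ := (hg.contDiffAt (x := a₀)).of_le
    (show (1 : WithTop ℕ∞) ≤ ((⊤ : ℕ∞) : WithTop ℕ∞) by exact_mod_cast le_top)
    |>.exists_lipschitzOnWith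
  obtain ⟨s, hs, hsT⟩ := Metric.mem_nhds_iff.1 hT
  set Λ : ℝ := 1 + C with hΛ
  have hΛ0 : 0 < Λ := by positivity
  set δ := min (s / 2) (r / 2) with hδ
  have hδ0 : 0 < δ := by positivity
  refine ⟨frontier Ω ∩ ball y₀ δ, inter_mem self_mem_nhdsWithin
    (mem_nhdsWithin_of_mem_nhds (ball_mem_nhds _ hδ0)), Λ, hΛ0,
    min (s / 4) (r / 4 / Λ), by positivity, ?_⟩
  rintro y ⟨hyf, hyδ⟩ ε hε hεle
  have hε1 : ε ≤ s / 4 := hεle.trans (min_le_left _ _)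
  have hε2 : ε * Λ ≤ r / 4 := by
    have := hεle.trans (min_le_right _ _)
    rwa [le_div_iff₀ hΛ0] at this
  have hyd : dist y y₀ < δ := hyδ
  have hyd1 : dist y y₀ < s / 2 := hyd.trans_le (min_le_left _ _)
  have hyd2 : dist y y₀ < r / 2 := hyd.trans_le (min_le_right _ _)
  set a := e y 0 with ha
  have haa : |a - a₀| < s / 2 := by
    have h1 : |a - a₀| ≤ dist (e y) (e y₀) := by
      rw [dist_eq_norm]; exact abs_apply_le_norm (e y - e y₀) 0
    rw [e.isometry.dist_eq] at h1
    linarith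
  have hga : e y 1 = g a := by
    have : y ∈ frontier Ω ∩ V := ⟨hyf, hrV (by rw [mem_ball]; linarith)⟩
    rw [hgraph] at this
    exact this.2
  have habs := abs_lt.1 haa
  have hmem : ∀ t ∈ Icc (0:ℝ) 1, a + ε * t ∈ ball a₀ s := by
    intro t ht
    have h1 : ε * t ≤ ε * 1 := by gcongr; exact ht.2
    have h2 : 0 ≤ ε * t := mul_nonneg hε.le ht.1
    rw [mem_ball, Real.dist_eq, abs_lt]
    constructor <;> linarith
  have hdist : ∀ t ∈ Icc (0:ℝ) 1, ‖e.symm !₂[a + ε * t, g (a + ε * t)] - y‖ ≤ ε * Λ := by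
    intro t ht
    have h1 : ε * t ≤ ε * 1 := by gcongr; exact ht.2
    have h2 : 0 ≤ ε * t := mul_nonneg hε.le ht.1
    rw [← dist_eq_norm, ← e.isometry.dist_eq, e.apply_symm_apply, dist_eq_norm]
    refine (norm_le_abs_add_abs _).trans ?_
    have h3 := hlip.dist_le_mul _ (hsT (hmem t ht)) _ (hsT (hmem 0 (by simp)))
    simp only [mul_zero, add_zero, Real.dist_eq, add_sub_cancel_left, abs_of_nonneg h2] at h3
    have e0 : (!₂[a + ε * t, g (a + ε * t)] - e y) 0 = ε * t := by simp [ha]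
    have e1 : (!₂[a + ε * t, g (a + ε * t)] - e y) 1 = g (a + ε * t) - g a := by simp [hga]
    rw [e0, e1, abs_of_nonneg h2]
    have h4 : (C:ℝ) * (ε * t) ≤ C * (ε * 1) := by gcongr
    rw [hΛ]
    linarith
  refine ⟨fun t => e.symm !₂[a + ε * t, g (a + ε * t)], ?_, ?_, hdist, ?_⟩
  · refine Continuous.continuousOn (e.symm.continuous.comp ?_)
    have hgc := hg.continuous
    fun_prop
  · intro t ht
    have h1 := hdist t ht
    rw [← dist_eq_norm] at h1
    have h2 : e.symm !₂[a + ε * t, g (a + ε * t)] ∈ V := by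
      refine hrV ?_
      rw [mem_ball]
      have := dist_triangle (e.symm !₂[a + ε * t, g (a + ε * t)]) y y₀
      linarith
    have h3 : e.symm !₂[a + ε * t, g (a + ε * t)] ∈ {y | y ∈ V ∧ e y 1 = g (e y 0)} :=
      ⟨h2, by simp⟩
    rw [← hgraph] at h3
    exact h3.1
  · intro x
    refine ⟨(e x 0 - a) / ε, fun t _ => ?_⟩
    rw [← dist_eq_norm, ← e.isometry.dist_eq, e.apply_symm_apply, dist_eq_norm]
    refine le_trans (le_of_eq ?_) (abs_apply_le_norm _ 0)
    rw [← abs_of_pos hε, ← abs_mul, abs_of_pos hε]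
    congr 1
    simp
    field_simp
    ring

lemma SmoothBoundary.hasArcs {Ω : Set R2} (hsm : SmoothBoundary Ω)
    (hbdd : Bornology.IsBounded Ω) : HasArcs (frontier Ω) (frontier Ω) := by
  have hK : IsCompact (frontier Ω) :=
    Metric.isCompact_of_isClosed_isBounded isClosed_frontier
      (hbdd.closure.subset frontier_subset_closure)
  refine hK.induction_on (p := HasArcs (frontier Ω)) ⟨1, one_pos, 1, one_pos, by simp⟩ ?_ ?_ fun y hy => hsm.hasArcs_nhds hy
  · rintro S T hST ⟨Λ, hΛ, ε₀, hε₀, h⟩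
    exact ⟨Λ, hΛ, ε₀, hε₀, fun y hy => h y (hST hy)⟩
  · rintro S T ⟨Λ, hΛ, ε₀, hε₀, h⟩ ⟨Λ', hΛ', ε₀', hε₀', h'⟩
    refine ⟨max Λ Λ', lt_max_of_lt_left hΛ, min ε₀ ε₀', lt_min hε₀ hε₀', ?_⟩
    rintro y (hy | hy) ε hε hle
    · obtain ⟨γ, h1, h2, h3, h4⟩ := h y hy ε hε (hle.trans (min_le_left _ _))
      exact ⟨γ, h1, h2, fun t ht => (h3 t ht).trans (by gcongr; exact le_max_left _ _), h4⟩
    · obtain ⟨γ, h1, h2, h3, h4⟩ := h' y hy ε hε (hle.trans (min_le_right _ _))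
      exact ⟨γ, h1, h2, fun t ht => (h3 t ht).trans (by gcongr; exact le_max_right _ _), h4⟩

/-- The properties of the Lane-Emden solution rescaled at its minimum point. -/
structure RescaledSol (D : Set R2) (p : ℝ) (z : R2 → ℝ) : Prop where
  isOpen : IsOpen D
  zero_mem : (0 : R2) ∈ D
  one_lt : 1 < p
  contDiffAt : ∀ x ∈ D, ContDiffAt ℝ 2 z x
  continuousOn : ContinuousOn z (closure D)
  frontier_eq : ∀ x ∈ frontier D, z x = -p
  abs_le : ∀ x ∈ D, |1 + z x / p| ≤ 1
  le_zero : ∀ x ∈ D, z x ≤ z 0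
  lap_eq : ∀ x ∈ D, -lap z x = |1 + z x / p| ^ (p - 1) * (1 + z x / p)

lemma RescaledSol.nonpos {D : Set R2} {p : ℝ} {z : R2 → ℝ} (h : RescaledSol D p z) {x : R2}
    (hx : x ∈ D) : z x ≤ 0 := by
  have h1 := (_root_.abs_le.1 (h.abs_le x hx)).2
  have hp : 0 < p := one_pos.trans h.one_lt
  have h2 : z x / p ≤ 0 := by linarith
  by_contra! h3
  exact absurd h2 (not_le.2 (div_pos h3 hp))

lemma RescaledSol.abs_lap_le {D : Set R2} {p : ℝ} {z : R2 → ℝ} (h : RescaledSol D p z) {x : R2}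
    (hx : x ∈ D) : |lap z x| ≤ 1 := by
  rw [← abs_neg, h.lap_eq x hx, abs_mul, abs_of_nonneg (rpow_nonneg (abs_nonneg _) _)]
  have h1 := h.abs_le x hx
  have h2 := rpow_le_one (abs_nonneg _) h1 (by linarith [h.one_lt] : 0 ≤ p - 1)
  exact mul_le_one₀ h2 (abs_nonneg _) h1

/-- The affine homeomorphism `x ↦ ε x + k`. -/
def affineHomeo (ε : ℝ) (hε : ε ≠ 0) (k : R2) : R2 ≃ₜ R2 :=
  (Homeomorph.smulOfNeZero ε hε).trans (Homeomorph.addRight k)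

lemma affineHomeo_apply (ε : ℝ) (hε : ε ≠ 0) (k x : R2) :
    affineHomeo ε hε k x = ε • x + k := rfl

lemma rescaledSol_of_isSolution {Ω : Set R2} {p M ε : ℝ} {u : R2 → ℝ} {k : R2} (hop : IsOpen Ω)
    (hp : 1 < p) (hsol : IsSolution Ω p u) (hM : 0 < M) (hε : 0 < ε)
    (hεM : p * M ^ (p - 1) * ε ^ 2 = 1) (hk : k ∈ Ω) (hmin : ∀ x ∈ Ω, u k ≤ u x)
    (huM : ∀ x ∈ Ω, |u x| ≤ M) :
    RescaledSol {x | ε • x + k ∈ Ω} p (fun x => p / M * (-u (ε • x + k) - M)) := by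
  have hp0 : 0 < p := one_pos.trans hp
  obtain ⟨h2, h1, heq, hb⟩ := hsol
  have hcd : ∀ x ∈ Ω, ContDiffAt ℝ 2 u x := fun x hx => h2.contDiffAt (hop.mem_nhds hx)
  have hD : {x | ε • x + k ∈ Ω} = affineHomeo ε hε.ne' k ⁻¹' Ω := rfl
  have hz : ∀ x : R2, 1 + p / M * (-u (ε • x + k) - M) / p = -u (ε • x + k) / M := fun x => by
    field_simp; ring
  refine ⟨hop.preimage (by fun_prop), by simpa using hk, hp, fun x hx => ?_, ?_, ?_, ?_, ?_, ?_⟩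
  · have : ContDiffAt ℝ 2 (fun y => u (ε • y + k)) x := ContDiffAt.comp x (hcd _ hx) (by fun_prop)
    exact contDiffAt_const.mul (this.neg.sub contDiffAt_const)
  · rw [hD, ← Homeomorph.preimage_closure]
    have : ContinuousOn (fun y => u (ε • y + k)) (affineHomeo ε hε.ne' k ⁻¹' closure Ω) :=
      h1.continuousOn.comp (affineHomeo ε hε.ne' k).continuous.continuousOn fun x hx => hx
    exact continuousOn_const.mul (this.neg.sub continuousOn_const)
  · rw [hD, ← Homeomorph.preimage_frontier]
    intro x hx
    have : u (ε • x + k) = 0 := hb _ hx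
    simp only [this]
    field_simp
    ring
  · intro x hx
    simp only [hz]
    rw [abs_div, abs_neg, abs_of_pos hM]
    exact div_le_one_of_le₀ (huM _ hx) hM.le
  · intro x hx
    have := hmin _ hx
    simp only [smul_zero, zero_add]
    gcongr
  · intro x hx
    have e1 : (fun x => p / M * (-u (ε • x + k) - M)) =
        fun x => p / M * ((-1) * u (ε • x + k) + (-M)) := by ext; ring
    rw [hz, e1, lap_comp_smul_add (hcd _ hx)]
    have e2 := heq _ hx
    rw [neg_div, abs_neg, abs_div, abs_of_pos hM, div_rpow (abs_nonneg _) hM.le]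
    have e3 : lap u (ε • x + k) = -(|u (ε • x + k)| ^ (p - 1) * u (ε • x + k)) := by linarith
    rw [e3]
    have hMp : 0 < M ^ (p - 1) := rpow_pos_of_pos hM _
    have e4 : p * ε ^ 2 = 1 / M ^ (p - 1) := by field_simp; linarith
    have e5 : -(p / M * -1 * ε ^ 2 * -(|u (ε • x + k)| ^ (p - 1) * u (ε • x + k))) =
      (p * ε ^ 2) * (-(|u (ε • x + k)| ^ (p - 1) * u (ε • x + k)) / M) := by ring
    rw [e5, e4]
    field_simp

/-- A lower bound at the concentration point when the boundary is at distance comparable to `ε`. -/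
lemma RescaledSol.le_of_near_boundary {Ω : Set R2} {p ε L₀ Λ ε₀ : ℝ} {z : R2 → ℝ} {k y : R2}
    (hε : 0 < ε) (h : RescaledSol {x | ε • x + k ∈ Ω} p z) (hεε : ε ≤ ε₀) (hL₀ : 0 ≤ L₀)
    (hΛ : 0 < Λ)
    (harc : ∀ y ∈ frontier Ω, ∀ ε : ℝ, 0 < ε → ε ≤ ε₀ → ∃ γ : ℝ → R2,
      ContinuousOn γ (Icc 0 1) ∧ (∀ t ∈ Icc (0:ℝ) 1, γ t ∈ frontier Ω) ∧
      (∀ t ∈ Icc (0:ℝ) 1, ‖γ t - y‖ ≤ ε * Λ) ∧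
      ∀ x, ∃ ξ : ℝ, ∀ t ∈ Icc (0:ℝ) 1, ε * |ξ - t| ≤ ‖x - γ t‖)
    (hy : ε • y + k ∈ frontier Ω) (hyL : ‖y‖ ≤ L₀) :
    p / (Real.log (3 * (L₀ + Λ + 1)) + 2) - 8 * (L₀ + Λ + 1) ^ 2 ≤ -z 0 := by
  obtain ⟨γ, hγc, hγf, hγy, hγξ⟩ := harc _ hy ε hε hεε
  have hD : {x | ε • x + k ∈ Ω} = affineHomeo ε hε.ne' k ⁻¹' Ω := rfl
  have hinv : ∀ v : R2, ε • (ε⁻¹ • (v - k)) + k = v := fun v => by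
    rw [smul_inv_smul₀ hε.ne']; abel
  have hnn : ∀ x ∈ closure {x | ε • x + k ∈ Ω}, 0 ≤ -z x := by
    intro x hx
    rw [closure_eq_interior_union_frontier, h.isOpen.interior_eq] at hx
    rcases hx with hx | hx
    · linarith [h.nonpos hx]
    · rw [h.frontier_eq x hx]; linarith [h.one_lt]
  have hsc : ∀ v x : R2, ‖x - ε⁻¹ • (v - k)‖ = ε⁻¹ * ‖(ε • x + k) - v‖ := by
    intro v x
    rw [← abs_of_pos (inv_pos.2 hε), ← Real.norm_eq_abs, ← norm_smul]
    congr 1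
    simp only [smul_sub, smul_add, Real.norm_eq_abs, abs_of_pos (inv_pos.2 hε),
      inv_smul_smul₀ hε.ne']
    abel
  refine boundary_barrier (w := fun x => -z x) (γ := fun t => ε⁻¹ • (γ t - k)) h.isOpen
    h.continuousOn.neg (fun x hx => (h.contDiffAt x hx).neg) hnn
    (fun x hx => ?_) (fun x hx => ?_) (by linarith [h.one_lt]) h.zero_mem (by linarith)
    ((hγc.sub continuousOn_const).const_smul ε⁻¹) ?_ ?_ ?_
  · rw [lap_neg (h.contDiffAt x hx), abs_neg]
    exact h.abs_lap_le hx
  · rw [h.frontier_eq x hx, neg_neg]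
  · intro t ht
    rw [hD, ← Homeomorph.preimage_frontier, mem_preimage, affineHomeo_apply, hinv]
    exact hγf t ht
  · intro t ht
    have h1 := hsc (γ t) y
    have h2 : ε⁻¹ * ‖ε • y + k - γ t‖ ≤ ε⁻¹ * (ε * Λ) := by
      rw [norm_sub_rev]
      exact mul_le_mul_of_nonneg_left (hγy t ht) (inv_pos.2 hε).le
    rw [inv_mul_cancel_left₀ hε.ne'] at h2
    have h3 := norm_sub_norm_le (ε⁻¹ • (γ t - k)) y
    rw [norm_sub_rev] at h3
    linarith
  · intro x
    obtain ⟨ξ, hξ⟩ := hγξ (ε • x + k)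
    refine ⟨ξ, fun t ht => ?_⟩
    rw [hsc, inv_mul_eq_div, le_div_iff₀ hε, mul_comm]
    exact hξ t ht

/-- The rescaled domains exhaust the plane. -/
lemma eventually_closedBall_subset_rescaled {Ω : Set R2} (harcs : HasArcs (frontier Ω) (frontier Ω))
    {P E : ℕ → ℝ} {k : ℕ → R2} {z : ℕ → R2 → ℝ} (hP : Tendsto P atTop atTop)
    (hE : Tendsto E atTop (𝓝 0)) (hE0 : ∀ᶠ n in atTop, 0 < E n) {A : ℝ}
    (hz : ∀ᶠ n in atTop, RescaledSol {x | E n • x + k n ∈ Ω} (P n) (z n))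
    (hA : ∀ᶠ n in atTop, -z n 0 ≤ A) (R : ℝ) :
    ∀ᶠ n in atTop, closedBall (0:R2) R ⊆ {x | E n • x + k n ∈ Ω} := by
  obtain ⟨Λ, hΛ, ε₀, hε₀, harc⟩ := harcs
  set L := max R 0 + Λ + 1
  have hlog : 0 < Real.log (3 * L) + 2 := by
    have : 0 ≤ Real.log (3 * L) := Real.log_nonneg (by
      have := le_max_right R 0
      simp only [L]; linarith)
    linarith
  have hPbig : ∀ᶠ n in atTop, A < P n / (Real.log (3 * L) + 2) - 8 * L ^ 2 := by
    filter_upwards [hP.eventually_gt_atTop ((A + 8 * L ^ 2) * (Real.log (3 * L) + 2))] with n hn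
    rw [lt_sub_iff_add_lt, lt_div_iff₀ hlog]
    exact hn
  filter_upwards [hz, hA, hPbig, hE0, hE.eventually (gt_mem_nhds hε₀)] with n h1 h2 h3 h4 h5
  by_contra hcon
  obtain ⟨x, hx, hxD⟩ := not_subset.1 hcon
  have hR : 0 ≤ R := (norm_nonneg x).trans (by simpa using hx)
  have hconn : IsPreconnected (closedBall (0:R2) R) := (convex_closedBall _ _).isPreconnected
  have hfr : ∃ y ∈ closedBall (0:R2) R, y ∈ frontier {x | E n • x + k n ∈ Ω} := by
    by_contra! hno
    rw [frontier, h1.isOpen.interior_eq] at hno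
    obtain ⟨y, -, hy1, hy2⟩ := hconn {x | E n • x + k n ∈ Ω} (closure {x | E n • x + k n ∈ Ω})ᶜ
      h1.isOpen isClosed_closure.isOpen_compl
      (fun y hy => (em (y ∈ {x | E n • x + k n ∈ Ω})).imp_right fun h h' => hno y hy ⟨h', h⟩)
      ⟨0, by simpa using hR, h1.zero_mem⟩ ⟨x, hx, fun h' => hno x hx ⟨h', hxD⟩⟩
    exact hy2 (subset_closure hy1)
  obtain ⟨y, hy, hyf⟩ := hfr
  have hD : {x | E n • x + k n ∈ Ω} = affineHomeo (E n) h4.ne' (k n) ⁻¹' Ω := rfl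
  rw [hD, ← Homeomorph.preimage_frontier] at hyf
  have := h1.le_of_near_boundary h4 h5.le (le_max_right R 0) hΛ harc hyf
    ((by simpa using hy : ‖y‖ ≤ R).trans (le_max_left _ _))
  linarith

lemma tsupport_pd_subset (i : Fin 2) (φ : R2 → ℝ) : tsupport (pd i φ) ⊆ tsupport φ := by
  refine closure_minimal (fun x hx => ?_) (isClosed_tsupport φ)
  by_contra h
  refine hx ?_
  have : φ =ᶠ[𝓝 x] fun _ => 0 := notMem_tsupport_iff_eventuallyEq.1 h
  simp [pd, this.fderiv_eq]

lemma continuous_mul_of_tsupport {φ g : R2 → ℝ} (hφ : Continuous φ)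
    (hg : ∀ x ∈ tsupport φ, ContinuousAt g x) : Continuous fun x => φ x * g x :=
  continuous_of_tsupport fun x hx =>
    hφ.continuousAt.mul (hg x (tsupport_mul_subset_left hx))

lemma integrable_mul_of_tsupport {φ g : R2 → ℝ} (hφ : Continuous φ) (hc : HasCompactSupport φ)
    (hg : ∀ x ∈ tsupport φ, ContinuousAt g x) : Integrable fun x => φ x * g x :=
  (continuous_mul_of_tsupport hφ hg).integrable_of_hasCompactSupport hc.mul_right

lemma continuousAt_pd {u : R2 → ℝ} {x : R2} (hu : ContDiffAt ℝ 1 u x) (i : Fin 2) :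
    ContinuousAt (pd i u) x :=
  (contDiffAt_pd (m := 0) hu (by simp) i).continuousAt

/-- Integration by parts against a compactly supported function. -/
lemma integral_mul_pd {φ v : R2 → ℝ} (hφ : ContDiff ℝ 1 φ) (hc : HasCompactSupport φ)
    (hv : ∀ x ∈ tsupport φ, ContDiffAt ℝ 1 v x) (i : Fin 2) :
    ∫ x, φ x * pd i v x = -∫ x, pd i φ x * v x := by
  have hpc : Continuous (pd i φ) := (contDiff_pd (m := 0) hφ (by simp) i).continuous
  have hpcs : HasCompactSupport (pd i φ) :=
    hc.of_isClosed_subset (isClosed_tsupport _) (tsupport_pd_subset i φ)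
  refine integral_mul_fderiv_eq_neg_fderiv_mul_of_integrable
    (integrable_mul_of_tsupport hpc hpcs fun x hx =>
      (hv x (tsupport_pd_subset i φ hx)).continuousAt)
    (integrable_mul_of_tsupport hφ.continuous hc fun x hx => continuousAt_pd (hv x hx) i)
    (integrable_mul_of_tsupport hφ.continuous hc fun x hx => (hv x hx).continuousAt)
    (fun x _ => hφ.differentiable one_ne_zero x)
    (fun x hx => (hv x hx).differentiableAt one_ne_zero)

/-- The divergence of a compactly supported field has zero integral. -/
lemma integral_pd_eq_zero {φ : R2 → ℝ} (hφ : ContDiff ℝ 1 φ) (hc : HasCompactSupport φ)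
    (i : Fin 2) : ∫ x, pd i φ x = 0 := by
  have := integral_mul_pd (v := fun _ => (1:ℝ)) hφ hc (fun _ _ => contDiffAt_const) i
  simp only [mul_one] at this
  have h2 : ∀ x, pd i (fun _ => (1:ℝ)) x = 0 := fun x => by simp [pd]
  simp only [h2, mul_zero, integral_zero] at this
  linarith

lemma gradient_apply (v : R2 → ℝ) (x : R2) (i : Fin 2) : gradient v x i = pd i v x := by
  have h : inner ℝ (gradient v x) (ei i) = fderiv ℝ v x (ei i) := by
    rw [gradient]; exact InnerProductSpace.toDual_symm_apply
  rw [pd, ← h, EuclideanSpace.inner_single_right]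
  simp

lemma norm_gradient_sq (v : R2 → ℝ) (x : R2) :
    ‖gradient v x‖ ^ 2 = pd 0 v x ^ 2 + pd 1 v x ^ 2 := by
  rw [EuclideanSpace.norm_sq_eq, Fin.sum_univ_two, gradient_apply, gradient_apply]
  simp

/-- Smooth truncation vanishing below `1/2` and equal to one above `3/4`. -/
def truncation (s : ℝ) : ℝ := Real.smoothTransition (4 * s - 2)

lemma contDiff_truncation : ContDiff ℝ 1 truncation :=
  Real.smoothTransition.contDiff.comp (by fun_prop)

lemma truncation_nonneg (s : ℝ) : 0 ≤ truncation s := Real.smoothTransition.nonneg _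

lemma truncation_of_le {s : ℝ} (h : s ≤ 1 / 2) : truncation s = 0 :=
  Real.smoothTransition.zero_of_nonpos (by linarith)

lemma truncation_of_ge {s : ℝ} (h : 3 / 4 ≤ s) : truncation s = 1 :=
  Real.smoothTransition.one_of_one_le (by linarith)

lemma exists_deriv_truncation_le : ∃ C : ℝ, 0 ≤ C ∧
    ∀ s ∈ Icc (-1:ℝ) 1, |deriv truncation s| ≤ C := by
  have hc : Continuous (deriv truncation) := contDiff_truncation.continuous_deriv le_rfl
  obtain ⟨C, hC⟩ := (isCompact_Icc (a := (-1:ℝ)) (b := 1)).exists_bound_of_continuousOn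
    hc.continuousOn
  exact ⟨C, (norm_nonneg _).trans (hC 0 (by simp)), hC⟩

/-- A Caccioppoli-type inequality: the Laplacian on a superlevel set is controlled by the
Dirichlet energy. -/
lemma setIntegral_neg_lap_le {Ω S : Set R2} {v : R2 → ℝ} {C : ℝ} (hop : IsOpen Ω)
    (hC : ∀ s ∈ Icc (-1:ℝ) 1, |deriv truncation s| ≤ C)
    (hbdd : Bornology.IsBounded Ω) (hc : ContinuousOn v (closure Ω))
    (hv : ∀ x ∈ Ω, ContDiffAt ℝ 2 v x) (h0 : ∀ x ∈ frontier Ω, v x = 0)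
    (hv1 : ∀ x ∈ Ω, |v x| ≤ 1) (hf : ∀ x ∈ Ω, 1 / 2 ≤ v x → 0 ≤ -lap v x)
    (hint : IntegrableOn (fun x => ‖gradient v x‖ ^ 2) Ω)
    (hSm : MeasurableSet S) (hS : S ⊆ Ω) (hvS : ∀ x ∈ S, 3 / 4 ≤ v x) :
    ∫ x in S, -lap v x ≤ C * ∫ x in Ω, ‖gradient v x‖ ^ 2 := by
  classical
  set ψ : R2 → ℝ := Ω.indicator fun x => truncation (v x) with hψ
  set K := closure Ω ∩ v ⁻¹' Ici (1 / 2) with hK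
  have hKcl : IsClosed K := hc.preimage_isClosed_of_isClosed isClosed_closure isClosed_Ici
  have hKc : IsCompact K :=
    (Metric.isCompact_of_isClosed_isBounded isClosed_closure hbdd.closure).of_isClosed_subset hKcl
      inter_subset_left
  have hKΩ : K ⊆ Ω := by
    rintro x ⟨hx, hx2⟩
    by_contra h
    have h1 : v x = 0 := h0 x (by rw [frontier, hop.interior_eq]; exact ⟨hx, h⟩)
    have h2 : 1 / 2 ≤ v x := hx2
    rw [h1] at h2
    norm_num at h2
  have hts : tsupport ψ ⊆ K := by
    refine closure_minimal (fun x hx => ?_) hKcl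
    have hxΩ : x ∈ Ω := by
      by_contra h
      exact hx (indicator_of_notMem h _)
    refine ⟨subset_closure hxΩ, ?_⟩
    by_contra h
    refine hx ?_
    rw [hψ, indicator_of_mem hxΩ]
    exact truncation_of_le (not_le.1 h).le
  have hev : ∀ x ∈ Ω, ψ =ᶠ[𝓝 x] fun y => truncation (v y) := fun x hx => by
    filter_upwards [hop.mem_nhds hx] with y hy
    rw [hψ, indicator_of_mem hy]
  have hψ1 : ContDiff ℝ 1 ψ := by
    refine contDiff_iff_contDiffAt.2 fun x => ?_
    by_cases hx : x ∈ tsupport ψ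
    swap
    · exact (contDiffAt_const (c := (0:ℝ))).congr_of_eventuallyEq
        (notMem_tsupport_iff_eventuallyEq.1 hx)
    have hxΩ := hKΩ (hts hx)
    exact ((contDiff_truncation.contDiffAt).comp x
      ((hv x hxΩ).of_le one_le_two)).congr_of_eventuallyEq (hev x hxΩ)
  have hψc : HasCompactSupport ψ := hKc.of_isClosed_subset (isClosed_tsupport _) hts
  have hpdψ : ∀ i, ∀ x ∈ Ω, pd i ψ x = deriv truncation (v x) * pd i v x := by
    intro i x hx
    have h1 : HasFDerivAt (fun y => truncation (v y)) (deriv truncation (v x) • fderiv ℝ v x) x :=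
      ((contDiff_truncation.differentiable one_ne_zero (v x)).hasDerivAt).comp_hasFDerivAt x
        (((hv x hx).differentiableAt two_ne_zero).hasFDerivAt)
    rw [pd, (hev x hx).fderiv_eq, h1.fderiv]
    rfl
  have hpd1 : ∀ i, ∀ x ∈ tsupport ψ, ContDiffAt ℝ 1 (pd i v) x := fun i x hx =>
    contDiffAt_pd (hv x (hKΩ (hts hx))) (by norm_num) i
  have hI : ∀ i, ∫ x, ψ x * pd i (pd i v) x = -∫ x, pd i ψ x * pd i v x := fun i =>
    integral_mul_pd hψ1 hψc (hpd1 i) i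
  have hint1 : ∀ i, Integrable fun x => ψ x * pd i (pd i v) x := fun i =>
    integrable_mul_of_tsupport hψ1.continuous hψc fun x hx => continuousAt_pd (hpd1 i x hx) i
  have hint2 : ∀ i, Integrable fun x => pd i ψ x * pd i v x := fun i =>
    integrable_mul_of_tsupport (contDiff_pd (m := 0) hψ1 (by simp) i).continuous
      (hψc.of_isClosed_subset (isClosed_tsupport _) (tsupport_pd_subset i ψ))
      fun x hx => (hpd1 i x (tsupport_pd_subset i ψ hx)).continuousAt
  have hlapint : Integrable fun x => ψ x * -lap v x := by
    refine (((hint1 0).add (hint1 1)).neg).congr (Eventually.of_forall fun x => ?_)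
    simp only [Pi.neg_apply, Pi.add_apply, lap_eq_pd]
    ring
  have heq : ∫ x, ψ x * -lap v x = ∫ x, (pd 0 ψ x * pd 0 v x + pd 1 ψ x * pd 1 v x) := by
    rw [integral_add (hint2 0) (hint2 1)]
    have h1 : ∫ x, ψ x * -lap v x =
        -(∫ x, (ψ x * pd 0 (pd 0 v) x + ψ x * pd 1 (pd 1 v) x)) := by
      rw [← integral_neg]
      congr 1; ext x; rw [lap_eq_pd]; ring
    rw [h1, integral_add (hint1 0) (hint1 1), hI 0, hI 1]
    ring
  have hle : ∫ x, (pd 0 ψ x * pd 0 v x + pd 1 ψ x * pd 1 v x) ≤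
      C * ∫ x in Ω, ‖gradient v x‖ ^ 2 := by
    rw [← integral_const_mul, ← integral_indicator hop.measurableSet]
    refine integral_mono ((hint2 0).add (hint2 1))
      ((integrable_indicator_iff hop.measurableSet).2 (hint.const_mul C)) fun x => ?_
    by_cases hx : x ∈ Ω
    · simp only [indicator_of_mem hx, hpdψ _ x hx, norm_gradient_sq]
      have h1 := (le_abs_self _).trans (hC (v x) (_root_.abs_le.1 (hv1 x hx)))
      nlinarith [mul_le_mul_of_nonneg_right h1 (add_nonneg (sq_nonneg (pd 0 v x))
        (sq_nonneg (pd 1 v x)))]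
    · have : ∀ i, pd i ψ x = 0 := fun i => by
        have h1 : x ∉ tsupport (pd i ψ) := fun h => hx (hKΩ (hts (tsupport_pd_subset i ψ h)))
        exact image_eq_zero_of_notMem_tsupport h1
      simp only [indicator_of_notMem hx, this]
      simp
  have hnn : ∀ x, 0 ≤ ψ x * -lap v x := by
    intro x
    by_cases hx : x ∈ K
    · rw [hψ, indicator_of_mem (hKΩ hx)]
      exact mul_nonneg (truncation_nonneg _) (hf x (hKΩ hx) hx.2)
    · rw [image_eq_zero_of_notMem_tsupport fun h => hx (hts h), zero_mul]
  calc ∫ x in S, -lap v x = ∫ x in S, ψ x * -lap v x := by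
        refine setIntegral_congr_fun hSm fun x hx => ?_
        simp only [hψ, indicator_of_mem (hS hx), truncation_of_ge (hvS x hx), one_mul]
    _ ≤ ∫ x, ψ x * -lap v x := setIntegral_le_integral hlapint (Eventually.of_forall hnn)
    _ ≤ _ := heq.trans_le hle

lemma pd_const_mul_add {v : R2 → ℝ} {x : R2} (a b : ℝ) (i : Fin 2) :
    pd i (fun y => b + a * v y) x = a * pd i v x := by
  have h : (fun y => a * v y) = a • v := rfl
  rw [pd, fderiv_const_add, h, fderiv_const_smul_field]
  rfl

lemma lap_const_mul_add {v : R2 → ℝ} {x : R2} (a b : ℝ) :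
    lap (fun y => b + a * v y) x = a * lap v x := by
  have h : ∀ i, pd i (fun y => b + a * v y) = fun y => 0 + a * pd i v y := fun i => by
    ext y; rw [pd_const_mul_add, zero_add]
  rw [lap_eq_pd, lap_eq_pd, h, h, pd_const_mul_add, pd_const_mul_add]
  ring

lemma pd_comp_smul_add {u : R2 → ℝ} {x k : R2} {r : ℝ}
    (hu : DifferentiableAt ℝ u (r • x + k)) (i : Fin 2) :
    pd i (fun y => u (r • y + k)) x = r * pd i u (r • x + k) := by
  have h1 : HasFDerivAt (fun y : R2 => r • y + k) (r • ContinuousLinearMap.id ℝ R2) x :=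
    ((hasFDerivAt_id x).const_smul r).add_const k
  have h2 := (HasFDerivAt.comp x hu.hasFDerivAt h1).fderiv
  have h3 : (u ∘ fun y => r • y + k) = fun y => u (r • y + k) := rfl
  rw [h3] at h2
  rw [pd, h2]
  simp [pd]

lemma RescaledSol.setIntegral_neg_lap_le {D S : Set R2} {p C : ℝ} {z : R2 → ℝ}
    (h : RescaledSol D p z) (hC : ∀ s ∈ Icc (-1:ℝ) 1, |deriv truncation s| ≤ C)
    (hbdd : Bornology.IsBounded D)
    (hint : IntegrableOn (fun x => ‖gradient z x‖ ^ 2) D)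
    (hSm : MeasurableSet S) (hS : S ⊆ D) (hvS : ∀ x ∈ S, -(p / 4) ≤ z x) :
    ∫ x in S, -lap z x ≤ C / p * ∫ x in D, ‖gradient z x‖ ^ 2 := by
  have hp : 0 < p := one_pos.trans h.one_lt
  set v : R2 → ℝ := fun x => 1 + p⁻¹ * z x with hv
  have hvz : ∀ x, v x = 1 + z x / p := fun x => by simp only [hv]; ring
  have hlv : ∀ x, lap v x = p⁻¹ * lap z x := fun x => lap_const_mul_add _ _
  have hgv : ∀ x, ‖gradient v x‖ ^ 2 = (p⁻¹) ^ 2 * ‖gradient z x‖ ^ 2 := fun x => by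
    rw [norm_gradient_sq, norm_gradient_sq]
    simp only [hv, pd_const_mul_add]
    ring
  have := _root_.setIntegral_neg_lap_le (v := v) h.isOpen hC hbdd
    (continuousOn_const.add (continuousOn_const.mul h.continuousOn))
    (fun x hx => contDiffAt_const.add (contDiffAt_const.mul (h.contDiffAt x hx)))
    (fun x hx => by rw [hvz, h.frontier_eq x hx, neg_div, div_self hp.ne']; ring)
    (fun x hx => by rw [hvz]; exact h.abs_le x hx)
    (fun x hx h2 => by
      rw [hlv, ← mul_neg, h.lap_eq x hx, ← hvz]
      have : 0 ≤ v x := by linarith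
      positivity)
    (by
      simp only [hgv]
      exact hint.const_mul _) hSm hS
    (fun x hx => by
      have h1 := hvS x hx
      have h2 : -(1 / 4) ≤ z x / p := by
        rw [le_div_iff₀ hp]; linarith
      rw [hvz]; linarith)
  simp only [hlv, hgv, ← mul_neg] at this
  rw [integral_const_mul, integral_const_mul] at this
  have h2 := mul_le_mul_of_nonneg_left this hp.le
  rw [mul_inv_cancel_left₀ hp.ne'] at h2
  refine h2.trans (le_of_eq ?_)
  field_simp

lemma integral_comp_smul_add (f : R2 → ℝ) {r : ℝ} (hr : 0 < r) (k : R2) :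
    ∫ x, f (r • x + k) = (r ^ 2)⁻¹ * ∫ x, f x := by
  have h1 := Measure.integral_comp_smul (volume : Measure R2) (fun x => f (x + k)) r
  rw [h1, integral_add_right_eq_self f k]
  simp [abs_of_pos hr]

lemma integrable_comp_smul_add {f : R2 → ℝ} (hf : Integrable f) {r : ℝ} (hr : 0 < r) (k : R2) :
    Integrable fun x => f (r • x + k) :=
  (integrable_comp_smul_iff (volume : Measure R2) (fun x => f (x + k)) hr.ne').2
    (hf.comp_add_right k)

lemma integral_gradient_rescaled {Ω : Set R2} {p M ε : ℝ} {u : R2 → ℝ} {k : R2} (hop : IsOpen Ω)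
    (hε : 0 < ε) (hu : ∀ x ∈ Ω, DifferentiableAt ℝ u x)
    (hint : IntegrableOn (fun x => ‖gradient u x‖ ^ 2) Ω) :
    IntegrableOn (fun x => ‖gradient (fun x => p / M * (-u (ε • x + k) - M)) x‖ ^ 2)
      {x | ε • x + k ∈ Ω} ∧
    ∫ x in {x | ε • x + k ∈ Ω}, ‖gradient (fun x => p / M * (-u (ε • x + k) - M)) x‖ ^ 2 =
      (p / M) ^ 2 * ∫ x in Ω, ‖gradient u x‖ ^ 2 := by
  set D := {x | ε • x + k ∈ Ω}
  have hDo : IsOpen D := hop.preimage (by fun_prop)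
  have hg : ∀ x ∈ D, ‖gradient (fun x => p / M * (-u (ε • x + k) - M)) x‖ ^ 2 =
      (p / M) ^ 2 * ε ^ 2 * ‖gradient u (ε • x + k)‖ ^ 2 := by
    intro x hx
    have e : (fun x => p / M * (-u (ε • x + k) - M)) =
        fun x => -(p / M * M) + -(p / M) * u (ε • x + k) := by ext; ring
    rw [norm_gradient_sq, norm_gradient_sq, e]
    simp only [pd_const_mul_add, pd_comp_smul_add (hu _ hx)]
    ring
  have hind : (D.indicator fun x => ‖gradient (fun x => p / M * (-u (ε • x + k) - M)) x‖ ^ 2) =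
      fun x => (p / M) ^ 2 * ε ^ 2 * (Ω.indicator fun x => ‖gradient u x‖ ^ 2) (ε • x + k) := by
    ext x
    by_cases hx : x ∈ D
    · rw [indicator_of_mem hx, indicator_of_mem (show ε • x + k ∈ Ω from hx), hg x hx]
    · rw [indicator_of_notMem hx, indicator_of_notMem (show ε • x + k ∉ Ω from hx), mul_zero]
  constructor
  · rw [← integrable_indicator_iff hDo.measurableSet, hind]
    exact (integrable_comp_smul_add ((integrable_indicator_iff hop.measurableSet).2 hint)
      hε k).const_mul _
  · rw [← integral_indicator hDo.measurableSet, hind, integral_const_mul,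
      integral_comp_smul_add _ hε, integral_indicator hop.measurableSet]
    field_simp

/-- The compactly supported kernel `(1 - lam |y|²)₊ ^ k`. -/
def kern (k : ℕ) (lam : ℝ) (y : R2) : ℝ := (max (1 - lam * ‖y‖ ^ 2) 0) ^ k

lemma hasDerivAt_max_zero_pow (k : ℕ) (t : ℝ) :
    HasDerivAt (fun s : ℝ => (max s 0) ^ (k + 2)) ((k + 2) * (max t 0) ^ (k + 1)) t := by
  rcases lt_trichotomy t 0 with h | h | h
  · have e : (fun s : ℝ => (max s 0) ^ (k + 2)) =ᶠ[𝓝 t] fun _ => 0 := by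
      filter_upwards [gt_mem_nhds h] with s hs
      rw [max_eq_right hs.le, zero_pow (by omega)]
    rw [max_eq_right h.le, zero_pow (by omega), mul_zero]
    exact (hasDerivAt_const t (0:ℝ)).congr_of_eventuallyEq e
  · subst h
    rw [max_self, zero_pow (by omega), mul_zero, hasDerivAt_iff_isLittleO_nhds_zero]
    simp only [zero_add, max_self, smul_zero, sub_zero]
    rw [zero_pow (by omega)]
    simp only [sub_zero]
    have h1 : (fun s : ℝ => (max s 0) ^ (k + 2)) =O[𝓝 0] fun s : ℝ => s ^ (k + 2) := by
      refine Asymptotics.IsBigO.of_bound 1 (Eventually.of_forall fun s => ?_)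
      rw [one_mul, norm_pow, norm_pow]
      refine pow_le_pow_left₀ (norm_nonneg _) ?_ _
      rw [Real.norm_eq_abs, Real.norm_eq_abs, abs_of_nonneg (le_max_right _ _)]
      exact max_le (le_abs_self s) (abs_nonneg s)
    exact h1.trans_isLittleO (by
      simpa using Asymptotics.isLittleO_pow_id (𝕜 := ℝ) (n := k + 2) (by omega))
  · have e : (fun s : ℝ => (max s 0) ^ (k + 2)) =ᶠ[𝓝 t] fun s => s ^ (k + 2) := by
      filter_upwards [lt_mem_nhds h] with s hs
      rw [max_eq_left hs.le]
    rw [max_eq_left h.le]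
    have := hasDerivAt_pow (k + 2) t
    refine HasDerivAt.congr_of_eventuallyEq ?_ e
    rw [show k + 2 - 1 = k + 1 by omega] at this
    push_cast at this
    exact this

lemma contDiff_max_zero_pow (n : ℕ) (k : ℕ) (hk : n ≤ k) :
    ContDiff ℝ n (fun s : ℝ => (max s 0) ^ (k + 1)) := by
  induction n generalizing k with
  | zero => exact contDiff_zero.2 (by fun_prop)
  | succ n ih =>
    obtain ⟨k, rfl⟩ : ∃ j, k = j + 1 := ⟨k - 1, by omega⟩
    push_cast
    rw [contDiff_succ_iff_deriv]
    refine ⟨fun t => (hasDerivAt_max_zero_pow k t).differentiableAt, by simp, ?_⟩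
    have : deriv (fun s : ℝ => (max s 0) ^ (k + 1 + 1)) =
        fun t => ((k:ℝ) + 2) * (max t 0) ^ (k + 1) :=
      funext fun t => (hasDerivAt_max_zero_pow k t).deriv
    rw [this]
    exact contDiff_const.mul (ih k (by omega))

lemma contDiff_kern (n k : ℕ) (hk : n ≤ k) (lam : ℝ) : ContDiff ℝ n (kern (k + 1) lam) :=
  (contDiff_max_zero_pow n k hk).comp
    (contDiff_const.sub (contDiff_const.mul (contDiff_norm_sq ℝ)))

lemma continuous_kern (k : ℕ) (lam : ℝ) : Continuous (kern k lam) := by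
  unfold kern; fun_prop

lemma kern_nonneg (k : ℕ) (lam : ℝ) (y : R2) : 0 ≤ kern k lam y :=
  pow_nonneg (le_max_right _ _) _

lemma kern_le_one (k : ℕ) {lam : ℝ} (h : 0 ≤ lam) (y : R2) : kern k lam y ≤ 1 :=
  pow_le_one₀ (le_max_right _ _) (max_le (by nlinarith [mul_nonneg h (sq_nonneg ‖y‖)]) zero_le_one)

lemma kern_succ_le (k : ℕ) {lam : ℝ} (h : 0 ≤ lam) (y : R2) : kern (k + 1) lam y ≤ kern k lam y :=
  pow_le_pow_of_le_one (le_max_right _ _)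
    (max_le (by nlinarith [mul_nonneg h (sq_nonneg ‖y‖)]) zero_le_one) (Nat.le_succ k)

lemma kern_eq_zero {k : ℕ} {lam : ℝ} {y : R2} (h : 1 ≤ lam * ‖y‖ ^ 2) : kern (k + 1) lam y = 0 := by
  rw [kern, max_eq_right (by linarith), zero_pow (by omega)]

lemma mul_norm_sq_mul_kern_le (k : ℕ) {lam : ℝ} (h : 0 ≤ lam) (y : R2) :
    lam * ‖y‖ ^ 2 * kern (k + 1) lam y ≤ 1 := by
  rcases le_or_gt 1 (lam * ‖y‖ ^ 2) with h1 | h1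
  · rw [kern_eq_zero h1]; simp
  · have := kern_le_one (k + 1) h y
    have := kern_nonneg (k + 1) lam y
    have : 0 ≤ lam * ‖y‖ ^ 2 := by positivity
    nlinarith

lemma tsupport_kern_subset (k : ℕ) {R lam : ℝ} (hR : 0 < R) (h : 1 ≤ lam * R ^ 2) :
    tsupport (kern (k + 1) lam) ⊆ closedBall 0 R := by
  refine closure_minimal (fun y hy => ?_) isClosed_closedBall
  rw [mem_closedBall_zero_iff]
  by_contra hlt
  push Not at hlt
  have h0 : 0 ≤ lam := by
    by_contra hn
    nlinarith [sq_nonneg R]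
  refine hy (kern_eq_zero (h.trans ?_))
  gcongr

lemma hasCompactSupport_kern (k : ℕ) {lam : ℝ} (h : 0 < lam) :
    HasCompactSupport (kern (k + 1) lam) :=
  (isCompact_closedBall 0 _).of_isClosed_subset (isClosed_tsupport _)
    (tsupport_kern_subset k (R := (√lam)⁻¹) (by positivity)
      (by rw [inv_pow, sq_sqrt h.le, mul_inv_cancel₀ h.ne']))

lemma pd_norm_sq (i : Fin 2) (y : R2) : pd i (fun y => ‖y‖ ^ 2) y = 2 * y i := by
  rw [pd, fderiv_norm_sq_apply]
  simp [ei, EuclideanSpace.inner_single_right]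

lemma pd_kern (i : Fin 2) (k : ℕ) (lam : ℝ) (y : R2) :
    pd i (kern (k + 2) lam) y = -(2 * lam * (k + 2)) * (y i * kern (k + 1) lam y) := by
  have hd : DifferentiableAt ℝ (fun y : R2 => ‖y‖ ^ 2) y :=
    (contDiff_norm_sq ℝ (n := 1)).differentiable one_ne_zero y
  have h1 := (hasDerivAt_max_zero_pow k (1 - lam * ‖y‖ ^ 2)).comp_hasFDerivAt y
    ((hd.hasFDerivAt.const_mul lam).const_sub 1)
  have h2 := pd_norm_sq i y
  rw [pd] at h2
  rw [pd, show kern (k + 2) lam =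
    ((fun s : ℝ => (max s 0) ^ (k + 2)) ∘ fun y : R2 => 1 - lam * ‖y‖ ^ 2) from rfl, h1.fderiv]
  simp only [_root_.smul_apply, _root_.neg_apply, h2, smul_eq_mul, kern]
  ring

lemma hasDerivAt_kern (k : ℕ) (lam : ℝ) (y : R2) :
    HasDerivAt (fun l => kern (k + 2) l y) (-((k + 2) * ‖y‖ ^ 2 * kern (k + 1) lam y)) lam := by
  have h1 := (hasDerivAt_max_zero_pow k (1 - lam * ‖y‖ ^ 2)).comp lam
    (((hasDerivAt_id lam).mul_const (‖y‖ ^ 2)).const_sub 1)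
  have e : (k + 2) * (max (1 - lam * ‖y‖ ^ 2) 0) ^ (k + 1) * -(1 * ‖y‖ ^ 2) =
      -((k + 2) * ‖y‖ ^ 2 * kern (k + 1) lam y) := by
    rw [kern]; ring
  rw [e] at h1
  exact h1

/-- The kernel average `∫ lam (1 - lam |y|²)₊³ f(y) dy`. -/
def kavg (f : R2 → ℝ) (lam : ℝ) : ℝ := ∫ y, lam * kern 3 lam y * f y

lemma hasDerivAt_kavg {f : R2 → ℝ} (hf : Integrable f) {lam : ℝ} (h : 0 < lam) :
    HasDerivAt (kavg f)
      (∫ y, (kern 3 lam y - 3 * (lam * ‖y‖ ^ 2 * kern 2 lam y)) * f y) lam := by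
  have hs : Ioo 0 (lam + 1) ∈ 𝓝 lam := Ioo_mem_nhds h (by linarith)
  have hm : ∀ l, AEStronglyMeasurable (fun y => l * kern 3 l y * f y) := fun l =>
    (continuous_const.mul (continuous_kern 3 l)).aestronglyMeasurable.mul hf.1
  refine (hasDerivAt_integral_of_dominated_loc_of_deriv_le (bound := fun y => 4 * ‖f y‖)
    (F := fun l y => l * kern 3 l y * f y)
    (F' := fun l y => (kern 3 l y - 3 * (l * ‖y‖ ^ 2 * kern 2 l y)) * f y)
    hs (Eventually.of_forall hm) ?_ ?_ ?_ (hf.norm.const_mul 4) ?_).2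
  · refine hf.bdd_mul (c := lam)
      (continuous_const.mul (continuous_kern 3 lam)).aestronglyMeasurable
      (Eventually.of_forall fun y => ?_)
    rw [Real.norm_eq_abs, abs_of_nonneg (mul_nonneg h.le (kern_nonneg _ _ _))]
    exact mul_le_of_le_one_right h.le (kern_le_one _ h.le _)
  · refine AEStronglyMeasurable.mul (Continuous.aestronglyMeasurable ?_) hf.1
    exact (continuous_kern _ _).sub (continuous_const.mul
      ((continuous_const.mul (by fun_prop)).mul (continuous_kern _ _)))
  · refine Eventually.of_forall fun y l hl => ?_
    rw [norm_mul]
    refine mul_le_mul_of_nonneg_right ?_ (norm_nonneg _)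
    have a1 := kern_nonneg 3 l y
    have a2 := kern_le_one 3 hl.1.le y
    have a3 := mul_norm_sq_mul_kern_le 1 hl.1.le y
    have a4 : 0 ≤ l * ‖y‖ ^ 2 * kern 2 l y :=
      mul_nonneg (mul_nonneg hl.1.le (sq_nonneg _)) (kern_nonneg _ _ _)
    rw [Real.norm_eq_abs, _root_.abs_le]
    constructor <;> linarith
  · refine Eventually.of_forall fun y l hl => ?_
    have h1 := ((hasDerivAt_id l).mul (hasDerivAt_kern 1 l y)).mul_const (f y)
    refine h1.congr_deriv ?_
    simp only [id]
    push_cast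
    ring

lemma kavg_eq {f : R2 → ℝ} {lam : ℝ} (h : 0 < lam) :
    kavg f lam = ∫ y, kern 3 1 y * f ((√lam)⁻¹ • y) := by
  have h1 : (0:ℝ) < (√lam)⁻¹ := by positivity
  have := integral_comp_smul_add (fun y => lam * kern 3 lam y * f y) h1 0
  have e : (((√lam)⁻¹) ^ 2)⁻¹ = lam := by rw [inv_pow, inv_inv, sq_sqrt h.le]
  rw [e] at this
  have h2 : ∀ y : R2, lam * kern 3 lam ((√lam)⁻¹ • y + 0) * f ((√lam)⁻¹ • y + 0) =
      lam * (kern 3 1 y * f ((√lam)⁻¹ • y)) := fun y => by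
    rw [add_zero, kern, kern, norm_smul, Real.norm_eq_abs, abs_of_pos h1, mul_pow, inv_pow,
      sq_sqrt h.le, mul_inv_cancel_left₀ h.ne', one_mul, mul_assoc]
  simp only [h2] at this
  rw [integral_const_mul] at this
  exact (mul_left_cancel₀ h.ne' this).symm

lemma integrable_kern (k : ℕ) {lam : ℝ} (h : 0 < lam) : Integrable (kern (k + 1) lam) :=
  (continuous_kern _ _).integrable_of_hasCompactSupport (hasCompactSupport_kern k h)

/-- The total mass of `kern 3 1`. -/
def kmass : ℝ := ∫ y, kern 3 1 y

lemma kmass_pos : 0 < kmass :=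
  (continuous_kern 3 1).integral_pos_of_hasCompactSupport_nonneg_nonzero
    (hasCompactSupport_kern 2 one_pos) (kern_nonneg _ _) (x := 0) (by simp [kern])

lemma integral_kern_three {lam : ℝ} (h : 0 < lam) : ∫ y, kern 3 lam y = kmass / lam := by
  have := kavg_eq (f := fun _ => 1) h
  simp only [kavg, mul_one, integral_const_mul] at this
  rw [kmass, ← this, mul_div_cancel_left₀ _ h.ne']

lemma tendsto_kavg {f : R2 → ℝ} (hf : ContinuousAt f 0) (hi : Integrable f) :
    Tendsto (kavg f) atTop (𝓝 (kmass * f 0)) := by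
  rw [Metric.tendsto_atTop]
  intro ε hε
  obtain ⟨δ, hδ, hd⟩ := Metric.continuousAt_iff.1 hf (ε / (2 * kmass))
    (by have := kmass_pos; positivity)
  have hk := kmass_pos
  refine ⟨(δ⁻¹) ^ 2 * 4, fun lam hl => ?_⟩
  have h0 : 0 < lam := lt_of_lt_of_le (by positivity) hl
  have hs : (√lam)⁻¹ < δ := by
    rw [inv_lt_comm₀ (by positivity) hδ]
    refine lt_of_lt_of_le ?_ (Real.le_sqrt_of_sq_le (x := 2 * δ⁻¹) (by linarith [hl]))
    have : 0 < δ⁻¹ := by positivity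
    linarith
  have hi2 : Integrable fun y => kern 3 1 y * f ((√lam)⁻¹ • y) := by
    have := integrable_comp_smul_add hi (r := (√lam)⁻¹) (by positivity) 0
    simp only [add_zero] at this
    exact this.bdd_mul (c := 1) (continuous_kern _ _).aestronglyMeasurable
      (Eventually.of_forall fun y => by
        rw [Real.norm_eq_abs, abs_of_nonneg (kern_nonneg _ _ _)]
        exact kern_le_one _ zero_le_one _)
  rw [kavg_eq h0, kmass, ← integral_mul_const, dist_eq_norm,
    ← integral_sub hi2 ((integrable_kern 2 one_pos).mul_const _)]
  have hb : ∀ y, ‖kern 3 1 y * f ((√lam)⁻¹ • y) - kern 3 1 y * f 0‖ ≤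
      kern 3 1 y * (ε / (2 * kmass)) := fun y => by
    rw [← mul_sub, norm_mul, Real.norm_eq_abs, abs_of_nonneg (kern_nonneg _ _ _)]
    rcases le_or_gt 1 (1 * ‖y‖ ^ 2) with h1 | h1
    · rw [kern_eq_zero h1]; simp
    · refine mul_le_mul_of_nonneg_left ?_ (kern_nonneg _ _ _)
      rw [← dist_eq_norm]
      refine (hd ?_).le
      have h2 : ‖y‖ < 1 := by nlinarith [norm_nonneg y]
      rw [dist_zero_right, norm_smul, norm_inv, Real.norm_eq_abs, abs_of_nonneg (sqrt_nonneg _)]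
      have : 0 < (√lam)⁻¹ := by positivity
      nlinarith
  refine (norm_integral_le_of_norm_le ((integrable_kern 2 one_pos).mul_const _)
    (Eventually.of_forall hb)).trans_lt ?_
  rw [integral_mul_const, ← kmass]
  have : kmass * (ε / (2 * kmass)) = ε / 2 := by field_simp
  rw [this]; linarith

/-- The `lam`-derivative of `lam * kern 3 lam`. -/
def kernDeriv (lam : ℝ) (y : R2) : ℝ := kern 3 lam y - 3 * (lam * ‖y‖ ^ 2 * kern 2 lam y)

lemma contDiff_coord (n : WithTop ℕ∞) (i : Fin 2) : ContDiff ℝ n fun y : R2 => y i := by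
  fun_prop

lemma pd_apply_self (i : Fin 2) (y : R2) : pd i (fun y => y i) y = 1 := by
  have h : HasFDerivAt (fun y : R2 => y i) (EuclideanSpace.proj i : R2 →L[ℝ] ℝ) y :=
    (EuclideanSpace.proj i : R2 →L[ℝ] ℝ).hasFDerivAt
  rw [pd, h.fderiv]
  simp [ei]

lemma pd_mul {u v : R2 → ℝ} {x : R2} (hu : DifferentiableAt ℝ u x) (hv : DifferentiableAt ℝ v x)
    (i : Fin 2) : pd i (fun y => u y * v y) x = u x * pd i v x + v x * pd i u x := by
  rw [pd, fderiv_fun_mul hu hv]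
  simp [pd]

lemma integral_kernDeriv_mul {V : R2 → ℝ} {R lam : ℝ} (hR : 0 < R) (h : 1 ≤ lam * R ^ 2)
    (hV : ∀ y ∈ closedBall 0 R, ContDiffAt ℝ 2 V y) :
    ∫ y, kernDeriv lam y * V y = -(16 * lam)⁻¹ * ∫ y, kern 4 lam y * lap V y := by
  have hl : 0 < lam := by
    by_contra hn
    nlinarith [sq_nonneg R]
  have hk : ∀ k, ∀ y ∈ tsupport (kern (k + 1) lam), ContDiffAt ℝ 2 V y := fun k y hy =>
    hV y (tsupport_kern_subset k hR h hy)
  have hd3 : ContDiff ℝ 1 (kern 3 lam) := contDiff_kern 1 2 (by omega) lam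
  have hφ : ∀ i, ContDiff ℝ 1 fun y : R2 => y i * kern 3 lam y := fun i =>
    (contDiff_coord 1 i).mul hd3
  have hφs : ∀ i, tsupport (fun y : R2 => y i * kern 3 lam y) ⊆ tsupport (kern 3 lam) := fun i =>
    tsupport_mul_subset_right
  have hc3 : HasCompactSupport (kern 3 lam) := hasCompactSupport_kern 2 hl
  have hφc : ∀ i, HasCompactSupport fun y : R2 => y i * kern 3 lam y := fun i => hc3.mul_left
  have key : ∀ i, Integrable (fun y => pd i (fun y => y i * kern 3 lam y) y * V y) ∧
      Integrable (fun y => kern 4 lam y * pd i (pd i V) y) ∧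
      ∫ y, pd i (fun y => y i * kern 3 lam y) y * V y =
        -(8 * lam)⁻¹ * ∫ y, kern 4 lam y * pd i (pd i V) y := by
    intro i
    have hp1 : ∀ y ∈ tsupport (kern 4 lam), ContDiffAt ℝ 1 (pd i V) y := fun y hy =>
      contDiffAt_pd (hk 3 y hy) (by norm_num) i
    have e1 := integral_mul_pd (hφ i) (hφc i)
      (fun y hy => (hk 2 y (hφs i hy)).of_le (by norm_num)) i
    have e2 := integral_mul_pd (φ := kern 4 lam) (contDiff_kern 1 3 (by omega) lam)
      (hasCompactSupport_kern 3 hl) hp1 i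
    have e3 : ∀ y, pd i (kern 4 lam) y * pd i V y =
        -(8 * lam) * (y i * kern 3 lam y * pd i V y) := fun y => by
      rw [pd_kern i 2 lam y]
      push_cast
      ring
    simp only [e3, integral_const_mul] at e2
    refine ⟨integrable_mul_of_tsupport (contDiff_pd (m := 0) (hφ i) (by simp) i).continuous
        ((hφc i).of_isClosed_subset (isClosed_tsupport _) (tsupport_pd_subset i _))
        fun y hy => (hk 2 y (hφs i (tsupport_pd_subset i _ hy))).continuousAt,
      integrable_mul_of_tsupport (continuous_kern _ _) (hasCompactSupport_kern 3 hl)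
        fun y hy => continuousAt_pd (hp1 y hy) i, ?_⟩
    rw [e2]
    field_simp
    linarith
  have e : ∀ y, kernDeriv lam y * V y = 2⁻¹ * (pd 0 (fun y => y 0 * kern 3 lam y) y * V y +
      pd 1 (fun y => y 1 * kern 3 lam y) y * V y) := fun y => by
    have hp : ∀ i, pd i (fun y => y i * kern 3 lam y) y =
        y i * (-(2 * lam * (1 + 2)) * (y i * kern 2 lam y)) + kern 3 lam y := fun i => by
      have := pd_kern i 1 lam y
      push_cast at this
      rw [pd_mul ((contDiff_coord 1 i).differentiable one_ne_zero y)
        (hd3.differentiable one_ne_zero y), this, pd_apply_self, mul_one]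
    rw [hp, hp, kernDeriv, EuclideanSpace.norm_sq_eq, Fin.sum_univ_two, Real.norm_eq_abs,
      Real.norm_eq_abs, sq_abs, sq_abs]
    ring
  have e4 : ∀ y, kern 4 lam y * lap V y =
      kern 4 lam y * pd 0 (pd 0 V) y + kern 4 lam y * pd 1 (pd 1 V) y := fun y => by
    rw [lap_eq_pd, mul_add]
  simp only [e, e4]
  rw [integral_const_mul, integral_add (key 0).1 (key 1).1,
    integral_add (key 0).2.1 (key 1).2.1, (key 0).2.2, (key 1).2.2]
  field_simp
  ring

lemma kavg_indicator {f : R2 → ℝ} {R lam : ℝ} (hR : 0 < R) (h : 1 ≤ lam * R ^ 2) :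
    kavg ((closedBall 0 R).indicator f) lam = kavg f lam := by
  refine integral_congr_ae (Eventually.of_forall fun y => ?_)
  by_cases hy : y ∈ closedBall (0:R2) R
  · simp [indicator_of_mem hy]
  · have : kern 3 lam y = 0 := by
      by_contra hn
      exact hy (tsupport_kern_subset 2 hR h (subset_closure hn))
    simp [this]

lemma integral_kernDeriv_indicator {f : R2 → ℝ} {R lam : ℝ} (hR : 0 < R) (h : 1 ≤ lam * R ^ 2) :
    ∫ y, kernDeriv lam y * (closedBall 0 R).indicator f y = ∫ y, kernDeriv lam y * f y := by
  refine integral_congr_ae (Eventually.of_forall fun y => ?_)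
  by_cases hy : y ∈ closedBall (0:R2) R
  · simp [indicator_of_mem hy]
  · have : ∀ k, kern (k + 1) lam y = 0 := fun k => by
      by_contra hn
      exact hy (tsupport_kern_subset k hR h (subset_closure hn))
    simp [kernDeriv, this 1, this 2]

/-- Approximate mean value property at the origin. -/
lemma abs_kavg_sub_le {V : R2 → ℝ} {R N : ℝ} (hR : 0 < R)
    (hV : ∀ y ∈ closedBall 0 R, ContDiffAt ℝ 2 V y)
    (hN : ∀ y ∈ closedBall 0 R, |lap V y| ≤ N) :
    |kavg V (R ^ 2)⁻¹ - kmass * V 0| ≤ N * kmass * R ^ 2 := by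
  set f := (closedBall 0 R).indicator V with hf
  have hVc : ContinuousOn V (closedBall 0 R) := fun y hy => (hV y hy).continuousAt.continuousWithinAt
  have hi : Integrable f := (integrable_indicator_iff isClosed_closedBall.measurableSet).2
    (hVc.integrableOn_compact (isCompact_closedBall 0 R))
  have hR2 : 0 < (R ^ 2)⁻¹ := by positivity
  have hball : closedBall (0:R2) R ∈ 𝓝 0 := closedBall_mem_nhds 0 hR
  have hf0 : ContinuousAt f 0 := by
    refine (hV 0 (mem_of_mem_nhds hball)).continuousAt.congr ?_
    filter_upwards [hball] with y hy
    rw [hf, indicator_of_mem hy]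
  have hl1 : ∀ l ∈ Ici (R ^ 2)⁻¹, 1 ≤ l * R ^ 2 := fun l hl => by
    have : (R ^ 2)⁻¹ ≤ l := hl
    rwa [inv_le_iff_one_le_mul₀ (by positivity)] at this
  have hder : ∀ l ∈ Ici (R ^ 2)⁻¹, ∃ d, HasDerivAt (kavg f) d l ∧ |d| ≤ N * kmass * (l ^ 2)⁻¹ := by
    intro l hl
    have hl0 : 0 < l := hR2.trans_le hl
    refine ⟨_, hasDerivAt_kavg hi hl0, ?_⟩
    have e1 := integral_kernDeriv_indicator (f := V) hR (hl1 l hl)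
    rw [integral_kernDeriv_mul hR (hl1 l hl) hV] at e1
    have e0 : (∫ y, (kern 3 l y - 3 * (l * ‖y‖ ^ 2 * kern 2 l y)) * f y) =
        ∫ y, kernDeriv l y * f y := rfl
    rw [e0, e1]
    have hb : ‖∫ y, kern 4 l y * lap V y‖ ≤ ∫ y, kern 3 l y * N := by
      refine norm_integral_le_of_norm_le ((integrable_kern 2 hl0).mul_const N)
        (Eventually.of_forall fun y => ?_)
      rw [norm_mul, Real.norm_eq_abs, abs_of_nonneg (kern_nonneg _ _ _)]
      by_cases hy : y ∈ closedBall (0:R2) R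
      · exact mul_le_mul (kern_succ_le 3 hl0.le y) (hN y hy) (norm_nonneg _) (kern_nonneg _ _ _)
      · have : ∀ k, kern (k + 1) l y = 0 := fun k => by
          by_contra hn
          exact hy (tsupport_kern_subset k hR (hl1 l hl) (subset_closure hn))
        simp [this 3, this 2]
    rw [integral_mul_const, integral_kern_three hl0, Real.norm_eq_abs] at hb
    have hk := kmass_pos
    rw [abs_mul, abs_neg, abs_of_pos (show 0 < (16 * l)⁻¹ by positivity)]
    have hNn : 0 ≤ N := (abs_nonneg _).trans (hN 0 (mem_of_mem_nhds hball))
    calc _ ≤ (16 * l)⁻¹ * (kmass / l * N) := by gcongr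
      _ = 16⁻¹ * (N * kmass * (l ^ 2)⁻¹) := by field_simp
      _ ≤ _ := mul_le_of_le_one_left (by positivity) (by norm_num)
  choose! d hd hdb using hder
  have hcont : ∀ l ∈ Ici (R ^ 2)⁻¹, HasDerivAt (fun l => N * kmass * l⁻¹)
      (-(N * kmass * (l ^ 2)⁻¹)) l := fun l hl => by
    have hl0 : l ≠ 0 := (hR2.trans_le hl).ne'
    refine ((hasDerivAt_inv hl0).const_mul (N * kmass)).congr_deriv ?_
    ring
  have htend := tendsto_kavg hf0 hi
  have hinv : Tendsto (fun l : ℝ => N * kmass * l⁻¹) atTop (𝓝 0) := by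
    simpa using tendsto_inv_atTop_zero.const_mul (N * kmass)
  have hmono1 : MonotoneOn (fun l => kavg f l - N * kmass * l⁻¹) (Ici (R ^ 2)⁻¹) := by
    refine monotoneOn_of_hasDerivWithinAt_nonneg (convex_Ici _)
      (fun l hl => ((hd l hl).sub (hcont l hl)).continuousAt.continuousWithinAt)
      (fun l hl => ((hd l (interior_subset hl)).sub
        (hcont l (interior_subset hl))).hasDerivWithinAt) fun l hl => ?_
    have := (abs_le.1 (hdb l (interior_subset hl))).1
    linarith
  have hmono2 : AntitoneOn (fun l => kavg f l + N * kmass * l⁻¹) (Ici (R ^ 2)⁻¹) := by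
    refine antitoneOn_of_hasDerivWithinAt_nonpos (convex_Ici _)
      (fun l hl => ((hd l hl).add (hcont l hl)).continuousAt.continuousWithinAt)
      (fun l hl => ((hd l (interior_subset hl)).add
        (hcont l (interior_subset hl))).hasDerivWithinAt) fun l hl => ?_
    have := (abs_le.1 (hdb l (interior_subset hl))).2
    linarith
  have a1 := ge_of_tendsto (htend.sub hinv) (by
    filter_upwards [eventually_ge_atTop (R ^ 2)⁻¹] with l hl
    exact hmono1 self_mem_Ici hl hl)
  have a2 := le_of_tendsto (htend.add hinv) (by
    filter_upwards [eventually_ge_atTop (R ^ 2)⁻¹] with l hl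
    exact hmono2 self_mem_Ici hl hl)
  have e0 : f 0 = V 0 := by rw [hf, indicator_of_mem (mem_of_mem_nhds hball)]
  simp only [inv_inv, sub_zero, add_zero, e0] at a1 a2
  rw [hf, kavg_indicator hR (hl1 _ self_mem_Ici)] at a1 a2
  rw [_root_.abs_le]
  constructor <;> linarith

lemma pd_comp_add_left (V : R2 → ℝ) (x : R2) (i : Fin 2) :
    pd i (fun y => V (x + y)) = fun y => pd i V (x + y) := by
  ext y
  rw [pd, fderiv_comp_add_left]
  rfl

lemma lap_comp_add_left (V : R2 → ℝ) (x y : R2) : lap (fun y => V (x + y)) y = lap V (x + y) := by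
  simp only [lap_eq_pd, pd_comp_add_left]

lemma kavg_translate_le {V : R2 → ℝ} {R : ℝ} {x : R2} (hR : 0 < R) (hx : ‖x‖ ≤ R)
    (hc : ∀ y ∈ closedBall 0 (4 * R), ContinuousAt V y)
    (h0 : ∀ y ∈ closedBall 0 (4 * R), 0 ≤ V y) :
    kavg (fun y => V (x + y)) (R ^ 2)⁻¹ ≤ 38 * kavg V ((4 * R) ^ 2)⁻¹ := by
  have hl : 0 < (R ^ 2)⁻¹ := by positivity
  have hl4 : 0 < ((4 * R) ^ 2)⁻¹ := by positivity
  have hs : tsupport (kern 3 (R ^ 2)⁻¹) ⊆ closedBall 0 R :=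
    tsupport_kern_subset 2 hR (by rw [inv_mul_cancel₀ (by positivity)])
  have hs4 : tsupport (kern 3 ((4 * R) ^ 2)⁻¹) ⊆ closedBall 0 (4 * R) :=
    tsupport_kern_subset 2 (by positivity) (by rw [inv_mul_cancel₀ (by positivity)])
  have hxy : ∀ y ∈ closedBall (0:R2) R, x + y ∈ closedBall (0:R2) (4 * R) := fun y hy => by
    rw [mem_closedBall_zero_iff] at hy ⊢
    linarith [norm_add_le x y]
  have i1 : Integrable fun y => kern 3 (R ^ 2)⁻¹ y * V (x + y) :=
    integrable_mul_of_tsupport (continuous_kern _ _) (hasCompactSupport_kern 2 hl) fun y hy =>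
      ContinuousAt.comp' (g := V) (hc _ (hxy y (hs hy))) (by fun_prop)
  have i2 : Integrable fun y => kern 3 ((4 * R) ^ 2)⁻¹ y * V y :=
    integrable_mul_of_tsupport (continuous_kern _ _) (hasCompactSupport_kern 2 hl4) fun y hy =>
      hc _ (hs4 hy)
  have i3 := i2.comp_add_left x
  rw [kavg, kavg, ← integral_const_mul,
    ← integral_add_left_eq_self (fun y => 38 * (((4 * R) ^ 2)⁻¹ * kern 3 ((4 * R) ^ 2)⁻¹ y * V y)) x]
  refine integral_mono ?_ ?_ fun y => ?_
  · simp only [mul_assoc]; exact i1.const_mul _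
  · simp only [mul_assoc]; exact (i3.const_mul _).const_mul _
  have hRHS : 0 ≤ kern 3 ((4 * R) ^ 2)⁻¹ (x + y) * V (x + y) := by
    by_cases hm : x + y ∈ closedBall (0:R2) (4 * R)
    · exact mul_nonneg (kern_nonneg _ _ _) (h0 _ hm)
    · have : kern 3 ((4 * R) ^ 2)⁻¹ (x + y) = 0 := by
        by_contra hn
        exact hm (hs4 (subset_closure hn))
      rw [this, zero_mul]
  show (R ^ 2)⁻¹ * kern 3 (R ^ 2)⁻¹ y * V (x + y) ≤
    38 * (((4 * R) ^ 2)⁻¹ * kern 3 ((4 * R) ^ 2)⁻¹ (x + y) * V (x + y))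
  by_cases hm : y ∈ closedBall (0:R2) R
  · have hV := h0 _ (hxy y hm)
    rw [mem_closedBall_zero_iff] at hm
    have k1 := kern_le_one 3 hl.le y
    have k2 : 27 / 64 ≤ kern 3 ((4 * R) ^ 2)⁻¹ (x + y) := by
      have hn : ‖x + y‖ ≤ 2 * R := by linarith [norm_add_le x y]
      have : 3 / 4 ≤ max (1 - ((4 * R) ^ 2)⁻¹ * ‖x + y‖ ^ 2) 0 := by
        refine le_max_of_le_left ?_
        have : ((4 * R) ^ 2)⁻¹ * ‖x + y‖ ^ 2 ≤ 1 / 4 := by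
          rw [inv_mul_le_iff₀ (by positivity)]
          nlinarith [norm_nonneg (x + y)]
        linarith
      calc (27 / 64 : ℝ) = (3 / 4) ^ 3 := by norm_num
        _ ≤ _ := pow_le_pow_left₀ (by norm_num) this 3
    have e : ((4 * R) ^ 2)⁻¹ = (R ^ 2)⁻¹ / 16 := by field_simp; norm_num
    rw [← mul_assoc]
    refine mul_le_mul_of_nonneg_right ?_ hV
    rw [e] at k2 ⊢
    nlinarith
  · have : kern 3 (R ^ 2)⁻¹ y = 0 := by
      by_contra hn
      exact hm (hs (subset_closure hn))
    rw [this, mul_zero, zero_mul, mul_assoc]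
    positivity

/-- Harnack inequality for nonnegative functions with bounded Laplacian. -/
lemma le_of_nonneg_of_abs_lap_le {V : R2 → ℝ} {R N : ℝ} {x : R2} (hR : 0 < R) (hx : ‖x‖ ≤ R)
    (hV : ∀ y ∈ closedBall 0 (4 * R), ContDiffAt ℝ 2 V y)
    (h0 : ∀ y ∈ closedBall 0 (4 * R), 0 ≤ V y)
    (hN : ∀ y ∈ closedBall 0 (4 * R), |lap V y| ≤ N) :
    V x ≤ 38 * V 0 + 609 * N * R ^ 2 := by
  have hk := kmass_pos
  have hxy : ∀ y ∈ closedBall (0:R2) R, x + y ∈ closedBall (0:R2) (4 * R) := fun y hy => by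
    rw [mem_closedBall_zero_iff] at hy ⊢
    linarith [norm_add_le x y]
  have a1 := abs_kavg_sub_le (V := fun y => V (x + y)) hR
    (fun y hy => ContDiffAt.comp y (hV _ (hxy y hy)) (by fun_prop))
    (fun y hy => by rw [lap_comp_add_left]; exact hN _ (hxy y hy))
  have a2 := abs_kavg_sub_le (V := V) (R := 4 * R) (by positivity) hV hN
  have a3 := kavg_translate_le hR hx (fun y hy => (hV y hy).continuousAt) h0
  rw [add_zero] at a1
  have b1 := (_root_.abs_le.1 a1).1
  have b2 := (_root_.abs_le.1 a2).2
  have : kmass * V x ≤ kmass * (38 * V 0 + 609 * N * R ^ 2) := by nlinarith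
  exact le_of_mul_le_mul_left this hk

lemma RescaledSol.neg_le {D : Set R2} {p R A : ℝ} {z : R2 → ℝ} (h : RescaledSol D p z)
    (hR : 0 < R) (hD : closedBall 0 (4 * R) ⊆ D) (hA : -z 0 ≤ A) {x : R2}
    (hx : x ∈ closedBall 0 R) : -z x ≤ 38 * A + 609 * R ^ 2 := by
  have := le_of_nonneg_of_abs_lap_le (V := fun y => -z y) (N := 1) hR
    (mem_closedBall_zero_iff.1 hx)
    (fun y hy => (h.contDiffAt y (hD hy)).neg) (fun y hy => by
      have := h.nonpos (hD hy); linarith)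
    (fun y hy => by
      rw [lap_neg (h.contDiffAt y (hD hy)), abs_neg]
      exact h.abs_lap_le (hD hy))
  simp only [mul_one] at this
  linarith

lemma hasDerivAt_one_add_div_rpow {p q s : ℝ} (hs : 0 < 1 + s / p) :
    HasDerivAt (fun s => (1 + s / p) ^ q) (p⁻¹ * q * (1 + s / p) ^ (q - 1)) s := by
  have h1 : HasDerivAt (fun s => 1 + s / p) p⁻¹ s := by
    simpa using ((hasDerivAt_id s).div_const p).const_add 1
  exact h1.rpow_const (Or.inl hs.ne')

lemma one_add_div_mem {p A s : ℝ} (hp : 0 < p) (hA : 2 * A ≤ p) (hs : s ∈ Icc (-A) 0) :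
    0 < 1 + s / p ∧ 1 + s / p ≤ 1 := by
  have h1 : s / p ≤ 0 := div_nonpos_of_nonpos_of_nonneg hs.2 hp.le
  have h2 : -(1 / 2) ≤ s / p := by
    rw [le_div_iff₀ hp]; linarith [hs.1]
  constructor <;> linarith

lemma abs_rpow_sub_le {p q A s t : ℝ} (hp : 0 < p) (hq : 1 ≤ q) (hqp : q ≤ p) (hA : 2 * A ≤ p)
    (hs : s ∈ Icc (-A) 0) (ht : t ∈ Icc (-A) 0) :
    |(1 + s / p) ^ q - (1 + t / p) ^ q| ≤ |s - t| := by
  have := (convex_Icc (-A) 0).norm_image_sub_le_of_norm_hasDerivWithin_le (C := 1)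
    (f := fun s => (1 + s / p) ^ q) (f' := fun s => p⁻¹ * q * (1 + s / p) ^ (q - 1))
    (fun x hx => (hasDerivAt_one_add_div_rpow (one_add_div_mem hp hA hx).1).hasDerivWithinAt)
    (fun x hx => by
      obtain ⟨h1, h2⟩ := one_add_div_mem hp hA hx
      rw [Real.norm_eq_abs, abs_of_nonneg (by positivity)]
      refine mul_le_one₀ ?_ (by positivity) (rpow_le_one h1.le h2 (by linarith))
      rw [inv_mul_le_iff₀ hp]; linarith) ht hs
  simpa [Real.norm_eq_abs] using this

lemma abs_rpow_second_difference_le {p A a b c d : ℝ} (hp : 2 ≤ p) (hA : 2 * A ≤ p)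
    (ha : a ∈ Icc (-A) 0) (hb : b ∈ Icc (-A) 0) (hc : c ∈ Icc (-A) 0) (hd : d ∈ Icc (-A) 0) {m : ℝ}
    (h1 : |a - c| ≤ m) (h2 : |b - d| ≤ m) :
    |(1 + a / p) ^ p - (1 + b / p) ^ p - ((1 + c / p) ^ p - (1 + d / p) ^ p)| ≤
      |a - b - (c - d)| + m * |c - d| := by
  have hp0 : 0 < p := by linarith
  have hcomb : ∀ {a b t : ℝ}, a ∈ Icc (-A) 0 → b ∈ Icc (-A) 0 → t ∈ Icc (0:ℝ) 1 →
      b + t * (a - b) ∈ Icc (-A) 0 := by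
    intro a b t ha hb ht
    constructor <;> nlinarith [ha.1, ha.2, hb.1, hb.2, ht.1, ht.2]
  have hder : ∀ {a b t : ℝ}, a ∈ Icc (-A) 0 → b ∈ Icc (-A) 0 → t ∈ Icc (0:ℝ) 1 →
      HasDerivAt (fun t => (1 + (b + t * (a - b)) / p) ^ p)
        ((1 + (b + t * (a - b)) / p) ^ (p - 1) * (a - b)) t := by
    intro a b t ha hb ht
    have e1 := hasDerivAt_one_add_div_rpow (q := p)
      (one_add_div_mem hp0 hA (hcomb ha hb ht)).1
    have e2 : HasDerivAt (fun t => b + t * (a - b)) (a - b) t := by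
      simpa using ((hasDerivAt_id t).mul_const (a - b)).const_add b
    have e3 := e1.comp t e2
    rw [inv_mul_cancel₀ hp0.ne', one_mul] at e3
    exact e3
  have := (convex_Icc (0:ℝ) 1).norm_image_sub_le_of_norm_hasDerivWithin_le
    (C := |a - b - (c - d)| + m * |c - d|)
    (f := fun t => (1 + (b + t * (a - b)) / p) ^ p - (1 + (d + t * (c - d)) / p) ^ p)
    (fun t ht => ((hder ha hb ht).sub (hder hc hd ht)).hasDerivWithinAt)
    (fun t ht => by
      have hx := hcomb ha hb ht
      have hy := hcomb hc hd ht
      set x := b + t * (a - b)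
      set y := d + t * (c - d)
      have hxy : |x - y| ≤ m := by
        have e : x - y = t * (a - c) + (1 - t) * (b - d) := by simp only [x, y]; ring
        rw [_root_.abs_le] at h1 h2 ⊢
        rw [e]
        constructor <;> nlinarith [ht.1, ht.2]
      obtain ⟨k1, k2⟩ := one_add_div_mem hp0 hA hx
      have k3 := rpow_le_one k1.le k2 (show 0 ≤ p - 1 by linarith)
      have k4 : 0 ≤ (1 + x / p) ^ (p - 1) := by positivity
      have k5 := (abs_rpow_sub_le (q := p - 1) hp0 (by linarith) (by linarith) hA hx hy).trans hxy
      rw [Real.norm_eq_abs]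
      calc _ = |(1 + x / p) ^ (p - 1) * (a - b - (c - d)) +
            ((1 + x / p) ^ (p - 1) - (1 + y / p) ^ (p - 1)) * (c - d)| := by ring_nf
        _ ≤ _ := abs_add_le _ _
        _ ≤ _ := by
          rw [abs_mul, abs_mul, abs_of_nonneg k4]
          gcongr
          exact mul_le_of_le_one_left (abs_nonneg _) k3)
    (left_mem_Icc.2 zero_le_one) (right_mem_Icc.2 zero_le_one)
  simp only [one_mul, zero_mul, add_zero, sub_zero, Real.norm_eq_abs, abs_one, mul_one,
    add_sub_cancel] at this
  rw [sub_sub_sub_comm]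
  exact this

lemma RescaledSol.lap_eq_rpow {D : Set R2} {p A : ℝ} {z : R2 → ℝ} {x : R2} (h : RescaledSol D p z)
    (hx : x ∈ D) (hA : 2 * A ≤ p) (hz : z x ∈ Icc (-A) 0) : -lap z x = (1 + z x / p) ^ p := by
  obtain ⟨h1, -⟩ := one_add_div_mem (one_pos.trans h.one_lt) hA hz
  rw [h.lap_eq x hx, abs_of_pos h1, rpow_sub_one h1.ne', div_mul_cancel₀ _ h1.ne']

lemma contDiffAt_comp_add_left {u : R2 → ℝ} {k x : R2} {n : WithTop ℕ∞}
    (h : ContDiffAt ℝ n u (k + x)) : ContDiffAt ℝ n (fun y => u (k + y)) x :=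
  ContDiffAt.comp x h (by fun_prop)

lemma fderiv_translate_sub {u : R2 → ℝ} {k x : R2} (h1 : DifferentiableAt ℝ u (k + x))
    (h2 : DifferentiableAt ℝ u x) :
    fderiv ℝ (fun y => u (k + y) - u y) x = fderiv ℝ u (k + x) - fderiv ℝ u x := by
  rw [fderiv_fun_sub (by exact h1.comp x (by fun_prop)) h2, fderiv_comp_add_left]

lemma pd_translate_sub {u : R2 → ℝ} {k x : R2} (h1 : DifferentiableAt ℝ u (k + x))
    (h2 : DifferentiableAt ℝ u x) (i : Fin 2) :
    pd i (fun y => u (k + y) - u y) x = pd i u (k + x) - pd i u x := by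
  rw [pd, fderiv_translate_sub h1 h2]; rfl

lemma lap_translate_sub {u : R2 → ℝ} {k x : R2} (h1 : ContDiffAt ℝ 2 u (k + x))
    (h2 : ContDiffAt ℝ 2 u x) :
    lap (fun y => u (k + y) - u y) x = lap u (k + x) - lap u x := by
  rw [lap_sub (contDiffAt_comp_add_left h1) h2, lap_comp_add_left]

lemma abs_pd_le (u : R2 → ℝ) (x : R2) (i : Fin 2) : |pd i u x| ≤ ‖fderiv ℝ u x‖ := by
  have := (fderiv ℝ u x).le_opNorm (ei i)
  rwa [norm_ei, mul_one] at this

lemma abs_pd_le_of_lip {g : R2 → ℝ} {x : R2} {C : ℝ} (hC : 0 ≤ C)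
    (h : ∀ k : R2, ‖k‖ ≤ 1 → |g (k + x) - g x| ≤ C * ‖k‖) (i : Fin 2) : |pd i g x| ≤ C := by
  refine (abs_pd_le g x i).trans (norm_fderiv_le_of_lip' ℝ hC ?_)
  filter_upwards [closedBall_mem_nhds x one_pos] with y hy
  have := h (y - x) (by rwa [← dist_eq_norm])
  simpa using this

/-- Uniform regularity estimates for rescaled solutions. -/
structure RegularBounds (z : R2 → ℝ) (r L : ℝ) : Prop where
  norm_fderiv_le : ∀ x ∈ closedBall 0 r, ‖fderiv ℝ z x‖ ≤ L
  abs_sub_le : ∀ x ∈ closedBall 0 r, ∀ k : R2, ‖k‖ ≤ 1 → |z (k + x) - z x| ≤ L * ‖k‖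
  abs_pd_sub_le : ∀ x ∈ closedBall 0 r, ∀ k : R2, ‖k‖ ≤ 1 → ∀ i,
    |pd i z (k + x) - pd i z x| ≤ L * ‖k‖
  abs_pd_pd_le : ∀ x ∈ closedBall 0 r, ∀ i j, |pd j (pd i z) x| ≤ L
  abs_pd_pd_sub_le : ∀ x ∈ closedBall 0 r, ∀ k : R2, ‖k‖ ≤ 1 → ∀ i j,
    |pd j (pd i z) (k + x) - pd j (pd i z) x| ≤ L * ‖k‖

lemma RescaledSol.regularBounds {D : Set R2} {p r A : ℝ} {z : R2 → ℝ} (h : RescaledSol D p z)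
    (hA0 : 0 ≤ A) (hp : 2 ≤ p) (hAp : 2 * A ≤ p) (hD : closedBall 0 (r + 5) ⊆ D)
    (hA : ∀ x ∈ closedBall 0 (r + 5), -z x ≤ A) :
    RegularBounds z r (2 * (2 * A + 1) * (2 * (2 * (2 * A + 1)) + 36)) := by
  set B : ℝ := 2 * (2 * A + 1) with hB
  have hB2 : 2 ≤ B := by rw [hB]; linarith
  have hball : ∀ {s t : ℝ} {k x : R2}, x ∈ closedBall (0:R2) s → ‖k‖ ≤ t →
      k + x ∈ closedBall (0:R2) (s + t) := fun {s t k x} hx hk => by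
    rw [mem_closedBall_zero_iff] at hx ⊢
    linarith [norm_add_le k x]
  have hball1 : ∀ {s : ℝ} {x y : R2}, x ∈ closedBall (0:R2) s → y ∈ closedBall x 1 →
      y ∈ closedBall (0:R2) (s + 1) := fun {s x y} hx hy => by
    have := hball (k := y - x) (t := 1) hx (by rwa [← dist_eq_norm])
    rwa [sub_add_cancel] at this
  have hm : ∀ {s : ℝ} {x : R2}, x ∈ closedBall (0:R2) (r + s) → s ≤ 5 →
      x ∈ closedBall (0:R2) (r + 5) := fun hx hs => closedBall_subset_closedBall (by linarith) hx
  have hC : ∀ {s : ℝ} {x : R2}, x ∈ closedBall (0:R2) (r + s) → s ≤ 5 → ContDiffAt ℝ 2 z x :=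
    fun hx hs => h.contDiffAt _ (hD (hm hx hs))
  have hd : ∀ {s : ℝ} {x : R2}, x ∈ closedBall (0:R2) (r + s) → s ≤ 5 → DifferentiableAt ℝ z x :=
    fun hx hs => (hC hx hs).differentiableAt (by norm_num)
  have hmem : ∀ {s : ℝ} {x : R2}, x ∈ closedBall (0:R2) (r + s) → s ≤ 5 → z x ∈ Icc (-A) 0 :=
    fun hx hs => ⟨by linarith [hA _ (hm hx hs)], h.nonpos (hD (hm hx hs))⟩
  have hlap : ∀ {s : ℝ} {x : R2}, x ∈ closedBall (0:R2) (r + s) → s ≤ 5 →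
      lap z x = -(1 + z x / p) ^ p := fun hx hs => by
    rw [← h.lap_eq_rpow (hD (hm hx hs)) hAp (hmem hx hs), neg_neg]
  -- first derivatives
  have b1 : ∀ x ∈ closedBall (0:R2) (r + 4), ‖fderiv ℝ z x‖ ≤ B := fun x hx => by
    have key : ∀ y ∈ closedBall x 1, y ∈ closedBall (0:R2) (r + 5) := fun y hy =>
      closedBall_subset_closedBall (by linarith) (hball1 hx hy)
    have := norm_fderiv_le_of_bounds (u := z) (x := x) (d := 1) (A := A) (N := 1) one_pos one_pos
      (fun y hy => hC (key y hy) le_rfl) (fun y hy => by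
        have := hmem (key y hy) le_rfl
        rw [_root_.abs_le]; constructor <;> linarith [this.1, this.2])
      (fun y hy => h.abs_lap_le (hD (key y hy)))
    simpa [hB] using this
  have b1' : ∀ x ∈ closedBall (0:R2) (r + 3), ∀ k : R2, ‖k‖ ≤ 1 → |z (k + x) - z x| ≤ B * ‖k‖ :=
    fun x hx k hk => by
      have := (convex_closedBall (0:R2) (r + 4)).norm_image_sub_le_of_norm_fderiv_le
        (fun y hy => hd hy (by norm_num)) b1
        (closedBall_subset_closedBall (by linarith) hx : x ∈ closedBall (0:R2) (r + 4))
        (closedBall_subset_closedBall (by linarith) (hball hx hk) : k + x ∈ closedBall (0:R2) (r + 4))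
      rwa [add_sub_cancel_right] at this
  have lift : ∀ {s t : ℝ} {x : R2}, x ∈ closedBall (0:R2) (r + s) → s ≤ t →
      x ∈ closedBall (0:R2) (r + t) := fun hx hst => closedBall_subset_closedBall (by linarith) hx
  -- first differences of the gradient
  have b2 : ∀ x ∈ closedBall (0:R2) (r + 2), ∀ k : R2, ‖k‖ ≤ 1 →
      ‖fderiv ℝ z (k + x) - fderiv ℝ z x‖ ≤ 6 * B * ‖k‖ := by
    intro x hx k hk
    rcases eq_or_ne k 0 with rfl | hk0
    · simp
    have hkp : 0 < ‖k‖ := norm_pos_iff.2 hk0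
    have key : ∀ y ∈ closedBall x 1, y ∈ closedBall (0:R2) (r + 3) := fun y hy =>
      closedBall_subset_closedBall (by linarith) (hball1 hx hy)
    have key2 : ∀ y ∈ closedBall x 1, k + y ∈ closedBall (0:R2) (r + 4) := fun y hy =>
      closedBall_subset_closedBall (by linarith) (hball (key y hy) hk)
    have := norm_fderiv_le_of_bounds (u := fun y => z (k + y) - z y) (x := x) (d := 1)
      (A := B * ‖k‖) (N := B * ‖k‖) one_pos (by positivity)
      (fun y hy => (contDiffAt_comp_add_left (hC (key2 y hy) (by norm_num))).sub
        (hC (key y hy) (by norm_num)))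
      (fun y hy => b1' y (key y hy) k hk)
      (fun y hy => by
        rw [lap_translate_sub (hC (key2 y hy) (by norm_num)) (hC (key y hy) (by norm_num)),
          hlap (key2 y hy) (by norm_num), hlap (key y hy) (by norm_num)]
        have e := abs_rpow_sub_le (q := p) (by linarith) (by linarith) le_rfl hAp
          (hmem (key2 y hy) (by norm_num)) (hmem (key y hy) (by norm_num))
        rw [neg_sub_neg, abs_sub_comm]
        exact e.trans (b1' y (key y hy) k hk))
    have hkx := hball hx hk
    rw [add_assoc] at hkx
    rw [fderiv_translate_sub (hd hkx (by norm_num))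
      (hd hx (by norm_num))] at this
    refine this.trans (le_of_eq ?_)
    ring
  have b2' : ∀ x ∈ closedBall (0:R2) (r + 2), ∀ k : R2, ‖k‖ ≤ 1 → ∀ i,
      |pd i z (k + x) - pd i z x| ≤ 6 * B * ‖k‖ := fun x hx k hk i => by
    have := ((fderiv ℝ z (k + x) - fderiv ℝ z x).le_opNorm (ei i)).trans
      (mul_le_mul_of_nonneg_right (b2 x hx k hk) (norm_nonneg _))
    rwa [norm_ei, mul_one] at this
  -- second differences of the gradient
  have b3 : ∀ x ∈ closedBall (0:R2) r, ∀ k l : R2, ‖k‖ ≤ 1 → ‖l‖ ≤ 1 → ∀ i,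
      |pd i z (k + (l + x)) - pd i z (l + x) - (pd i z (k + x) - pd i z x)| ≤
        B * (2 * B + 36) * ‖l‖ * ‖k‖ := by
    intro x hx k l hk hl i
    have hx0 : x ∈ closedBall (0:R2) (r + 0) := by rwa [add_zero]
    have b2k : ∀ y ∈ closedBall (0:R2) (r + 1), |z (k + (l + y)) - z (l + y) - (z (k + y) - z y)| ≤
        6 * B * ‖k‖ * ‖l‖ := fun y hy => by
      have hy2 : l + y ∈ closedBall (0:R2) (r + 2) := by
        have := hball hy hl
        rw [add_assoc] at this
        exact lift this (by norm_num)
      have := (convex_closedBall (0:R2) (r + 2)).norm_image_sub_le_of_norm_fderiv_le (𝕜 := ℝ)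
        (f := fun y => z (k + y) - z y) (C := 6 * B * ‖k‖)
        (fun w hw => by
          have := hball hw hk
          rw [add_assoc] at this
          have e := hd this (by norm_num)
          exact (e.comp w (by fun_prop : DifferentiableAt ℝ (fun y => k + y) w)).sub
            (hd hw (by norm_num)))
        (fun w hw => by
          have := hball hw hk
          rw [add_assoc] at this
          rw [fderiv_translate_sub (hd this (by norm_num)) (hd hw (by norm_num))]
          exact b2 w hw k hk) (lift hy (by norm_num)) hy2
      rwa [add_sub_cancel_right] at this
    rcases eq_or_ne k 0 with rfl | hk0
    · simp
    rcases eq_or_ne l 0 with rfl | hl0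
    · simp
    have hkp : 0 < ‖k‖ := norm_pos_iff.2 hk0
    have hlp : 0 < ‖l‖ := norm_pos_iff.2 hl0
    set h1 : R2 → ℝ := fun y => z (k + y) - z y with hh1
    have key : ∀ y ∈ closedBall x 1, y ∈ closedBall (0:R2) (r + 1) := fun y hy => hball1 hx hy
    have keyl : ∀ {y : R2} {s : ℝ}, y ∈ closedBall (0:R2) (r + s) →
        l + y ∈ closedBall (0:R2) (r + (s + 1)) := fun {y s} hy => by
      have := hball hy hl
      rwa [add_assoc] at this
    have keyk : ∀ {y : R2} {s : ℝ}, y ∈ closedBall (0:R2) (r + s) →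
        k + y ∈ closedBall (0:R2) (r + (s + 1)) := fun {y s} hy => by
      have := hball hy hk
      rwa [add_assoc] at this
    have hC1 : ∀ {s : ℝ} {y : R2}, y ∈ closedBall (0:R2) (r + s) → s ≤ 4 → ContDiffAt ℝ 2 h1 y :=
      fun hy hs => (contDiffAt_comp_add_left (hC (keyk hy) (by linarith))).sub
        (hC hy (by linarith))
    have hl1 : ∀ {s : ℝ} {y : R2}, y ∈ closedBall (0:R2) (r + s) → s ≤ 4 →
        lap h1 y = lap z (k + y) - lap z y := fun hy hs =>
      lap_translate_sub (hC (keyk hy) (by linarith)) (hC hy (by linarith))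
    have := norm_fderiv_le_of_bounds (u := fun y => h1 (l + y) - h1 y) (x := x) (d := 1)
      (A := 6 * B * ‖k‖ * ‖l‖) (N := (6 * B + B ^ 2) * ‖k‖ * ‖l‖) one_pos (by positivity)
      (fun y hy => (contDiffAt_comp_add_left (hC1 (keyl (key y hy)) (by norm_num))).sub
        (hC1 (key y hy) (by norm_num)))
      (fun y hy => b2k y (key y hy))
      (fun y hy => by
        have y1 := key y hy
        rw [lap_translate_sub (hC1 (keyl y1) (by norm_num)) (hC1 y1 (by norm_num)),
          hl1 (keyl y1) (by norm_num), hl1 y1 (by norm_num),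
          hlap (keyk (keyl y1)) (by norm_num), hlap (keyl y1) (by norm_num),
          hlap (keyk y1) (by norm_num), hlap y1 (by norm_num)]
        have e := abs_rpow_second_difference_le (m := B * ‖l‖) hp hAp
          (hmem (keyk (keyl y1)) (by norm_num)) (hmem (keyl y1) (by norm_num))
          (hmem (keyk y1) (by norm_num)) (hmem y1 (by norm_num))
          (by
            rw [add_left_comm]
            exact b1' _ (lift (keyk y1) (by norm_num)) l hl)
          (b1' _ (lift y1 (by norm_num)) l hl)
        rw [← abs_neg]
        refine (le_of_eq (by ring_nf)).trans (e.trans ?_)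
        have e2 := b2k y y1
        have e3 := mul_le_mul_of_nonneg_left (b1' _ (lift y1 (by norm_num)) k hk)
          (show 0 ≤ B * ‖l‖ by positivity)
        calc _ ≤ 6 * B * ‖k‖ * ‖l‖ + B * ‖l‖ * (B * ‖k‖) := add_le_add e2 e3
          _ = _ := by ring)
    have hdh : ∀ {s : ℝ} {y : R2}, y ∈ closedBall (0:R2) (r + s) → s ≤ 4 →
        DifferentiableAt ℝ h1 y := fun hy hs => (hC1 hy hs).differentiableAt (by norm_num)
    have e5 := (abs_pd_le _ x i).trans this
    rw [pd_translate_sub (hdh (keyl hx0) (by norm_num)) (hdh hx0 (by norm_num)),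
      hh1, pd_translate_sub (hd (keyk (keyl hx0)) (by norm_num)) (hd (keyl hx0) (by norm_num)),
      pd_translate_sub (hd (keyk hx0) (by norm_num)) (hd hx0 (by norm_num))] at e5
    refine e5.trans ?_
    refine le_of_eq ?_
    ring
  have c1 : B ≤ B * (2 * B + 36) := le_mul_of_one_le_right (by linarith) (by linarith)
  have c6 : 6 * B ≤ B * (2 * B + 36) := by nlinarith
  refine ⟨fun x hx => (b1 x (closedBall_subset_closedBall (by linarith) hx)).trans c1,
    fun x hx k hk => (b1' x (closedBall_subset_closedBall (by linarith) hx) k hk).trans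
      (mul_le_mul_of_nonneg_right c1 (norm_nonneg _)),
    fun x hx k hk i => (b2' x (closedBall_subset_closedBall (by linarith) hx) k hk i).trans
      (mul_le_mul_of_nonneg_right c6 (norm_nonneg _)),
    fun x hx i j => (abs_pd_le_of_lip (by positivity) (fun k hk =>
      b2' x (closedBall_subset_closedBall (by linarith) hx) k hk i) j).trans c6,
    fun x hx k hk i j => ?_⟩
  have hx0 : x ∈ closedBall (0:R2) (r + 0) := by rwa [add_zero]
  have hkx : k + x ∈ closedBall (0:R2) (r + 1) := hball hx hk
  have hdp : ∀ {s : ℝ} {y : R2}, y ∈ closedBall (0:R2) (r + s) → s ≤ 5 →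
      DifferentiableAt ℝ (pd i z) y := fun hy hs =>
    (contDiffAt_pd (hC hy hs) (by norm_num) i : ContDiffAt ℝ 1 _ _).differentiableAt one_ne_zero
  have := abs_pd_le_of_lip (g := fun y => pd i z (k + y) - pd i z y) (x := x)
    (C := B * (2 * B + 36) * ‖k‖) (by positivity) (fun l hl => by
      have := b3 x hx k l hk hl i
      refine le_trans (le_of_eq ?_) (this.trans (le_of_eq ?_))
      · rfl
      · ring) j
  rwa [pd_translate_sub (hdp hkx (by norm_num)) (hdp hx0 (by norm_num))] at this

/-- Arzelà–Ascoli along an ultrafilter. -/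
lemma exists_tendstoUniformlyOn_of_ultrafilter {ι : Type*} (𝒰 : Ultrafilter ι) {g : ι → R2 → ℝ}
    (hg : ∀ R : ℝ, ∃ L, 0 ≤ L ∧ ∀ᶠ n in 𝒰, ∀ x ∈ closedBall 0 R, |g n x| ≤ L ∧
      ∀ k : R2, ‖k‖ ≤ 1 → |g n (k + x) - g n x| ≤ L * ‖k‖) :
    ∃ G : R2 → ℝ, Continuous G ∧ (∀ x, Tendsto (fun n => g n x) 𝒰 (𝓝 (G x))) ∧
      ∀ R, TendstoUniformlyOn g G 𝒰 (closedBall 0 R) := by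
  have hex : ∀ x, ∃ a, Tendsto (fun n => g n x) 𝒰 (𝓝 a) := fun x => by
    obtain ⟨L, -, hL⟩ := hg ‖x‖
    obtain ⟨a, -, ha⟩ := (isCompact_Icc (a := -L) (b := L)).ultrafilter_le_nhds
      (𝒰.map fun n => g n x) (by
        rw [le_principal_iff]
        show ∀ᶠ n in (𝒰 : Filter ι), g n x ∈ Icc (-L) L
        filter_upwards [hL] with n hn
        exact _root_.abs_le.1 (hn x (by simp)).1)
    exact ⟨a, ha⟩
  choose G hG using hex
  have hLip : ∀ R, ∃ L, 0 ≤ L ∧ ∀ x ∈ closedBall (0:R2) R, ∀ k : R2, ‖k‖ ≤ 1 →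
      |G (k + x) - G x| ≤ L * ‖k‖ ∧ ∀ᶠ n in 𝒰, ∀ x ∈ closedBall 0 R,
      ∀ k : R2, ‖k‖ ≤ 1 → |g n (k + x) - g n x| ≤ L * ‖k‖ := fun R => by
    obtain ⟨L, hL0, hL⟩ := hg R
    refine ⟨L, hL0, fun x hx k hk => ⟨le_of_tendsto ((hG (k + x)).sub (hG x)).abs ?_, ?_⟩⟩
    · filter_upwards [hL] with n hn
      exact (hn x hx).2 k hk
    · filter_upwards [hL] with n hn y hy l hl
      exact (hn y hy).2 l hl
  refine ⟨G, continuous_iff_continuousAt.2 fun x => ?_, hG, fun R => ?_⟩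
  · obtain ⟨L, hL0, hL⟩ := hLip ‖x‖
    rw [Metric.continuousAt_iff]
    intro ε hε
    refine ⟨min 1 (ε / (L + 1)), by positivity, fun {y} hy => ?_⟩
    rw [dist_eq_norm] at hy
    have := (hL x (by simp) (y - x) (hy.le.trans (min_le_left _ _))).1
    rw [sub_add_cancel] at this
    rw [Real.dist_eq]
    have h2 := hy.trans_le (min_le_right _ _)
    rw [lt_div_iff₀ (by positivity)] at h2
    nlinarith [norm_nonneg (y - x)]
  · obtain ⟨L, hL0, hL⟩ := hLip R
    rw [Metric.tendstoUniformlyOn_iff]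
    intro ε hε
    obtain ⟨t, ht, htf, hcov⟩ := (isCompact_closedBall (0:R2) R).finite_cover_balls
      (e := min 1 (ε / (3 * (L + 1)))) (by positivity)
    have h1 : ∀ᶠ n in (𝒰 : Filter ι), ∀ x ∈ t, |g n x - G x| < ε / 3 := by
      refine (htf.eventually_all).2 fun x _ => ?_
      have := Metric.tendsto_nhds.1 (hG x) (ε / 3) (by positivity)
      simpa [Real.dist_eq] using this
    rcases t.eq_empty_or_nonempty with h0 | ⟨x0, hx0⟩
    · subst h0
      simp only [biUnion_empty, subset_empty_iff] at hcov
      simp [hcov]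
    have h2 := (hL x0 (ht hx0) 0 (by simp)).2
    filter_upwards [h1, h2] with n hn1 hn2 y hy
    obtain ⟨x, hx, hxy⟩ := mem_iUnion₂.1 (hcov hy)
    rw [mem_ball, dist_eq_norm] at hxy
    have hk := hxy.le.trans (min_le_left _ _)
    have a1 := hn2 x (ht hx) (y - x) hk
    have a2 := (hL x (ht hx) (y - x) hk).1
    rw [sub_add_cancel] at a1 a2
    have a3 := hn1 x hx
    have a4 := hxy.trans_le (min_le_right _ _)
    rw [lt_div_iff₀ (by positivity)] at a4
    have a5 : L * ‖y - x‖ < ε / 3 := by nlinarith [norm_nonneg (y - x)]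
    rw [Real.dist_eq]
    rw [_root_.abs_le] at a1 a2
    rw [abs_lt] at a3 ⊢
    constructor <;> linarith [a1.1, a1.2, a2.1, a2.2, a3.1, a3.2]

/-- The linear form with coordinates `a`, `b`. -/
def coordForm (a b : ℝ) : R2 →L[ℝ] ℝ :=
  a • (EuclideanSpace.proj 0 : R2 →L[ℝ] ℝ) + b • (EuclideanSpace.proj 1 : R2 →L[ℝ] ℝ)

lemma coordForm_apply (a b : ℝ) (v : R2) : coordForm a b v = a * v 0 + b * v 1 := rfl

lemma eq_coord_sum (v : R2) : v = v 0 • ei 0 + v 1 • ei 1 := by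
  ext i
  fin_cases i <;> simp [ei]

lemma clm_eq_coordForm (T : R2 →L[ℝ] ℝ) : T = coordForm (T (ei 0)) (T (ei 1)) := by
  ext v
  conv_lhs => rw [eq_coord_sum v]
  rw [map_add, map_smul, map_smul, coordForm_apply, smul_eq_mul, smul_eq_mul]
  ring

lemma fderiv_eq_coordForm (u : R2 → ℝ) (x : R2) :
    fderiv ℝ u x = coordForm (pd 0 u x) (pd 1 u x) := clm_eq_coordForm _

lemma norm_coordForm_sub_le (a b c d : ℝ) :
    ‖coordForm a b - coordForm c d‖ ≤ |a - c| + |b - d| := by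
  refine ContinuousLinearMap.opNorm_le_bound _ (by positivity) fun v => ?_
  rw [_root_.sub_apply, coordForm_apply, coordForm_apply, Real.norm_eq_abs]
  have h0 := abs_apply_le_norm v 0
  have h1 := abs_apply_le_norm v 1
  calc |a * v 0 + b * v 1 - (c * v 0 + d * v 1)| = |(a - c) * v 0 + (b - d) * v 1| := by ring_nf
    _ ≤ |(a - c) * v 0| + |(b - d) * v 1| := abs_add_le _ _
    _ ≤ _ := by
      rw [abs_mul, abs_mul, add_mul]
      gcongr

lemma tendstoUniformlyOn_coordForm {ι : Type*} {l : Filter ι} {S : Set R2} {a b : ι → R2 → ℝ}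
    {a' b' : R2 → ℝ} (ha : TendstoUniformlyOn a a' l S) (hb : TendstoUniformlyOn b b' l S) :
    TendstoUniformlyOn (fun n x => coordForm (a n x) (b n x))
      (fun x => coordForm (a' x) (b' x)) l S := by
  rw [Metric.tendstoUniformlyOn_iff] at *
  intro ε hε
  filter_upwards [ha (ε / 2) (by positivity), hb (ε / 2) (by positivity)] with n h1 h2 x hx
  have := norm_coordForm_sub_le (a' x) (b' x) (a n x) (b n x)
  have h3 := h1 x hx
  have h4 := h2 x hx
  rw [Real.dist_eq] at h3 h4
  rw [dist_eq_norm]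
  linarith

lemma hasFDerivAt_of_tendsto_pd {ι : Type*} {l : Filter ι} [l.NeBot] {f : ι → R2 → ℝ}
    {G G0 G1 : R2 → ℝ} (hd : ∀ R, ∀ᶠ n in l, ∀ x ∈ closedBall 0 R, DifferentiableAt ℝ (f n) x)
    (hG : ∀ x, Tendsto (fun n => f n x) l (𝓝 (G x)))
    (h0 : ∀ R, TendstoUniformlyOn (fun n => pd 0 (f n)) G0 l (closedBall 0 R))
    (h1 : ∀ R, TendstoUniformlyOn (fun n => pd 1 (f n)) G1 l (closedBall 0 R)) (x : R2) :
    HasFDerivAt G (coordForm (G0 x) (G1 x)) x := by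
  have hx : closedBall (0:R2) (‖x‖ + 1) ∈ 𝓝 x := by
    refine Filter.mem_of_superset (closedBall_mem_nhds x one_pos) fun y hy => ?_
    rw [mem_closedBall_zero_iff]
    rw [mem_closedBall, dist_eq_norm] at hy
    linarith [norm_le_norm_add_norm_sub' y x]
  have hu := (tendstoUniformlyOn_coordForm (h0 (‖x‖ + 1)) (h1 (‖x‖ + 1))).tendstoUniformlyOnFilter
  refine hasFDerivAt_of_tendstoUniformlyOnFilter (l := l) (f := f)
    (f' := fun n y => coordForm (pd 0 (f n) y) (pd 1 (f n) y))
    (g' := fun y => coordForm (G0 y) (G1 y))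
    (hu.mono_right (le_principal_iff.2 hx)) ?_ (Eventually.of_forall hG)
  have : ∀ᶠ q : ι × R2 in l ×ˢ 𝓝 x, (∀ y ∈ closedBall 0 (‖x‖ + 1), DifferentiableAt ℝ (f q.1) y) ∧
      q.2 ∈ closedBall (0:R2) (‖x‖ + 1) := (hd (‖x‖ + 1)).prod_mk hx
  filter_upwards [this] with q hq
  rw [← fderiv_eq_coordForm]
  exact (hq.1 q.2 hq.2).hasFDerivAt

lemma contDiff_succ_of_pd {u : R2 → ℝ} {n : ℕ} (hd : Differentiable ℝ u)
    (h : ∀ i, ContDiff ℝ n (pd i u)) : ContDiff ℝ (n + 1) u := by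
  rw [contDiff_succ_iff_fderiv]
  refine ⟨hd, by simp, ?_⟩
  have : fderiv ℝ u = fun x => pd 0 u x • (EuclideanSpace.proj 0 : R2 →L[ℝ] ℝ) +
      pd 1 u x • (EuclideanSpace.proj 1 : R2 →L[ℝ] ℝ) := funext fun x => fderiv_eq_coordForm u x
  rw [this]
  exact ((h 0).smul contDiff_const).add ((h 1).smul contDiff_const)

lemma pd_pd_eq {u : R2 → ℝ} {x : R2} (hu : ContDiffAt ℝ 2 u x) (i j : Fin 2) :
    pd j (pd i u) x = fderiv ℝ (fderiv ℝ u) x (ei j) (ei i) := by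
  have h : DifferentiableAt ℝ (fderiv ℝ u) x :=
    (hu.fderiv_right (m := 1) (by norm_num)).differentiableAt one_ne_zero
  have h2 : pd i u = fun y => fderiv ℝ u y (ei i) := rfl
  rw [pd, h2, fderiv_clm_apply h (by fun_prop)]
  simp

lemma fderiv_fderiv_apply {u : R2 → ℝ} {x : R2} (hu : ContDiffAt ℝ 2 u x) (v w : R2) :
    fderiv ℝ (fderiv ℝ u) x v w = v 0 * (w 0 * pd 0 (pd 0 u) x + w 1 * pd 0 (pd 1 u) x) +
      v 1 * (w 0 * pd 1 (pd 0 u) x + w 1 * pd 1 (pd 1 u) x) := by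
  rw [pd_pd_eq hu, pd_pd_eq hu, pd_pd_eq hu, pd_pd_eq hu]
  conv_lhs => rw [eq_coord_sum v, eq_coord_sum w]
  simp only [map_add, map_smul, _root_.add_apply, _root_.smul_apply, smul_eq_mul]
  ring

lemma norm_iteratedFDeriv_one_sub_le (u v : R2 → ℝ) (x : R2) :
    ‖iteratedFDeriv ℝ 1 u x - iteratedFDeriv ℝ 1 v x‖ ≤ ‖fderiv ℝ u x - fderiv ℝ v x‖ := by
  refine ContinuousMultilinearMap.opNorm_le_bound (norm_nonneg _) fun m => ?_
  rw [_root_.sub_apply, iteratedFDeriv_one_apply, iteratedFDeriv_one_apply, Fin.prod_univ_one]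
  exact (fderiv ℝ u x - fderiv ℝ v x).le_opNorm (m 0)

lemma norm_iteratedFDeriv_two_sub_le {u v : R2 → ℝ} {x : R2} (hu : ContDiffAt ℝ 2 u x)
    (hv : ContDiffAt ℝ 2 v x) {ε : ℝ} (hε : 0 ≤ ε)
    (h : ∀ i j, |pd j (pd i u) x - pd j (pd i v) x| ≤ ε) :
    ‖iteratedFDeriv ℝ 2 u x - iteratedFDeriv ℝ 2 v x‖ ≤ 4 * ε := by
  refine ContinuousMultilinearMap.opNorm_le_bound (by positivity) fun m => ?_
  rw [_root_.sub_apply, iteratedFDeriv_two_apply, iteratedFDeriv_two_apply,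
    fderiv_fderiv_apply hu, fderiv_fderiv_apply hv, Fin.prod_univ_two, Real.norm_eq_abs]
  have hb : ∀ i j, |m 0 j * m 1 i * (pd j (pd i u) x - pd j (pd i v) x)| ≤ ‖m 0‖ * ‖m 1‖ * ε :=
    fun i j => by
      rw [abs_mul, abs_mul]
      have := abs_apply_le_norm (m 0) j
      have := abs_apply_le_norm (m 1) i
      have := h i j
      gcongr
  have b1 := _root_.abs_le.1 (hb 0 0)
  have b2 := _root_.abs_le.1 (hb 0 1)
  have b3 := _root_.abs_le.1 (hb 1 0)
  have b4 := _root_.abs_le.1 (hb 1 1)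
  rw [_root_.abs_le]
  constructor <;> linarith [b1.1, b1.2, b2.1, b2.2, b3.1, b3.2, b4.1, b4.2]

lemma tendstoUniformlyOn_iteratedFDeriv {ι : Type*} {l : Filter ι} {f : ι → R2 → ℝ} {U : R2 → ℝ}
    {S : Set R2} (hf : ∀ᶠ n in l, ∀ x ∈ S, ContDiffAt ℝ 2 (f n) x) (hU : ContDiff ℝ 2 U)
    (h0 : TendstoUniformlyOn f U l S)
    (h1 : ∀ i, TendstoUniformlyOn (fun n => pd i (f n)) (pd i U) l S)
    (h2 : ∀ i j, TendstoUniformlyOn (fun n => pd j (pd i (f n))) (pd j (pd i U)) l S)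
    (n : ℕ) (hn : n ≤ 2) :
    TendstoUniformlyOn (fun k x => iteratedFDeriv ℝ n (f k) x)
      (fun x => iteratedFDeriv ℝ n U x) l S := by
  rw [Metric.tendstoUniformlyOn_iff]
  intro ε hε
  interval_cases n
  · filter_upwards [Metric.tendstoUniformlyOn_iff.1 h0 ε hε] with k hk x hx
    simpa only [iteratedFDeriv_zero_eq_comp, Function.comp, LinearIsometryEquiv.dist_map]
      using hk x hx
  · filter_upwards [Metric.tendstoUniformlyOn_iff.1
      (tendstoUniformlyOn_coordForm (h1 0) (h1 1)) ε hε] with k hk x hx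
    have := hk x hx
    rw [← fderiv_eq_coordForm, ← fderiv_eq_coordForm] at this
    rw [dist_eq_norm] at this ⊢
    exact (norm_iteratedFDeriv_one_sub_le _ _ _).trans_lt this
  · have h3 : ∀ᶠ k in l, ∀ i j, ∀ x ∈ S, dist (pd j (pd i U) x) (pd j (pd i (f k)) x) < ε / 8 := by
      rw [eventually_all]; intro i
      rw [eventually_all]; intro j
      exact Metric.tendstoUniformlyOn_iff.1 (h2 i j) (ε / 8) (by positivity)
    filter_upwards [hf, h3] with k hk hk3 x hx
    rw [dist_eq_norm]
    have := norm_iteratedFDeriv_two_sub_le hU.contDiffAt (hk x hx) (ε := ε / 8) (by positivity)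
      fun i j => by
        have := hk3 i j x hx
        rw [Real.dist_eq] at this
        exact this.le
    linarith

lemma RescaledSol.pd_zero {D : Set R2} {p : ℝ} {z : R2 → ℝ} (h : RescaledSol D p z) (i : Fin 2) :
    pd i z 0 = 0 := by
  have : IsLocalMax z 0 := by
    filter_upwards [h.isOpen.mem_nhds h.zero_mem] with x hx
    exact h.le_zero x hx
  rw [pd, this.fderiv_eq_zero]
  rfl

lemma exists_entire_limit {ι : Type*} (𝒰 : Ultrafilter ι) {D : ι → Set R2} {P : ι → ℝ}
    {z : ι → R2 → ℝ} {A C c : ℝ} (hA0 : 0 ≤ A) (hP : Tendsto P 𝒰 atTop)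
    (hz : ∀ᶠ n in 𝒰, RescaledSol (D n) (P n) (z n))
    (hD : ∀ R, ∀ᶠ n in 𝒰, closedBall 0 R ⊆ D n)
    (hA : ∀ᶠ n in 𝒰, -z n 0 ≤ A) (hc : Tendsto (fun n => z n 0) 𝒰 (𝓝 c))
    (hmass : ∀ R, ∀ᶠ n in 𝒰, ∫ x in closedBall 0 R, -lap (z n) x ≤ C) :
    ∃ U : R2 → ℝ, ContDiff ℝ 2 U ∧ (∀ x, -lap U x = Real.exp (U x)) ∧ (∀ x, U x ≤ 0) ∧ U 0 = c ∧
      (∀ i, pd i U 0 = 0) ∧ (∀ R, ∫ x in closedBall 0 R, Real.exp (U x) ≤ C) ∧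
      ∀ R, ∀ n : ℕ, n ≤ 2 → TendstoUniformlyOn (fun k x => iteratedFDeriv ℝ n (z k) x)
        (fun x => iteratedFDeriv ℝ n U x) 𝒰 (closedBall 0 R) := by
  have hloc : ∀ R, ∃ B, 0 ≤ B ∧ ∀ᶠ n in 𝒰, ∀ x ∈ closedBall 0 R, z n x ∈ Icc (-B) 0 := fun R => by
    have hR : 0 < |R| + 1 := by positivity
    refine ⟨38 * A + 609 * (|R| + 1) ^ 2, by positivity, ?_⟩
    filter_upwards [hz, hD (4 * (|R| + 1)), hA] with n h1 h2 h3 x hx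
    have hx' : x ∈ closedBall (0:R2) (|R| + 1) :=
      closedBall_subset_closedBall (by linarith [le_abs_self R]) hx
    have hx'' : x ∈ closedBall (0:R2) (4 * (|R| + 1)) :=
      closedBall_subset_closedBall (by linarith) hx'
    exact ⟨by linarith [h1.neg_le hR h2 h3 hx'], h1.nonpos (h2 hx'')⟩
  have hreg : ∀ R, ∃ L, 0 ≤ L ∧ ∀ᶠ n in 𝒰, RegularBounds (z n) R L := fun R => by
    obtain ⟨B, hB0, hB⟩ := hloc (R + 5)
    refine ⟨2 * (2 * B + 1) * (2 * (2 * (2 * B + 1)) + 36), by positivity, ?_⟩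
    filter_upwards [hz, hD (R + 5), hB, hP.eventually_ge_atTop 2,
      hP.eventually_ge_atTop (2 * B)] with n h1 h2 h3 h4 h5
    exact h1.regularBounds hB0 h4 h5 h2 fun x hx => by linarith [(h3 x hx).1]
  have hCD : ∀ R, ∀ᶠ n in 𝒰, ∀ x ∈ closedBall 0 R, ContDiffAt ℝ 2 (z n) x := fun R => by
    filter_upwards [hz, hD R] with n h1 h2 x hx
    exact h1.contDiffAt x (h2 hx)
  obtain ⟨U, hUc, hU, hUu⟩ := exists_tendstoUniformlyOn_of_ultrafilter 𝒰 (g := z) fun R => by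
    obtain ⟨B, hB0, hB⟩ := hloc R
    obtain ⟨L, hL0, hL⟩ := hreg R
    refine ⟨max B L, le_max_of_le_left hB0, ?_⟩
    filter_upwards [hB, hL] with n h1 h2 x hx
    refine ⟨_root_.abs_le.2 ⟨by linarith [(h1 x hx).1, le_max_left B L],
      (h1 x hx).2.trans (le_max_of_le_left hB0)⟩, fun k hk =>
      (h2.abs_sub_le x hx k hk).trans ?_⟩
    gcongr; exact le_max_right _ _
  have h1 := fun i : Fin 2 => exists_tendstoUniformlyOn_of_ultrafilter 𝒰 (g := fun n => pd i (z n))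
    fun R => by
      obtain ⟨L, hL0, hL⟩ := hreg R
      refine ⟨L, hL0, ?_⟩
      filter_upwards [hL] with n h2 x hx
      exact ⟨(abs_pd_le _ _ _).trans (h2.norm_fderiv_le x hx), fun k hk =>
        h2.abs_pd_sub_le x hx k hk i⟩
  choose V hVc hV hVu using h1
  have h2 := fun i j : Fin 2 => exists_tendstoUniformlyOn_of_ultrafilter 𝒰
    (g := fun n => pd j (pd i (z n))) fun R => by
      obtain ⟨L, hL0, hL⟩ := hreg R
      refine ⟨L, hL0, ?_⟩
      filter_upwards [hL] with n h2 x hx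
      exact ⟨h2.abs_pd_pd_le x hx i j, fun k hk => h2.abs_pd_pd_sub_le x hx k hk i j⟩
  choose W hWc hW hWu using h2
  have hdU := hasFDerivAt_of_tendsto_pd (fun R => by
    filter_upwards [hCD R] with n hn x hx
    exact (hn x hx).differentiableAt (by norm_num)) hU (hVu 0) (hVu 1)
  have hdV := fun i => hasFDerivAt_of_tendsto_pd (fun R => by
    filter_upwards [hCD R] with n hn x hx
    exact (contDiffAt_pd (hn x hx) (by norm_num) i : ContDiffAt ℝ 1 _ _).differentiableAt
      one_ne_zero) (hV i) (hWu i 0) (hWu i 1)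
  have hpU : ∀ i, pd i U = V i := fun i => by
    ext x
    rw [pd, (hdU x).fderiv, coordForm_apply]
    fin_cases i <;> simp [ei]
  have hpV : ∀ i j, pd j (V i) = W i j := fun i j => by
    ext x
    rw [pd, (hdV i x).fderiv, coordForm_apply]
    fin_cases j <;> simp [ei]
  have hU2 : ContDiff ℝ 2 U := by
    refine contDiff_succ_of_pd (n := 1) (fun x => (hdU x).differentiableAt) fun i => ?_
    rw [hpU]
    refine contDiff_succ_of_pd (n := 0) (fun x => (hdV i x).differentiableAt) fun j => ?_
    rw [hpV]
    exact contDiff_zero.2 (hWc i j)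
  have hlapt : ∀ x, Tendsto (fun n => -lap (z n) x) 𝒰 (𝓝 (-lap U x)) := fun x => by
    simp only [lap_eq_pd, hpU, hpV]
    exact ((hW 0 0 x).add (hW 1 1 x)).neg
  have hUle : ∀ x, U x ≤ 0 := fun x => by
    obtain ⟨B, -, hB⟩ := hloc ‖x‖
    refine le_of_tendsto (hU x) ?_
    filter_upwards [hB] with n hn
    exact (hn x (by simp)).2
  have hEq : ∀ x, -lap U x = Real.exp (U x) := fun x => by
    obtain ⟨B, hB0, hB⟩ := hloc ‖x‖
    have hUB : U x ∈ Icc (-B) 0 := isClosed_Icc.mem_of_tendsto (hU x) (by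
      filter_upwards [hB] with n hn
      exact hn x (by simp))
    refine tendsto_nhds_unique (hlapt x) ?_
    have e1 := (tendsto_one_add_div_rpow_exp (U x)).comp hP
    have e2 : Tendsto (fun n => z n x - U x) 𝒰 (𝓝 0) := by
      simpa using (hU x).sub_const (U x)
    have e3 : Tendsto (fun n => -lap (z n) x - (1 + U x / P n) ^ P n) 𝒰 (𝓝 0) := by
      refine squeeze_zero_norm' ?_ (tendsto_zero_iff_norm_tendsto_zero.1 e2)
      filter_upwards [hz, hD ‖x‖, hB, hP.eventually_ge_atTop 2,
        hP.eventually_ge_atTop (2 * B)] with n k1 k2 k3 k4 k5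
      have hx : x ∈ closedBall (0:R2) ‖x‖ := by simp
      rw [k1.lap_eq_rpow (k2 hx) k5 (k3 x hx)]
      exact abs_rpow_sub_le (by linarith) (by linarith) le_rfl k5 (k3 x hx) hUB
    have e4 := e3.add e1
    simp only [Function.comp_def, sub_add_cancel, zero_add] at e4
    exact e4
  refine ⟨U, hU2, hEq, hUle, tendsto_nhds_unique (hU 0) hc, fun i => ?_, fun R => ?_,
    fun R n hn => tendstoUniformlyOn_iteratedFDeriv (hCD R) hU2 (hUu R)
      (fun i => by rw [hpU]; exact hVu i R) (fun i j => by rw [hpU, hpV]; exact hWu i j R) n hn⟩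
  · rw [hpU]
    refine tendsto_nhds_unique (hV i 0) ((tendsto_congr' ?_).2 tendsto_const_nhds)
    filter_upwards [hz] with n hn
    exact hn.pd_zero i
  · refine le_of_forall_pos_le_add fun ε hε => ?_
    set m := volume.real (closedBall (0:R2) R) with hm
    have hm0 : 0 ≤ m := measureReal_nonneg
    have u0 := Metric.tendstoUniformlyOn_iff.1 (hWu 0 0 R) (ε / (2 * (m + 1))) (by positivity)
    have u1 := Metric.tendstoUniformlyOn_iff.1 (hWu 1 1 R) (ε / (2 * (m + 1))) (by positivity)
    obtain ⟨n, k1, k2, k3, k4⟩ := (u0.and (u1.and ((hmass R).and (hCD R)))).exists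
    have hfin : volume (closedBall (0:R2) R) ≠ ⊤ := (isCompact_closedBall 0 R).measure_lt_top.ne
    have i1 : IntegrableOn (fun x => -lap (z n) x) (closedBall 0 R) := by
      refine ContinuousOn.integrableOn_compact (isCompact_closedBall 0 R) fun x hx => ?_
      simp only [lap_eq_pd]
      have := fun i => continuousAt_pd
        (contDiffAt_pd (k4 x hx) (by norm_num) i : ContDiffAt ℝ 1 _ x) i
      exact ((this 0).add (this 1)).neg.continuousWithinAt
    have i2 : IntegrableOn (fun _ : R2 => ε / (m + 1)) (closedBall 0 R) :=
      integrableOn_const hfin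
    calc ∫ x in closedBall 0 R, Real.exp (U x)
        ≤ ∫ x in closedBall 0 R, (-lap (z n) x + ε / (m + 1)) := by
          refine setIntegral_mono_on ?_ (i1.add i2) isClosed_closedBall.measurableSet fun x hx => ?_
          · exact (Real.continuous_exp.comp hUc).continuousOn.integrableOn_compact
              (isCompact_closedBall 0 R)
          · rw [← hEq x, lap_eq_pd, lap_eq_pd, hpU, hpU, hpV, hpV]
            have a0 := k1 x hx
            have a1 := k2 x hx
            rw [Real.dist_eq, abs_lt] at a0 a1
            have : ε / (m + 1) = ε / (2 * (m + 1)) + ε / (2 * (m + 1)) := by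
              field_simp; norm_num
            linarith [a0.1, a1.1]
      _ = (∫ x in closedBall 0 R, -lap (z n) x) + m * (ε / (m + 1)) := by
          rw [integral_add i1 i2, setIntegral_const, smul_eq_mul]
      _ ≤ C + ε := by
          have : m * (ε / (m + 1)) ≤ ε := by
            rw [mul_div_assoc', div_le_iff₀ (by positivity)]
            nlinarith
          linarith

lemma one_le_mul_inv_sqrt_sq {lam : ℝ} (h : 0 < lam) : 1 ≤ lam * ((√lam)⁻¹) ^ 2 := by
  rw [inv_pow, sq_sqrt h.le, mul_inv_cancel₀ h.ne']

lemma integrable_indicator_closedBall {f : R2 → ℝ} (hf : Continuous f) (R : ℝ) :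
    Integrable ((closedBall (0:R2) R).indicator f) :=
  (integrable_indicator_iff isClosed_closedBall.measurableSet).2
    (hf.continuousOn.integrableOn_compact (isCompact_closedBall 0 R))

lemma hasDerivAt_kavg_of_continuous {f : R2 → ℝ} (hf : Continuous f) {lam : ℝ} (h : 0 < lam) :
    HasDerivAt (kavg f) (∫ y, kernDeriv lam y * f y) lam := by
  set R := (√(lam / 2))⁻¹ with hR
  have hR0 : 0 < R := by positivity
  have h1 : 1 ≤ lam / 2 * R ^ 2 := one_le_mul_inv_sqrt_sq (by positivity)
  have h2 : ∀ l, lam / 2 < l → 1 ≤ l * R ^ 2 := fun l hl => h1.trans (by gcongr)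
  rw [← integral_kernDeriv_indicator hR0 (h2 lam (by linarith))]
  refine (hasDerivAt_kavg (integrable_indicator_closedBall hf R) h).congr_of_eventuallyEq ?_
  filter_upwards [lt_mem_nhds (show lam / 2 < lam by linarith)] with l hl
  exact (kavg_indicator hR0 (h2 l hl)).symm

lemma tendsto_kavg_of_continuous {f : R2 → ℝ} (hf : Continuous f) :
    Tendsto (kavg f) atTop (𝓝 (kmass * f 0)) := by
  have h0 : (closedBall (0:R2) 1).indicator f =ᶠ[𝓝 0] f := by
    filter_upwards [closedBall_mem_nhds (0:R2) one_pos] with x hx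
    exact indicator_of_mem hx f
  have := tendsto_kavg (hf.continuousAt.congr h0.symm) (integrable_indicator_closedBall hf 1)
  rw [h0.eq_of_nhds] at this
  refine this.congr' ?_
  filter_upwards [eventually_ge_atTop 1] with l hl
  exact kavg_indicator one_pos (by simpa using hl)

lemma kavg_bounds_of_lap {V : R2 → ℝ} {C : ℝ} (hV : ContDiff ℝ 2 V) (h0 : ∀ x, 0 ≤ lap V x)
    (hC : ∀ R, ∫ x in closedBall 0 R, lap V x ≤ C) {lam : ℝ} (h : 0 < lam) :
    (∫ y, kernDeriv lam y * V y) ∈ Icc (-(16 * lam)⁻¹ * C) 0 := by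
  have hR := one_le_mul_inv_sqrt_sq h
  set R := (√lam)⁻¹ with hRd
  have hR0 : 0 < R := by positivity
  have hlc : Continuous (lap V) := by
    have e : lap V = fun x => pd 0 (pd 0 V) x + pd 1 (pd 1 V) x := funext fun x => lap_eq_pd V x
    rw [e]
    have : ∀ i, Continuous (pd i (pd i V)) := fun i => continuous_iff_continuousAt.2 fun x =>
      continuousAt_pd (contDiffAt_pd hV.contDiffAt (by norm_num) i : ContDiffAt ℝ 1 _ x) i
    exact (this 0).add (this 1)
  rw [integral_kernDeriv_mul hR0 hR fun y _ => hV.contDiffAt]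
  have i1 : 0 ≤ ∫ y, kern 4 lam y * lap V y :=
    integral_nonneg fun y => mul_nonneg (kern_nonneg _ _ _) (h0 y)
  have i2 : ∫ y, kern 4 lam y * lap V y ≤ C := by
    refine le_trans ?_ (hC R)
    rw [← integral_indicator isClosed_closedBall.measurableSet]
    refine integral_mono ?_ (integrable_indicator_closedBall hlc R) fun y => ?_
    · exact integrable_mul_of_tsupport (continuous_kern _ _) (hasCompactSupport_kern 3 h)
        fun y _ => hlc.continuousAt
    · by_cases hy : y ∈ closedBall (0:R2) R
      · simp only [indicator_of_mem hy]
        exact mul_le_of_le_one_left (h0 y) (kern_le_one _ h.le y)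
      · have : kern 4 lam y = 0 := by
          by_contra hn
          exact hy (tsupport_kern_subset 3 hR0 hR (subset_closure hn))
        simp [indicator_of_notMem hy, this]
  have hp : 0 < (16 * lam)⁻¹ := by positivity
  constructor <;> nlinarith

/-- A nonnegative subharmonic function whose Laplacian has finite mass grows at most
logarithmically; we record the square root rate. -/
lemma exists_le_mul_sqrt {V : R2 → ℝ} {C : ℝ} (hV : ContDiff ℝ 2 V) (hV0 : ∀ x, 0 ≤ V x)
    (h0 : ∀ x, 0 ≤ lap V x) (hC : ∀ R, ∫ x in closedBall 0 R, lap V x ≤ C) :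
    ∃ a, 0 ≤ a ∧ ∀ R, 1 ≤ R → ∀ x, ‖x‖ ≤ R → V x ≤ a * √R := by
  have hk := kmass_pos
  have hC0 : 0 ≤ C := by
    have := hC 0
    refine le_trans ?_ this
    exact integral_nonneg fun x => h0 x
  have hanti : ∀ W : R2 → ℝ, ContDiff ℝ 2 W → (∀ x, 0 ≤ lap W x) →
      ∀ lam, 0 < lam → kmass * W 0 ≤ kavg W lam := fun W hW hl lam hlam => by
    have hA : AntitoneOn (kavg W) (Ici lam) := by
      refine antitoneOn_of_deriv_nonpos (convex_Ici _) (fun l hl' => ?_) (fun l hl' => ?_)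
        (fun l hl' => ?_)
      · exact (hasDerivAt_kavg_of_continuous hW.continuous
          (hlam.trans_le hl')).continuousAt.continuousWithinAt
      · rw [interior_Ici] at hl'
        exact (hasDerivAt_kavg_of_continuous hW.continuous
          (hlam.trans hl')).differentiableAt.differentiableWithinAt
      · rw [interior_Ici] at hl'
        have hl0 : 0 < l := hlam.trans hl'
        rw [(hasDerivAt_kavg_of_continuous hW.continuous hl0).deriv,
          integral_kernDeriv_mul (R := (√l)⁻¹) (by positivity) (one_le_mul_inv_sqrt_sq hl0)
            fun y _ => hW.contDiffAt]
        have i1 : 0 ≤ ∫ y, kern 4 l y * lap W y :=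
          integral_nonneg fun y => mul_nonneg (kern_nonneg _ _ _) (hl y)
        have : 0 < (16 * l)⁻¹ := by positivity
        nlinarith
    refine le_of_tendsto (tendsto_kavg_of_continuous hW.continuous) ?_
    filter_upwards [eventually_ge_atTop lam] with l hl'
    exact hA (mem_Ici.2 le_rfl) hl' hl'
  have hmono : ∀ lam, 0 < lam → lam ≤ 1 → kavg V lam ≤ kavg V 1 - C / 16 * Real.log lam := by
    intro lam hlam hlam1
    have hd : ∀ l, 0 < l → HasDerivAt (fun l => kavg V l + C / 16 * Real.log l)
        ((∫ y, kernDeriv l y * V y) + C / 16 * l⁻¹) l := fun l hl =>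
      (hasDerivAt_kavg_of_continuous hV.continuous hl).add
        ((Real.hasDerivAt_log hl.ne').const_mul _)
    have hM : MonotoneOn (fun l => kavg V l + C / 16 * Real.log l) (Icc lam 1) := by
      refine monotoneOn_of_deriv_nonneg (convex_Icc _ _) (fun l hl' => ?_) (fun l hl' => ?_)
        (fun l hl' => ?_)
      · exact (hd l (hlam.trans_le hl'.1)).continuousAt.continuousWithinAt
      · rw [interior_Icc] at hl'
        exact (hd l (hlam.trans hl'.1)).differentiableAt.differentiableWithinAt
      · rw [interior_Icc] at hl'
        have hl0 := hlam.trans hl'.1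
        rw [(hd l hl0).deriv]
        have := (kavg_bounds_of_lap hV h0 hC hl0).1
        rw [mul_inv] at this
        linarith
    have := hM (left_mem_Icc.2 hlam1) (right_mem_Icc.2 hlam1) hlam1
    simp only [Real.log_one, mul_zero, add_zero] at this
    linarith
  have hm : 0 ≤ kavg V 1 := integral_nonneg fun y =>
    mul_nonneg (mul_nonneg zero_le_one (kern_nonneg _ _ _)) (hV0 y)
  refine ⟨38 * (kavg V 1 + C / 2) / kmass, by positivity, fun R hR x hx => ?_⟩
  have hR0 : 0 < R := by linarith
  have a1 := hanti (fun y => V (x + y)) (hV.comp (contDiff_const.add contDiff_id))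
    (fun y => by rw [lap_comp_add_left]; exact h0 _) (R ^ 2)⁻¹ (by positivity)
  have a2 := kavg_translate_le hR0 hx (fun y _ => hV.continuous.continuousAt) fun y _ => hV0 y
  have a3 := hmono ((4 * R) ^ 2)⁻¹ (by positivity) (inv_le_one_of_one_le₀ (by nlinarith))
  have hs : 1 ≤ √R := Real.one_le_sqrt.2 hR
  have a4 : -Real.log ((4 * R) ^ 2)⁻¹ ≤ 8 * √R := by
    have e : (4 * R) ^ 2 = (2 * √R) ^ 4 := by
      have := Real.sq_sqrt hR0.le
      calc (4 * R) ^ 2 = 16 * R ^ 2 := by ring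
        _ = 16 * (√R ^ 2) ^ 2 := by rw [this]
        _ = _ := by ring
    rw [Real.log_inv, neg_neg, e, Real.log_pow]
    have := Real.log_le_sub_one_of_pos (show 0 < 2 * √R by positivity)
    push_cast
    linarith
  rw [add_zero] at a1
  rw [div_mul_eq_mul_div, le_div_iff₀ hk]
  have : C / 16 * (-Real.log ((4 * R) ^ 2)⁻¹) ≤ C / 16 * (8 * √R) := by gcongr
  nlinarith

lemma hasDerivAt_pd {f : R2 → ℝ} {x : R2} (hf : DifferentiableAt ℝ f x) (i : Fin 2) :
    HasDerivAt (fun t : ℝ => f (x + t • ei i)) (pd i f x) 0 := by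
  have := hasDerivAt_line (ei i) (u := f) (x := x) (t := 0) (by simpa using hf)
  simpa [pd] using this

lemma pd_comm {u : R2 → ℝ} {x : R2} (hu : ContDiffAt ℝ 2 u x) (i j : Fin 2) :
    pd j (pd i u) x = pd i (pd j u) x := by
  rw [pd_pd_eq hu, pd_pd_eq hu]
  exact (hu.isSymmSndFDerivAt (by simp)).eq _ _

/-- The real part of the quadratic differential attached to a solution of Liouville's equation. -/
def hopfRe (U : R2 → ℝ) (x : R2) : ℝ :=
  1 / 2 * (pd 0 (pd 0 U) x - pd 1 (pd 1 U) x) - 1 / 4 * (pd 0 U x ^ 2 - pd 1 U x ^ 2)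

/-- The imaginary part of the quadratic differential attached to a solution of Liouville's
equation, up to sign. -/
def hopfIm (U : R2 → ℝ) (x : R2) : ℝ := pd 0 (pd 1 U) x - 1 / 2 * (pd 0 U x * pd 1 U x)

lemma integral_hopf_eq_zero {U a b : R2 → ℝ} (hU : ContDiff ℝ 2 U)
    (hE : ∀ x, -lap U x = Real.exp (U x)) (ha : ContDiff ℝ 2 a) (hb : ContDiff ℝ 2 b)
    (hac : HasCompactSupport a) (hbc : HasCompactSupport b) :
    ∫ x, (hopfRe U x * (pd 0 a x - pd 1 b x) + hopfIm U x * (pd 1 a x + pd 0 b x)) = 0 := by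
  have hpU : ∀ i, ContDiff ℝ 1 (pd i U) := fun i => contDiff_pd hU (by norm_num) i
  have hpa : ∀ i, ContDiff ℝ 1 (pd i a) := fun i => contDiff_pd ha (by norm_num) i
  have hpb : ∀ i, ContDiff ℝ 1 (pd i b) := fun i => contDiff_pd hb (by norm_num) i
  have hU1 : ContDiff ℝ 1 U := hU.of_le (by norm_num)
  have ha1 : ContDiff ℝ 1 a := ha.of_le (by norm_num)
  have hb1 : ContDiff ℝ 1 b := hb.of_le (by norm_num)
  have hpac : ∀ i, HasCompactSupport (pd i a) := fun i =>
    hac.of_isClosed_subset (isClosed_tsupport _) (tsupport_pd_subset i a)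
  have hpbc : ∀ i, HasCompactSupport (pd i b) := fun i =>
    hbc.of_isClosed_subset (isClosed_tsupport _) (tsupport_pd_subset i b)
  set P : R2 → ℝ := fun x => pd 1 U x * pd 1 a x - pd 0 U x * pd 1 b x -
    1 / 2 * Real.exp (U x) * a x - 1 / 4 * (pd 0 U x * pd 0 U x - pd 1 U x * pd 1 U x) * a x -
    1 / 2 * (pd 0 U x * pd 1 U x) * b x with hP
  set Q : R2 → ℝ := fun x => -(pd 1 U x * pd 0 a x) + pd 0 U x * pd 0 b x -
    1 / 2 * Real.exp (U x) * b x + 1 / 4 * (pd 0 U x * pd 0 U x - pd 1 U x * pd 1 U x) * b x -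
    1 / 2 * (pd 0 U x * pd 1 U x) * a x with hQ
  have hPd : ContDiff ℝ 1 P := by
    have := Real.contDiff_exp.comp hU1
    have h1 := (hpU 0); have h2 := hpU 1
    have h3 := hpa 1; have h4 := hpb 1
    fun_prop
  have hQd : ContDiff ℝ 1 Q := by
    have := Real.contDiff_exp.comp hU1
    have h1 := (hpU 0); have h2 := hpU 1
    have h3 := hpa 0; have h4 := hpb 0
    fun_prop
  have hPc : HasCompactSupport P :=
    (((((hpac 1).mul_left).sub ((hpbc 1).mul_left)).sub hac.mul_left).sub hac.mul_left).sub
      hbc.mul_left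
  have hQc : HasCompactSupport Q :=
    (((((hpac 0).mul_left.neg).add ((hpbc 0).mul_left)).sub hbc.mul_left).add hbc.mul_left).sub
      hac.mul_left
  have key : ∀ x, hopfRe U x * (pd 0 a x - pd 1 b x) + hopfIm U x * (pd 1 a x + pd 0 b x) =
      pd 0 P x + pd 1 Q x := fun x => by
    have dU := hasDerivAt_pd (hU1.differentiable one_ne_zero x)
    have da := hasDerivAt_pd (ha1.differentiable one_ne_zero x)
    have db := hasDerivAt_pd (hb1.differentiable one_ne_zero x)
    have ddU := fun i => hasDerivAt_pd ((hpU i).differentiable one_ne_zero x)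
    have dda := fun i => hasDerivAt_pd ((hpa i).differentiable one_ne_zero x)
    have ddb := fun i => hasDerivAt_pd ((hpb i).differentiable one_ne_zero x)
    have e1 := (hasDerivAt_pd (hPd.differentiable one_ne_zero x) 0).unique
      (((((((ddU 1 0).mul (dda 1 0)).sub ((ddU 0 0).mul (ddb 1 0))).sub
        (((dU 0).exp.const_mul (1 / 2)).mul (da 0))).sub
        (((((ddU 0 0).mul (ddU 0 0)).sub ((ddU 1 0).mul (ddU 1 0))).const_mul (1 / 4)).mul
          (da 0))).sub ((((ddU 0 0).mul (ddU 1 0)).const_mul (1 / 2)).mul (db 0))))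
    have e2 := (hasDerivAt_pd (hQd.differentiable one_ne_zero x) 1).unique
      (((((((ddU 1 1).mul (dda 0 1)).neg.add ((ddU 0 1).mul (ddb 0 1))).sub
        (((dU 1).exp.const_mul (1 / 2)).mul (db 1))).add
        (((((ddU 0 1).mul (ddU 0 1)).sub ((ddU 1 1).mul (ddU 1 1))).const_mul (1 / 4)).mul
          (db 1))).sub ((((ddU 0 1).mul (ddU 1 1)).const_mul (1 / 2)).mul (da 1))))
    simp only [zero_smul, add_zero, Pi.mul_apply, Pi.sub_apply] at e1 e2
    have hl := hE x
    rw [lap_eq_pd] at hl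
    rw [e1, e2, hopfRe, hopfIm, ← hl, pd_comm hU.contDiffAt 0 1, pd_comm ha.contDiffAt 0 1,
      pd_comm hb.contDiffAt 0 1]
    ring
  simp only [key]
  have iP : Integrable (pd 0 P) := (contDiff_pd (m := 0) hPd (by norm_num) 0).continuous.integrable_of_hasCompactSupport
    (hPc.of_isClosed_subset (isClosed_tsupport _) (tsupport_pd_subset 0 P))
  have iQ : Integrable (pd 1 Q) := (contDiff_pd (m := 0) hQd (by norm_num) 1).continuous.integrable_of_hasCompactSupport
    (hQc.of_isClosed_subset (isClosed_tsupport _) (tsupport_pd_subset 1 Q))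
  rw [integral_add iP iQ, integral_pd_eq_zero hPd hPc, integral_pd_eq_zero hQd hQc, add_zero]

lemma pd_apply (i j : Fin 2) (y : R2) : pd i (fun y => y j) y = if i = j then 1 else 0 := by
  have : HasFDerivAt (fun y : R2 => y j) (EuclideanSpace.proj j : R2 →L[ℝ] ℝ) y :=
    (EuclideanSpace.proj j : R2 →L[ℝ] ℝ).hasFDerivAt
  rw [pd, this.fderiv]
  fin_cases i <;> fin_cases j <;> simp [ei]

lemma norm_sq_eq_coord (y : R2) : ‖y‖ ^ 2 = y 0 ^ 2 + y 1 ^ 2 := by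
  simp [EuclideanSpace.norm_sq_eq, Fin.sum_univ_two]

lemma pd_coord_mul_kern (i j : Fin 2) (lam : ℝ) (y : R2) :
    pd i (fun y => y j * kern 3 lam y) y =
      (if i = j then kern 3 lam y else 0) - 6 * lam * (y i * y j * kern 2 lam y) := by
  rw [pd_mul (by fun_prop) (((contDiff_kern 1 2 (by norm_num) lam).differentiable (by norm_num)) y),
    pd_apply, pd_kern]
  split_ifs <;> · norm_num; ring

lemma integral_kernDeriv_mul_hopf {U : R2 → ℝ} (hU : ContDiff ℝ 2 U)
    (hE : ∀ x, -lap U x = Real.exp (U x)) {lam : ℝ} (h : 0 < lam) :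
    ∫ y, kernDeriv lam y * hopfRe U y = 0 ∧ ∫ y, kernDeriv lam y * hopfIm U y = 0 := by
  have hq : ContDiff ℝ 2 (kern 3 lam) := contDiff_kern 2 2 le_rfl lam
  have hc : HasCompactSupport (kern 3 lam) := hasCompactSupport_kern 2 h
  have hx : ∀ j : Fin 2, ContDiff ℝ 2 fun y : R2 => y j * kern 3 lam y := fun j =>
    (contDiff_coord 2 j).mul hq
  have hxc : ∀ j : Fin 2, HasCompactSupport fun y : R2 => y j * kern 3 lam y := fun j =>
    hc.mul_left
  have hneg : ∀ i (y : R2), pd i (fun y => -(y 1 * kern 3 lam y)) y =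
      -pd i (fun y => y 1 * kern 3 lam y) y := fun i y => by
    rw [pd, fderiv_fun_neg]; rfl
  constructor
  · have := integral_hopf_eq_zero hU hE (hx 0) (hx 1).neg (hxc 0) (hxc 1).neg
    simp only [hneg, pd_coord_mul_kern] at this
    refine (mul_eq_zero.1 ((integral_const_mul (2:ℝ) _).symm.trans (Eq.trans ?_ this))).resolve_left
      two_ne_zero
    refine integral_congr_ae (Eventually.of_forall fun y => ?_)
    simp only [kernDeriv, norm_sq_eq_coord, ↓reduceIte, zero_ne_one, one_ne_zero]
    ring
  · have := integral_hopf_eq_zero hU hE (hx 1) (hx 0) (hxc 1) (hxc 0)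
    simp only [pd_coord_mul_kern] at this
    refine (mul_eq_zero.1 ((integral_const_mul (2:ℝ) _).symm.trans (Eq.trans ?_ this))).resolve_left
      two_ne_zero
    refine integral_congr_ae (Eventually.of_forall fun y => ?_)
    simp only [kernDeriv, norm_sq_eq_coord, ↓reduceIte, zero_ne_one, one_ne_zero]
    ring

lemma continuous_pd_pd {U : R2 → ℝ} (hU : ContDiff ℝ 2 U) (i j : Fin 2) :
    Continuous (pd j (pd i U)) :=
  (contDiff_pd (m := 0) (contDiff_pd (m := 1) hU (by norm_num) i) (by norm_num) j).continuous

lemma continuous_pd {U : R2 → ℝ} (hU : ContDiff ℝ 2 U) (i : Fin 2) : Continuous (pd i U) :=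
  (contDiff_pd (m := 1) hU (by norm_num) i).continuous

lemma continuous_hopfRe {U : R2 → ℝ} (hU : ContDiff ℝ 2 U) : Continuous (hopfRe U) := by
  have := continuous_pd_pd hU
  have := continuous_pd hU
  unfold hopfRe
  fun_prop

lemma continuous_hopfIm {U : R2 → ℝ} (hU : ContDiff ℝ 2 U) : Continuous (hopfIm U) := by
  have := continuous_pd_pd hU
  have := continuous_pd hU
  unfold hopfIm
  fun_prop

lemma kavg_eq_of_integral_kernDeriv_eq_zero {f : R2 → ℝ} (hf : Continuous f)
    (h0 : ∀ lam, 0 < lam → ∫ y, kernDeriv lam y * f y = 0) {lam : ℝ} (h : 0 < lam) :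
    kavg f lam = kmass * f 0 := by
  have hc : ∀ l ∈ Ioi (0:ℝ), kavg f l = kavg f lam := fun l hl => by
    refine (convex_Ioi (0:ℝ)).is_const_of_fderivWithin_eq_zero (𝕜 := ℝ) (f := kavg f)
      (fun s hs => (hasDerivAt_kavg_of_continuous hf hs).differentiableAt.differentiableWithinAt)
      (fun s hs => ?_) hl h
    rw [fderivWithin_of_isOpen isOpen_Ioi hs]
    have := hasDerivAt_kavg_of_continuous hf hs
    rw [h0 s hs] at this
    rw [this.hasFDerivAt.fderiv]
    ext; simp
  refine tendsto_nhds_unique (tendsto_const_nhds.congr' ?_) (tendsto_kavg_of_continuous hf)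
  filter_upwards [eventually_gt_atTop 0] with l hl
  exact (hc l hl).symm

lemma integral_mul_pd_pd {q W : R2 → ℝ} (hq : ContDiff ℝ 2 q) (hc : HasCompactSupport q)
    (hW : ContDiff ℝ 2 W) (i j : Fin 2) :
    ∫ x, q x * pd j (pd i W) x = ∫ x, pd i (pd j q) x * W x := by
  have hc' : HasCompactSupport (pd j q) :=
    hc.of_isClosed_subset (isClosed_tsupport _) (tsupport_pd_subset j q)
  rw [integral_mul_pd (hq.of_le (by norm_num)) hc
      (fun x _ => (contDiff_pd (m := 1) hW (by norm_num) i).contDiffAt) j,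
    integral_mul_pd (contDiff_pd (m := 1) hq (by norm_num) j) hc'
      (fun x _ => (hW.of_le (by norm_num)).contDiffAt) i, neg_neg]

lemma abs_pd_pd_kern_le (i j : Fin 2) {lam : ℝ} (h : 0 ≤ lam) (y : R2) :
    |pd i (pd j (kern 3 lam)) y| ≤ 30 * lam := by
  have e : pd j (kern 3 lam) = fun y => -(6 * lam) * (y j * kern 2 lam y) := by
    funext y
    rw [pd_kern j 1]
    push_cast
    ring
  have hd : DifferentiableAt ℝ (kern 2 lam) y :=
    (contDiff_kern 1 1 le_rfl lam).differentiable (by norm_num) y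
  have e2 : pd i (pd j (kern 3 lam)) y = -(6 * lam) * ((if i = j then kern 2 lam y else 0) -
      4 * (lam * (y i * y j) * kern 1 lam y)) := by
    have := pd_const_mul_add (v := fun y => y j * kern 2 lam y) (x := y) (-(6 * lam)) 0 i
    simp only [zero_add] at this
    rw [e, this, pd_mul (by fun_prop) hd, pd_apply, pd_kern i 0]
    split_ifs <;> · push_cast; ring
  have k2 : |if i = j then kern 2 lam y else 0| ≤ 1 := by
    split_ifs
    · rw [abs_of_nonneg (kern_nonneg _ _ _)]; exact kern_le_one _ h y
    · simp
  have k1 : |lam * (y i * y j) * kern 1 lam y| ≤ 1 := by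
    refine le_trans ?_ (mul_norm_sq_mul_kern_le 0 h y)
    rw [abs_mul, abs_mul, abs_mul, abs_of_nonneg h, abs_of_nonneg (kern_nonneg _ _ _), sq]
    gcongr
    · exact kern_nonneg _ _ _
    · exact abs_apply_le_norm y i
    · exact abs_apply_le_norm y j
  rw [e2, abs_mul, abs_neg, abs_of_nonneg (by positivity : 0 ≤ 6 * lam)]
  have : |(if i = j then kern 2 lam y else 0) - 4 * (lam * (y i * y j) * kern 1 lam y)| ≤ 5 := by
    rw [_root_.abs_le] at k1 k2 ⊢
    constructor <;> linarith [k1.1, k1.2, k2.1, k2.2]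
  nlinarith

lemma abs_integral_kern_mul_pd_pd_le {W : R2 → ℝ} {R N : ℝ} (hR : 0 < R) (hW : ContDiff ℝ 2 W)
    (hN : ∀ x, ‖x‖ ≤ R → |W x| ≤ N) (i j : Fin 2) :
    |∫ y, kern 3 (R ^ 2)⁻¹ y * pd j (pd i W) y| ≤
      30 * volume.real (closedBall (0:R2) 1) * N := by
  have hl : 0 < (R ^ 2)⁻¹ := by positivity
  have hR1 : 1 ≤ (R ^ 2)⁻¹ * R ^ 2 := by rw [inv_mul_cancel₀ (by positivity)]
  have hs : ∀ y, y ∉ closedBall (0:R2) R → pd i (pd j (kern 3 (R ^ 2)⁻¹)) y * W y = 0 :=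
    fun y hy => by
      rw [image_eq_zero_of_notMem_tsupport fun hn => hy (tsupport_kern_subset 2 hR hR1
        (tsupport_pd_subset _ _ (tsupport_pd_subset _ _ hn))), zero_mul]
  rw [integral_mul_pd_pd (contDiff_kern 2 2 le_rfl _) (hasCompactSupport_kern 2 hl) hW,
    ← setIntegral_eq_integral_of_forall_compl_eq_zero hs, ← Real.norm_eq_abs]
  refine (norm_setIntegral_le_of_norm_le_const (C := 30 * (R ^ 2)⁻¹ * N)
    (isCompact_closedBall 0 R).measure_lt_top fun y hy => ?_).trans (le_of_eq ?_)
  · rw [norm_mul, Real.norm_eq_abs, Real.norm_eq_abs]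
    exact mul_le_mul (abs_pd_pd_kern_le i j hl.le y) (hN y (by simpa using hy)) (abs_nonneg _)
      (by positivity)
  · rw [Measure.addHaar_real_closedBall volume (0:R2) hR.le, Measure.addHaar_real_closedBall volume (0:R2) zero_le_one]
    simp only [finrank_euclideanSpace, Fintype.card_fin]
    field_simp

lemma pd_sq {U : R2 → ℝ} (hU : ContDiff ℝ 2 U) (i : Fin 2) (x : R2) :
    pd i (pd i fun y => U y * U y) x = 2 * pd i U x ^ 2 + 2 * (U x * pd i (pd i U) x) := by
  have hd : Differentiable ℝ U := hU.differentiable (by norm_num)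
  have hd1 : Differentiable ℝ (pd i U) :=
    (contDiff_pd (m := 1) hU (by norm_num) i).differentiable (by norm_num)
  have e : pd i (fun y => U y * U y) = fun y => 0 + 2 * (U y * pd i U y) := by
    funext y
    rw [pd_mul (hd y) (hd y)]
    ring
  rw [e, pd_const_mul_add, pd_mul (hd x) (hd1 x)]
  ring

lemma integral_kern_mul_grad_sq_le {U : R2 → ℝ} {R N : ℝ} (hR : 0 < R) (hU : ContDiff ℝ 2 U)
    (hE : ∀ x, -lap U x = Real.exp (U x)) (hU0 : ∀ x, U x ≤ 0)
    (hN : ∀ x, ‖x‖ ≤ R → |U x * U x| ≤ N) :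
    ∫ y, kern 3 (R ^ 2)⁻¹ y * (pd 0 U y ^ 2 + pd 1 U y ^ 2) ≤
      30 * volume.real (closedBall (0:R2) 1) * N := by
  have hl : 0 < (R ^ 2)⁻¹ := by positivity
  have hW : ContDiff ℝ 2 fun y => U y * U y := hU.mul hU
  have b0 := (_root_.abs_le.1 (abs_integral_kern_mul_pd_pd_le hR hW hN 0 0)).2
  have b1 := (_root_.abs_le.1 (abs_integral_kern_mul_pd_pd_le hR hW hN 1 1)).2
  have hi : ∀ g : R2 → ℝ, Continuous g → Integrable fun y => kern 3 (R ^ 2)⁻¹ y * g y :=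
    fun g hg => integrable_mul_of_tsupport (continuous_kern _ _) (hasCompactSupport_kern 2 hl)
      fun y _ => hg.continuousAt
  have i0 := hi _ (continuous_pd_pd hW 0 0)
  have i1 := hi _ (continuous_pd_pd hW 1 1)
  have ig := hi (fun y => pd 0 U y ^ 2 + pd 1 U y ^ 2)
    (((continuous_pd hU 0).pow 2).add ((continuous_pd hU 1).pow 2))
  have : 2 * ∫ y, kern 3 (R ^ 2)⁻¹ y * (pd 0 U y ^ 2 + pd 1 U y ^ 2) ≤
      (∫ y, kern 3 (R ^ 2)⁻¹ y * pd 0 (pd 0 fun y => U y * U y) y) +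
      ∫ y, kern 3 (R ^ 2)⁻¹ y * pd 1 (pd 1 fun y => U y * U y) y := by
    rw [← integral_const_mul, ← integral_add i0 i1]
    refine integral_mono (ig.const_mul 2) (i0.add i1) fun y => ?_
    simp only [pd_sq hU]
    have hl := hE y
    rw [lap_eq_pd] at hl
    have h1 : 0 ≤ kern 3 (R ^ 2)⁻¹ y * (U y * (pd 0 (pd 0 U) y + pd 1 (pd 1 U) y)) :=
      mul_nonneg (kern_nonneg _ _ _)
        (mul_nonneg_of_nonpos_of_nonpos (hU0 y) (by linarith [Real.exp_pos (U y)]))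
    linarith
  linarith

/-- The quadratic differential of a solution of Liouville's equation of slow growth vanishes
at the origin. -/
lemma hopf_zero {U : R2 → ℝ} {a : ℝ} (hU : ContDiff ℝ 2 U)
    (hE : ∀ x, -lap U x = Real.exp (U x)) (hU0 : ∀ x, U x ≤ 0) (ha : 0 ≤ a)
    (hg : ∀ R, 1 ≤ R → ∀ x, ‖x‖ ≤ R → |U x| ≤ a * √R) : hopfRe U 0 = 0 ∧ hopfIm U 0 = 0 := by
  set v := volume.real (closedBall (0:R2) 1) with hv
  have hv0 : 0 ≤ v := measureReal_nonneg
  have hint : ∀ R, 0 < R → ∀ g : R2 → ℝ, Continuous g →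
      Integrable fun y => kern 3 (R ^ 2)⁻¹ y * g y := fun R hR g hg =>
    integrable_mul_of_tsupport (continuous_kern _ _) (hasCompactSupport_kern 2 (by positivity))
      fun y _ => hg.continuousAt
  have aux : ∀ S : R2 → ℝ, Continuous S →
      (∀ lam, 0 < lam → ∫ y, kernDeriv lam y * S y = 0) →
      (∀ R, 1 ≤ R → |∫ y, kern 3 (R ^ 2)⁻¹ y * S y| ≤ 30 * v * (a * √R + a ^ 2 * R)) →
      S 0 = 0 := by
    intro S hS h0 hb
    by_contra hne
    have hk := kmass_pos
    have hpos : 0 < kmass * |S 0| := mul_pos hk (abs_pos.2 hne)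
    set B := 30 * v * (a + a ^ 2) with hB
    have hB0 : 0 ≤ B := by positivity
    set R := 1 + B / (kmass * |S 0|) with hR
    have hR1 : 1 ≤ R := by simp only [hR, le_add_iff_nonneg_right]; positivity
    have hR0 : 0 < R := by linarith
    have h1 : kavg S (R ^ 2)⁻¹ = (R ^ 2)⁻¹ * ∫ y, kern 3 (R ^ 2)⁻¹ y * S y := by
      rw [kavg, ← integral_const_mul]
      simp only [mul_assoc]
    have h2 := kavg_eq_of_integral_kernDeriv_eq_zero hS h0 (lam := (R ^ 2)⁻¹) (by positivity)
    have h3 : kmass * |S 0| ≤ (R ^ 2)⁻¹ * (B * R) := by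
      calc kmass * |S 0| = |kmass * S 0| := by rw [abs_mul, abs_of_pos hk]
        _ = (R ^ 2)⁻¹ * |∫ y, kern 3 (R ^ 2)⁻¹ y * S y| := by
          rw [← h2, h1, abs_mul, abs_of_pos (by positivity)]
        _ ≤ (R ^ 2)⁻¹ * (B * R) := by
          gcongr
          refine (hb R hR1).trans ?_
          have hs : √R ≤ R := Real.sqrt_le_iff.2 ⟨hR0.le, by nlinarith⟩
          have : a * √R ≤ a * R := by gcongr
          rw [hB, mul_assoc _ (a + a ^ 2)]
          gcongr
          linarith
    have h4 : (R ^ 2)⁻¹ * (B * R) = B / R := by field_simp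
    rw [h4, le_div_iff₀ hR0, hR, mul_add, mul_div_cancel₀ _ hpos.ne'] at h3
    linarith
  have hgrad : ∀ R, 1 ≤ R → ∫ y, kern 3 (R ^ 2)⁻¹ y * (pd 0 U y ^ 2 + pd 1 U y ^ 2) ≤
      30 * v * (a ^ 2 * R) := fun R hR => by
    refine integral_kern_mul_grad_sq_le (by linarith) hU hE hU0 fun x hx => ?_
    have h1 := hg R hR x hx
    rw [abs_mul]
    calc |U x| * |U x| ≤ (a * √R) * (a * √R) := by gcongr
      _ = a ^ 2 * (√R * √R) := by ring
      _ = a ^ 2 * R := by rw [Real.mul_self_sqrt (by linarith)]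
  have hquad : ∀ R, 1 ≤ R → ∀ g : R2 → ℝ, Continuous g →
      (∀ y, |g y| ≤ pd 0 U y ^ 2 + pd 1 U y ^ 2) →
      |∫ y, kern 3 (R ^ 2)⁻¹ y * g y| ≤ 30 * v * (a ^ 2 * R) := fun R hR g hgc hb => by
    refine le_trans ?_ (hgrad R hR)
    rw [← Real.norm_eq_abs]
    refine norm_integral_le_of_norm_le (hint R (by linarith) _
      (((continuous_pd hU 0).pow 2).add ((continuous_pd hU 1).pow 2)))
      (Eventually.of_forall fun y => ?_)
    rw [norm_mul, Real.norm_eq_abs, Real.norm_eq_abs, abs_of_nonneg (kern_nonneg _ _ _)]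
    exact mul_le_mul_of_nonneg_left (hb y) (kern_nonneg _ _ _)
  have hmul : Continuous fun y => pd 0 U y * pd 1 U y := (continuous_pd hU 0).mul (continuous_pd hU 1)
  have hsub : Continuous fun y => pd 0 U y ^ 2 - pd 1 U y ^ 2 :=
    ((continuous_pd hU 0).pow 2).sub ((continuous_pd hU 1).pow 2)
  constructor
  · refine aux _ (continuous_hopfRe hU) (fun l hl => (integral_kernDeriv_mul_hopf hU hE hl).1)
      fun R hR => ?_
    have hR0 : 0 < R := by linarith
    have e : ∫ y, kern 3 (R ^ 2)⁻¹ y * hopfRe U y =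
        1 / 2 * ((∫ y, kern 3 (R ^ 2)⁻¹ y * pd 0 (pd 0 U) y) -
          ∫ y, kern 3 (R ^ 2)⁻¹ y * pd 1 (pd 1 U) y) -
        1 / 4 * ∫ y, kern 3 (R ^ 2)⁻¹ y * (pd 0 U y ^ 2 - pd 1 U y ^ 2) := by
      have i0 := hint R hR0 _ (continuous_pd_pd hU 0 0)
      have i1 := hint R hR0 _ (continuous_pd_pd hU 1 1)
      have i2 := hint R hR0 _ hsub
      have i01 : Integrable fun y => kern 3 (R ^ 2)⁻¹ y * pd 0 (pd 0 U) y -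
        kern 3 (R ^ 2)⁻¹ y * pd 1 (pd 1 U) y := i0.sub i1
      rw [← integral_sub i0 i1, ← integral_const_mul, ← integral_const_mul,
        ← integral_sub (i01.const_mul _) (i2.const_mul _)]
      refine integral_congr_ae (Eventually.of_forall fun y => ?_)
      simp only [hopfRe]
      ring
    have b0 := abs_integral_kern_mul_pd_pd_le hR0 hU (hg R hR) 0 0
    have b1 := abs_integral_kern_mul_pd_pd_le hR0 hU (hg R hR) 1 1
    have b2 := hquad R hR _ hsub fun y => by
      rw [_root_.abs_le]; constructor <;> nlinarith [sq_nonneg (pd 0 U y), sq_nonneg (pd 1 U y)]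
    rw [← hv] at b0 b1
    rw [e]
    have hp : 0 ≤ 30 * v * (a ^ 2 * R) := by positivity
    rw [_root_.abs_le] at b0 b1 b2 ⊢
    constructor <;> linarith [b0.1, b0.2, b1.1, b1.2, b2.1, b2.2]
  · refine aux _ (continuous_hopfIm hU) (fun l hl => (integral_kernDeriv_mul_hopf hU hE hl).2)
      fun R hR => ?_
    have hR0 : 0 < R := by linarith
    have e : ∫ y, kern 3 (R ^ 2)⁻¹ y * hopfIm U y =
        (∫ y, kern 3 (R ^ 2)⁻¹ y * pd 0 (pd 1 U) y) -
        1 / 2 * ∫ y, kern 3 (R ^ 2)⁻¹ y * (pd 0 U y * pd 1 U y) := by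
      have i0 := hint R hR0 _ (continuous_pd_pd hU 1 0)
      have i2 := hint R hR0 _ hmul
      rw [← integral_const_mul, ← integral_sub i0 (i2.const_mul _)]
      refine integral_congr_ae (Eventually.of_forall fun y => ?_)
      simp only [hopfIm]
      ring
    have b0 := abs_integral_kern_mul_pd_pd_le hR0 hU (hg R hR) 1 0
    have b2 := hquad R hR _ hmul fun y => by
      rw [_root_.abs_le]
      constructor <;> nlinarith [sq_nonneg (pd 0 U y + pd 1 U y), sq_nonneg (pd 0 U y - pd 1 U y),
        sq_nonneg (pd 0 U y), sq_nonneg (pd 1 U y)]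
    rw [← hv] at b0
    rw [e]
    have hp : 0 ≤ 30 * v * (a ^ 2 * R) := by positivity
    rw [_root_.abs_le] at b0 b2 ⊢
    constructor <;> linarith [b0.1, b0.2, b2.1, b2.2]

lemma eq_of_pd_eq_zero {f : R2 → ℝ} (hf : Differentiable ℝ f) (h : ∀ i x, pd i f x = 0) (x : R2) :
    f x = f 0 := by
  refine is_const_of_fderiv_eq_zero (𝕜 := ℝ) hf (fun y => ?_) x 0
  rw [fderiv_eq_coordForm, h, h]
  ext v
  simp [coordForm_apply]

lemma eq_of_pd_dir_eq_zero {f : R2 → ℝ} (hf : Differentiable ℝ f) {i : Fin 2}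
    (h : ∀ x, pd i f x = 0) (t : ℝ) (x : R2) : f (t • ei i + x) = f x := by
  have hd : ∀ s : ℝ, HasDerivAt (fun s : ℝ => f (x + s • ei i)) 0 s := fun s => by
    have := hasDerivAt_line (ei i) (hf (x + s • ei i))
    rwa [show fderiv ℝ f (x + s • ei i) (ei i) = 0 from h _] at this
  have := is_const_of_deriv_eq_zero (fun s => (hd s).differentiableAt) (fun s => (hd s).deriv) t 0
  simpa [add_comm] using this

lemma exists_quadratic_of_pd {g : R2 → ℝ} (hg : ContDiff ℝ 2 g)
    (h01 : ∀ x, pd 0 (pd 1 g) x = 0) (hd : ∀ x, pd 0 (pd 0 g) x = pd 1 (pd 1 g) x)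
    (h0 : ∀ i, pd i g 0 = 0) (x : R2) : g x = g 0 + pd 0 (pd 0 g) 0 / 2 * ‖x‖ ^ 2 := by
  have h10 : ∀ x, pd 1 (pd 0 g) x = 0 := fun x => by rw [pd_comm hg.contDiffAt, h01]
  have hG : ∀ i, Differentiable ℝ (pd i g) := fun i =>
    (contDiff_pd (m := 1) hg (by norm_num) i).differentiable one_ne_zero
  set k := pd 0 (pd 0 g) 0 with hk
  have t0 : ∀ (t : ℝ) (y : R2), pd 0 (pd 0 g) (t • ei 1 + y) = pd 0 (pd 0 g) y := fun t y => by
    have e : (fun y => pd 0 g (t • ei 1 + y)) = pd 0 g :=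
      funext fun y => eq_of_pd_dir_eq_zero (hG 0) h10 t y
    have := congrFun (pd_comp_add_left (pd 0 g) (t • ei 1) 0) y
    rw [e] at this
    exact this.symm
  have t1 : ∀ (t : ℝ) (y : R2), pd 1 (pd 1 g) (t • ei 0 + y) = pd 1 (pd 1 g) y := fun t y => by
    have e : (fun y => pd 1 g (t • ei 0 + y)) = pd 1 g :=
      funext fun y => eq_of_pd_dir_eq_zero (hG 1) h01 t y
    have := congrFun (pd_comp_add_left (pd 1 g) (t • ei 0) 1) y
    rw [e] at this
    exact this.symm
  have hH : ∀ y, pd 0 (pd 0 g) y = k := fun y => by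
    conv_lhs => rw [eq_coord_sum y]
    rw [add_comm, t0, hd]
    have := t1 (y 0) 0
    rw [add_zero] at this
    rw [this, ← hd]
  have hH' : ∀ i j y, pd j (pd i g) y = if j = i then k else 0 := fun i j y => by
    fin_cases i <;> fin_cases j
    · exact hH y
    · exact h10 y
    · exact h01 y
    · exact (hd y).symm.trans (hH y)
  have hG' : ∀ i y, pd i g y = k * y i := fun i y => by
    have hdf : Differentiable ℝ fun y : R2 => pd i g y - k * y i :=
      (hG i).sub (by fun_prop)
    have := eq_of_pd_eq_zero hdf (fun j z => ?_) y
    · simp only [h0, PiLp.zero_apply, mul_zero, sub_zero] at this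
      linarith
    · have c1 := (hasDerivAt_pd (hdf z) j).unique ((hasDerivAt_pd (hG i z) j).sub
        ((hasDerivAt_pd (f := fun y : R2 => y i) (by fun_prop) j).const_mul k))
      rw [c1, hH', pd_apply]
      split_ifs <;> simp
  have hdn : Differentiable ℝ fun y : R2 => ‖y‖ ^ 2 := fun y =>
    (contDiff_norm_sq ℝ (n := 1)).differentiable one_ne_zero y
  have hdf : Differentiable ℝ fun y : R2 => g y - k / 2 * ‖y‖ ^ 2 :=
    (hg.differentiable (by norm_num)).sub (hdn.const_mul _)
  have := eq_of_pd_eq_zero hdf (fun j z => ?_) x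
  · simp only [norm_zero] at this
    linarith
  · have c1 := (hasDerivAt_pd (hdf z) j).unique
      ((hasDerivAt_pd (hg.differentiable (by norm_num) z) j).sub
        ((hasDerivAt_pd (hdn z) j).const_mul (k / 2)))
    rw [c1, hG', pd_norm_sq]
    ring

/-- Classification of the solutions of Liouville's equation of finite mass (with a
normalization at the origin). -/
lemma eq_bubble {U : R2 → ℝ} {C : ℝ} (hU : ContDiff ℝ 2 U)
    (hE : ∀ x, -lap U x = Real.exp (U x)) (hU0 : ∀ x, U x ≤ 0) (h0 : ∀ i, pd i U 0 = 0)
    (hC : ∀ R, ∫ x in closedBall 0 R, Real.exp (U x) ≤ C) : U = bubble (Real.exp (U 0)) := by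
  have hV : ∀ x, lap (fun y => -U y) x = Real.exp (U x) := fun x => by
    rw [lap_neg hU.contDiffAt, hE]
  obtain ⟨a, ha, hg⟩ := exists_le_mul_sqrt (V := fun y => -U y) hU.neg
    (fun x => by linarith [hU0 x]) (fun x => by rw [hV]; positivity) (by simpa only [hV] using hC)
  have hS : ∀ x, hopfRe U x = 0 ∧ hopfIm U x = 0 := fun x => by
    have := hopf_zero (U := fun y => U (x + y)) (a := a * √(1 + ‖x‖))
      (hU.comp (contDiff_const.add contDiff_id)) (fun y => by rw [lap_comp_add_left]; exact hE _)
      (fun y => hU0 _) (by positivity) fun R hR y hy => by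
        have hn : ‖x + y‖ ≤ (1 + ‖x‖) * R := by
          nlinarith [norm_add_le x y, norm_nonneg x]
        have := hg ((1 + ‖x‖) * R) (by nlinarith [norm_nonneg x]) (x + y) hn
        rw [Real.sqrt_mul (by positivity), ← mul_assoc] at this
        rwa [abs_of_nonpos (hU0 _)]
    simpa only [hopfRe, hopfIm, pd_comp_add_left, add_zero] using this
  set g : R2 → ℝ := fun y => Real.exp (-(1 / 2) * U y) with hgd
  have hgC : ContDiff ℝ 2 g := Real.contDiff_exp.comp (contDiff_const.mul hU)
  have hUd : Differentiable ℝ U := hU.differentiable (by norm_num)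
  have hUd1 : ∀ i, Differentiable ℝ (pd i U) := fun i =>
    (contDiff_pd (m := 1) hU (by norm_num) i).differentiable one_ne_zero
  have hg1 : ∀ i, pd i g = fun y => -(1 / 2) * (g y * pd i U y) := fun i => funext fun y => by
    have := (hasDerivAt_pd (hgC.differentiable (by norm_num) y) i).unique
      ((hasDerivAt_pd (hUd y) i).const_mul (-(1 / 2))).exp
    rw [this, zero_smul, add_zero]
    simp only [hgd]
    ring
  have hg2 : ∀ i j y, pd j (pd i g) y =
      -(1 / 2) * g y * (pd j (pd i U) y - 1 / 2 * (pd i U y * pd j U y)) := fun i j y => by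
    have := (hasDerivAt_pd ((contDiff_pd (m := 1) hgC (by norm_num) i).differentiable
      one_ne_zero y) j)
    rw [hg1 i] at this ⊢
    have := this.unique (((hasDerivAt_pd (hgC.differentiable (by norm_num) y) j).mul
      (hasDerivAt_pd (hUd1 i y) j)).const_mul (-(1 / 2)))
    rw [this, zero_smul, add_zero, hg1 j]
    ring
  have hquad := exists_quadratic_of_pd hgC (fun x => ?_) (fun x => ?_) (fun i => ?_)
  · funext x
    have hE0 := hE 0
    rw [lap_eq_pd] at hE0
    have hd0 : pd 0 (pd 0 U) 0 = pd 1 (pd 1 U) 0 := by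
      have := (hS 0).1
      rw [hopfRe, h0, h0] at this
      linarith
    have hk : pd 0 (pd 0 g) 0 = 1 / 4 * g 0 * Real.exp (U 0) := by
      rw [hg2, h0]
      rw [← hd0] at hE0
      linear_combination (1 / 4 * g 0) * hE0
    have hx := hquad x
    rw [hk] at hx
    have hsq : ∀ y, g y ^ 2 * Real.exp (U y) = 1 := fun y => by
      simp only [hgd, ← Real.exp_nat_mul, ← Real.exp_add]
      rw [Real.exp_eq_one_iff]
      push_cast
      ring
    have hmu := Real.exp_pos (U 0)
    have hpos : 0 < 1 + Real.exp (U 0) * ‖x‖ ^ 2 / 8 := by positivity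
    have hx' : g x = g 0 * (1 + Real.exp (U 0) * ‖x‖ ^ 2 / 8) := by rw [hx]; ring
    rw [bubble]
    conv_lhs => rw [← Real.log_exp (U x)]
    congr 1
    rw [eq_div_iff (by positivity)]
    have s1 := hsq x
    have s0 := hsq 0
    rw [hx'] at s1
    linear_combination Real.exp (U 0) * s1 -
      Real.exp (U x) * (1 + Real.exp (U 0) * ‖x‖ ^ 2 / 8) ^ 2 * s0
  · rw [hg2]
    have := (hS x).2
    rw [hopfIm] at this
    linear_combination (-(1 / 2) * g x) * this
  · rw [hg2, hg2]
    have := (hS x).1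
    rw [hopfRe] at this
    linear_combination (-g x) * this
  · rw [hg1]
    simp [h0]

lemma bubble_nonpos {m : ℝ} (h0 : 0 < m) (h1 : m ≤ 1) (x : R2) : bubble m x ≤ 0 := by
  have hp : 1 ≤ 1 + m * ‖x‖ ^ 2 / 8 := by
    have : 0 ≤ m * ‖x‖ ^ 2 / 8 := by positivity
    linarith
  refine Real.log_nonpos (by positivity) ?_
  rw [div_le_one (by positivity)]
  nlinarith

lemma exp_bubble {m : ℝ} (h0 : 0 < m) (x : R2) :
    Real.exp (bubble m x) = m / (1 + m * ‖x‖ ^ 2 / 8) ^ 2 :=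
  Real.exp_log (by positivity)

lemma bubble_eq {m : ℝ} (h0 : 0 < m) :
    bubble m = fun x => Real.log m - 2 * Real.log (1 + m / 8 * ‖x‖ ^ 2) := by
  funext x
  have hp : 0 < 1 + m * ‖x‖ ^ 2 / 8 := by positivity
  rw [bubble, Real.log_div h0.ne' (by positivity), Real.log_pow, mul_div_right_comm]
  norm_num

lemma neg_lap_bubble {m : ℝ} (h0 : 0 < m) (x : R2) :
    -lap (bubble m) x = Real.exp (bubble m x) := by
  have hn : Differentiable ℝ fun y : R2 => ‖y‖ ^ 2 := fun y =>
    (contDiff_norm_sq ℝ (n := 1)).differentiable one_ne_zero y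
  have hpos : ∀ y : R2, 0 < 1 + m / 8 * ‖y‖ ^ 2 := fun y => by positivity
  have hd : Differentiable ℝ (bubble m) := by
    rw [bubble_eq h0]
    exact fun y => (((hn y).const_mul _).const_add 1).log (hpos y).ne' |>.const_mul 2
      |>.const_sub _
  have h1 : ∀ i, pd i (bubble m) = fun y => -(m / 2) * (y i / (1 + m / 8 * ‖y‖ ^ 2)) := fun i =>
    funext fun y => by
      have e := hasDerivAt_pd (hd y) i
      rw [bubble_eq h0] at e ⊢
      rw [e.unique (((((hasDerivAt_pd (hn y) i).const_mul (m / 8)).const_add 1).log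
        (by simpa using (hpos y).ne')).const_mul 2 |>.const_sub _), pd_norm_sq, zero_smul,
        add_zero]
      field_simp
      ring
  have h2 : ∀ i, pd i (pd i (bubble m)) x = -(m / 2) *
      ((1 * (1 + m / 8 * ‖x‖ ^ 2) - x i * (m / 8 * (2 * x i))) /
        (1 + m / 8 * ‖x‖ ^ 2) ^ 2) := fun i => by
    have hc : DifferentiableAt ℝ (fun y : R2 => y i) x := by fun_prop
    have hq : DifferentiableAt ℝ (fun y : R2 => 1 + m / 8 * ‖y‖ ^ 2) x :=
      ((hn x).const_mul _).const_add 1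
    have hquo : DifferentiableAt ℝ (fun y : R2 => y i / (1 + m / 8 * ‖y‖ ^ 2)) x :=
      (hc.fun_mul (hq.fun_inv (hpos x).ne')).congr_of_eventuallyEq
        (Eventually.of_forall fun y => div_eq_mul_inv _ _)
    have hdd : DifferentiableAt ℝ
        (fun y : R2 => -(m / 2) * (y i / (1 + m / 8 * ‖y‖ ^ 2))) x :=
      hquo.const_mul _
    rw [h1 i, (hasDerivAt_pd hdd i).unique (((hasDerivAt_pd hc i).div
      (((hasDerivAt_pd (hn x) i).const_mul (m / 8)).const_add 1)
        (by simpa using (hpos x).ne')).const_mul (-(m / 2))), pd_norm_sq, pd_apply, zero_smul,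
      add_zero, if_pos rfl]
  rw [lap_eq_pd, h2, h2, exp_bubble h0]
  have hp := hpos x
  have hs := norm_sq_eq_coord x
  have e : 1 + m * ‖x‖ ^ 2 / 8 = 1 + m / 8 * ‖x‖ ^ 2 := by ring
  rw [e, ← mul_add, ← add_div, mul_div_assoc', ← neg_div]
  congr 1
  rw [hs]
  ring

lemma integral_exp_bubble {m : ℝ} (h0 : 0 < m) : ∫ x, Real.exp (bubble m x) = 8 * π := by
  simp only [exp_bubble h0]
  rw [integral_fun_norm_addHaar volume fun r : ℝ => m / (1 + m * r ^ 2 / 8) ^ 2]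
  have hd : ∀ r : ℝ, HasDerivAt (fun r : ℝ => -4 / (1 + m * r ^ 2 / 8))
      (r * (m / (1 + m * r ^ 2 / 8) ^ 2)) r := fun r => by
    have hp : 0 < 1 + m * r ^ 2 / 8 := by positivity
    have := ((((hasDerivAt_pow 2 r).const_mul m).div_const 8).const_add 1).fun_inv hp.ne'
      |>.const_mul (-4)
    refine (this.congr_deriv ?_).congr_of_eventuallyEq
      (Eventually.of_forall fun s => by simp [div_eq_mul_inv])
    push_cast
    field_simp
    ring
  have ht : Tendsto (fun r : ℝ => -4 / (1 + m * r ^ 2 / 8)) atTop (𝓝 0) := by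
    refine Tendsto.const_div_atTop ?_ _
    refine tendsto_atTop_add_const_left _ _ (Tendsto.atTop_div_const (by norm_num) ?_)
    exact (tendsto_pow_atTop two_ne_zero).const_mul_atTop h0
  have hI := integral_Ioi_of_hasDerivAt_of_nonneg' (a := 0) (fun r _ => hd r)
    (fun r hr => by have : 0 < r := hr; positivity) ht
  have hv : volume.real (ball (0:R2) 1) = π := by
    simp [Measure.real, EuclideanSpace.volume_ball_fin_two, ENNReal.toReal_ofReal, pi_pos.le]
  rw [hv]
  simp only [finrank_euclideanSpace, Fintype.card_fin, Nat.add_one_sub_one, pow_one, smul_eq_mul]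
  rw [hI]
  simp
  ring

lemma tendsto_bubble_of_rescaledSol {D : ℕ → Set R2} {P : ℕ → ℝ} {z : ℕ → R2 → ℝ} {A C c : ℝ}
    (hA0 : 0 ≤ A) (hP : Tendsto P atTop atTop) (hz : ∀ᶠ n in atTop, RescaledSol (D n) (P n) (z n))
    (hD : ∀ R, ∀ᶠ n in atTop, closedBall 0 R ⊆ D n) (hA : ∀ᶠ n in atTop, -z n 0 ≤ A)
    (hc : Tendsto (fun n => z n 0) atTop (𝓝 c))
    (hmass : ∀ R, ∀ᶠ n in atTop, ∫ x in closedBall 0 R, -lap (z n) x ≤ C) :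
    TendstoC2loc atTop D z (bubble (Real.exp c)) := by
  intro K hK
  obtain ⟨R, hR⟩ := hK.isBounded.subset_closedBall (0:R2)
  refine ⟨(hD R).mono fun n hn => hR.trans hn, fun n hn V hV => ?_⟩
  refine mem_iff_ultrafilter.2 fun 𝒰 h𝒰 => ?_
  obtain ⟨U, hU, hE, hU0, hUc, hd, hC, ht⟩ := exists_entire_limit 𝒰 hA0 (hP.mono_left h𝒰)
    (h𝒰 hz) (fun R => h𝒰 (hD R)) (h𝒰 hA) (hc.mono_left h𝒰) fun R => h𝒰 (hmass R)
  have := eq_bubble hU hE hU0 hd hC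
  rw [hUc] at this
  rw [← this]
  exact ((ht R n hn).mono hR) V hV

lemma isBounded_rescaled {Ω : Set R2} (hΩ : Bornology.IsBounded Ω) {ε : ℝ} (hε : 0 < ε) (k : R2) :
    Bornology.IsBounded {x | ε • x + k ∈ Ω} := by
  obtain ⟨R, hR⟩ := hΩ.subset_closedBall (0:R2)
  refine isBounded_closedBall.subset (t := closedBall (0:R2) ((R + ‖k‖) / ε)) fun x hx => ?_
  have h1 := hR hx
  rw [mem_closedBall_zero_iff] at h1 ⊢
  have h2 : ‖ε • x‖ ≤ ‖ε • x + k‖ + ‖k‖ := by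
    simpa using norm_sub_le (ε • x + k) k
  rw [norm_smul, Real.norm_of_nonneg hε.le] at h2
  rw [le_div_iff₀ hε]
  linarith

lemma IsSolution.contDiffAt {Ω : Set R2} {p : ℝ} {u : R2 → ℝ} (h : IsSolution Ω p u)
    (hop : IsOpen Ω) {x : R2} (hx : x ∈ Ω) : ContDiffAt ℝ 2 u x :=
  (h.1 x hx).contDiffAt (hop.mem_nhds hx)

lemma IsSolution.one_le_rpow_mul_sq {Ω : Set R2} {p R : ℝ} {u : R2 → ℝ} {k : R2}
    (h : IsSolution Ω p u) (hop : IsOpen Ω) (hp : 1 < p) (hΩ : Ω ⊆ closedBall 0 R) (hk : k ∈ Ω)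
    (hu0 : 0 < u k) (hu : ∀ x ∈ Ω, |u x| ≤ u k) : 1 ≤ u k ^ (p - 1) * R ^ 2 := by
  have hpow : 0 < u k ^ (p - 1) := Real.rpow_pos_of_pos hu0 _
  have := le_of_abs_lap_le hop (N := u k ^ (p - 1) * u k) (by positivity) hΩ h.2.1.continuousOn
    (fun x hx => h.contDiffAt hop hx) h.2.2.2 (fun x hx => by
      rw [← abs_neg, h.2.2.1 x hx, abs_mul, abs_of_nonneg (Real.rpow_nonneg (abs_nonneg _) _)]
      have := hu x hx
      have h1 : |u x| ^ (p - 1) ≤ u k ^ (p - 1) :=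
        Real.rpow_le_rpow (abs_nonneg _) this (by linarith)
      gcongr) hk
  refine le_of_mul_le_mul_left ?_ hu0
  linarith

lemma eventually_half_le_of_rpow {M : ℝ → ℝ} {R : ℝ} (hM : ∀ p > (1:ℝ), 0 < M p)
    (h : ∀ p > (1:ℝ), 1 ≤ M p ^ (p - 1) * R ^ 2) : ∀ᶠ p in atTop, 1 / 2 ≤ M p := by
  have ht : Tendsto (fun p : ℝ => (1 / 2 : ℝ) ^ (p - 1) * R ^ 2) atTop (𝓝 (0 * R ^ 2)) :=
    ((tendsto_rpow_atTop_of_base_lt_one (1 / 2) (by norm_num) (by norm_num)).comp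
      (tendsto_atTop_add_const_right atTop (-1 : ℝ) tendsto_id)).mul_const _
  rw [zero_mul] at ht
  filter_upwards [ht.eventually (gt_mem_nhds one_pos), eventually_gt_atTop 1] with p hp hp1
  by_contra hlt
  push Not at hlt
  have h1 : M p ^ (p - 1) ≤ (1 / 2 : ℝ) ^ (p - 1) :=
    Real.rpow_le_rpow (hM p hp1).le hlt.le (by linarith)
  have := h p hp1
  nlinarith [mul_le_mul_of_nonneg_right h1 (sq_nonneg R)]

theorem stmt12
    (Ω : Set R2) (hne : Ω.Nonempty) (hop : IsOpen Ω)
    (hbdd : Bornology.IsBounded Ω) (hconn : IsConnected Ω) (hsm : SmoothBoundary Ω)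
    (u : ℝ → R2 → ℝ)
    (hsol : ∀ p > (1:ℝ), IsSolution Ω p (u p))
    (hnod : ∀ p > (1:ℝ), IsNodal Ω (u p))
    (xp xm : ℝ → R2)
    (hxpmem : ∀ p > (1:ℝ), xp p ∈ Ω)
    (hxpmax : ∀ p > (1:ℝ), ∀ x ∈ Ω, u p x ≤ u p (xp p))
    (hxmmem : ∀ p > (1:ℝ), xm p ∈ Ω)
    (hxmmin : ∀ p > (1:ℝ), ∀ x ∈ Ω, u p (xm p) ≤ u p x)
    (hcomp : ∀ p > (1:ℝ), -u p (xm p) ≤ u p (xp p))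
    (hA : CondA Ω u) (K : ℝ) (hK : 0 ≤ K)
    (hB : Tendsto (fun p : ℝ => p * (u p (xp p) + u p (xm p))) atTop (𝓝 K)) :
    ∀ pn : ℕ → ℝ, Tendsto pn atTop atTop →
      ∃ φ : ℕ → ℕ, StrictMono φ ∧ ∃ μ : ℝ, 0 < μ ∧ μ ≤ 1 ∧
        TendstoC2loc atTop
          (fun n : ℕ => {x : R2 | eps u xp (pn (φ n)) • x + xm (pn (φ n)) ∈ Ω})
          (fun n : ℕ => zm u xp xm (pn (φ n))) (bubble μ) ∧
        (∀ x : R2, -lap (bubble μ) x = Real.exp (bubble μ x)) ∧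
        (∀ x : R2, bubble μ x ≤ 0) ∧
        (∫ x : R2, Real.exp (bubble μ x)) = 8 * π ∧
        (K = 0 → μ = 1) := by
  obtain ⟨R₀, hR₀⟩ := hbdd.subset_closedBall (0:R2)
  have hM : ∀ p > (1:ℝ), 0 < u p (xp p) := fun p hp => by
    obtain ⟨⟨x, hx, hx0⟩, -⟩ := hnod p hp
    exact hx0.trans_le (hxpmax p hp x hx)
  have habs : ∀ p > (1:ℝ), ∀ x ∈ Ω, |u p x| ≤ u p (xp p) := fun p hp x hx =>
    _root_.abs_le.2 ⟨by linarith [hxmmin p hp x hx, hcomp p hp], hxpmax p hp x hx⟩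
  have hlow : ∀ p > (1:ℝ), 1 ≤ u p (xp p) ^ (p - 1) * R₀ ^ 2 := fun p hp =>
    (hsol p hp).one_le_rpow_mul_sq hop hp hR₀ (hxpmem p hp) (hM p hp) (habs p hp)
  have hhalf := eventually_half_le_of_rpow hM hlow
  have hpM : ∀ p > (1:ℝ), 0 < p * u p (xp p) ^ (p - 1) := fun p hp =>
    mul_pos (by linarith) (Real.rpow_pos_of_pos (hM p hp) _)
  have hε : ∀ p > (1:ℝ), 0 < eps u xp p := fun p hp =>
    one_div_pos.2 (Real.sqrt_pos.2 (hpM p hp))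
  have hε2 : ∀ p > (1:ℝ), p * u p (xp p) ^ (p - 1) * eps u xp p ^ 2 = 1 := fun p hp => by
    rw [eps, div_pow, Real.sq_sqrt (hpM p hp).le, one_pow, mul_one_div_cancel (hpM p hp).ne']
  have hres : ∀ p > (1:ℝ), RescaledSol {x | eps u xp p • x + xm p ∈ Ω} p (zm u xp xm p) :=
    fun p hp => rescaledSol_of_isSolution hop hp (hsol p hp) (hM p hp) (hε p hp) (hε2 p hp)
      (hxmmem p hp) (hxmmin p hp) (habs p hp)
  have hεt : Tendsto (eps u xp) atTop (𝓝 0) := by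
    have ht : Tendsto (fun p : ℝ => |R₀| / √p) atTop (𝓝 0) :=
      Tendsto.const_div_atTop Real.tendsto_sqrt_atTop _
    refine squeeze_zero' ?_ ?_ ht
    · filter_upwards [eventually_gt_atTop 1] with p hp using (hε p hp).le
    · filter_upwards [eventually_gt_atTop 1] with p hp
      have hp0 : 0 < p := by linarith
      rw [le_div_iff₀ (Real.sqrt_pos.2 hp0)]
      refine abs_le_of_sq_le_sq' ?_ (abs_nonneg _) |>.2
      rw [mul_pow, Real.sq_sqrt hp0.le, sq_abs]
      have h1 := hlow p hp
      have h2 := hε2 p hp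
      have h3 : 0 ≤ p * eps u xp p ^ 2 := by positivity
      nlinarith [mul_le_mul_of_nonneg_left h1 h3]
  have hz0 : ∀ p, zm u xp xm p 0 = -(p * (u p (xp p) + u p (xm p)) / u p (xp p)) := fun p => by
    rw [zm, smul_zero, zero_add]
    ring
  have hz0le : ∀ᶠ p in atTop, -zm u xp xm p 0 ≤ 2 * (p * (u p (xp p) + u p (xm p))) ∧
      zm u xp xm p 0 ≤ 0 := by
    filter_upwards [hhalf, eventually_gt_atTop 1] with p h1 hp
    have h2 : 0 ≤ p * (u p (xp p) + u p (xm p)) :=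
      mul_nonneg (by linarith) (by linarith [hcomp p hp])
    rw [hz0, neg_neg]
    refine ⟨?_, neg_nonpos.2 (div_nonneg h2 (hM p hp).le)⟩
    rw [div_le_iff₀ (hM p hp)]
    nlinarith
  have hzA : ∀ᶠ p in atTop, zm u xp xm p 0 ∈ Icc (-(2 * (K + 1))) 0 := by
    filter_upwards [hz0le, hB.eventually (gt_mem_nhds (show K < K + 1 by linarith))] with p h1 h2
    exact ⟨by linarith [h1.1], h1.2⟩
  obtain ⟨C, hC0, hC⟩ := exists_deriv_truncation_le
  set E := 16 * π * Real.exp 1 with hE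
  have hE0 : 0 < E := by positivity
  have hmass : ∀ R, ∀ᶠ p in atTop, closedBall 0 (4 * (|R| + 1)) ⊆ {x | eps u xp p • x + xm p ∈ Ω} →
      ∫ x in closedBall 0 R, -lap (zm u xp xm p) x ≤ C * (4 * (E + 1)) := fun R => by
    filter_upwards [eventually_gt_atTop 1, hhalf, hzA,
      hA.eventually (gt_mem_nhds (show E < E + 1 by linarith)),
      hA.eventually (lt_mem_nhds hE0),
      eventually_ge_atTop (4 * (38 * (2 * (K + 1)) + 609 * (|R| + 1) ^ 2))]
      with p hp h1 h2 h3 h4 h5 hD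
    have hp0 : 0 < p := by linarith
    have hR1 : 0 < |R| + 1 := by positivity
    have hint : IntegrableOn (fun x => ‖gradient (u p) x‖ ^ 2) Ω := by
      by_contra hn
      rw [integral_undef hn, mul_zero] at h4
      exact lt_irrefl _ h4
    have hgrad := integral_gradient_rescaled (p := p) (M := u p (xp p)) (k := xm p) hop (hε p hp)
      (fun x hx => ((hsol p hp).contDiffAt hop hx).differentiableAt (by norm_num)) hint
    have hsub : closedBall (0:R2) R ⊆ closedBall 0 (|R| + 1) :=
      closedBall_subset_closedBall (by linarith [le_abs_self R])
    refine ((hres p hp).setIntegral_neg_lap_le hC (isBounded_rescaled hbdd (hε p hp) _) hgrad.1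
      isClosed_closedBall.measurableSet
      (hsub.trans ((closedBall_subset_closedBall (by linarith)).trans hD)) fun x hx => ?_).trans ?_
    · have := (hres p hp).neg_le hR1 hD (show _ ≤ 2 * (K + 1) by linarith [h2.1]) (hsub hx)
      linarith
    · refine (congrArg (C / p * ·) hgrad.2).le.trans ?_
      have e : C / p * ((p / u p (xp p)) ^ 2 * ∫ x in Ω, ‖gradient (u p) x‖ ^ 2) =
          C * ((p * ∫ x in Ω, ‖gradient (u p) x‖ ^ 2) / u p (xp p) ^ 2) := by
        have := hM p hp
        field_simp
      show C / p * ((p / u p (xp p)) ^ 2 * ∫ x in Ω, ‖gradient (u p) x‖ ^ 2) ≤ _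
      rw [e]
      refine mul_le_mul_of_nonneg_left ?_ hC0
      rw [div_le_iff₀ (pow_pos (hM p hp) 2)]
      have h6 : 1 / 4 ≤ u p (xp p) ^ 2 := by nlinarith
      have h7 : (E + 1) * 1 ≤ (E + 1) * (4 * u p (xp p) ^ 2) :=
        mul_le_mul_of_nonneg_left (by linarith) (by linarith)
      linarith
  intro pn hpn
  obtain ⟨c, hc, φ, hφ, hcφ⟩ := (isCompact_Icc (a := -(2 * (K + 1))) (b := (0:ℝ))).tendsto_subseq'
    (hpn.eventually hzA).frequently
  have hq : Tendsto (fun n => pn (φ n)) atTop atTop := hpn.comp hφ.tendsto_atTop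
  have hz' := (hq.eventually (eventually_gt_atTop 1)).mono fun n hn => hres _ hn
  have hA' : ∀ᶠ n in atTop, -zm u xp xm (pn (φ n)) 0 ≤ 2 * (K + 1) :=
    (hq.eventually hzA).mono fun n hn => by linarith [hn.1]
  have hD' := eventually_closedBall_subset_rescaled (hsm.hasArcs hbdd) hq (hεt.comp hq)
    (hq.eventually ((eventually_gt_atTop 1).mono fun p hp => hε p hp)) hz' hA'
  have hlim := tendsto_bubble_of_rescaledSol (by linarith) hq hz' hD' hA' hcφ fun R => by
    filter_upwards [hq.eventually (hmass R), hD' (4 * (|R| + 1))] with n h1 h2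
    exact h1 h2
  have hμ : Real.exp c ≤ 1 := Real.exp_le_one_iff.2 hc.2
  refine ⟨φ, hφ, Real.exp c, Real.exp_pos c, hμ, hlim, neg_lap_bubble (Real.exp_pos c),
    bubble_nonpos (Real.exp_pos c) hμ, integral_exp_bubble (Real.exp_pos c), fun hK0 => ?_⟩
  have h0 : Tendsto (fun p => zm u xp xm p 0) atTop (𝓝 0) := by
    have h1 : Tendsto (fun p => -(2 * (p * (u p (xp p) + u p (xm p))))) atTop (𝓝 0) := by
      simpa [hK0] using (hB.const_mul 2).neg
    refine tendsto_of_tendsto_of_tendsto_of_le_of_le' h1 tendsto_const_nhds ?_ ?_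
    · filter_upwards [hz0le] with p hp
      linarith [hp.1]
    · filter_upwards [hz0le] with p hp using hp.2
  rw [tendsto_nhds_unique hcφ (h0.comp hq), Real.exp_zero]
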